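/- arXiv:2502.02388 — 4 statements merged into one kernel-verified Lean document; each statement's English description precedes it below -/
import Mathlib

section
/- (Improved Berezin–Li–Yau inequality with measure-dependent remainder, case γ = 1, variational form.) For every dimension d ≥ 1 there exist constants c, c' > 0 with the following property: for every open set Ω ⊆ ℝ^d of finite Lebesgue measure, every Λ > 0, every N ∈ ℕ and every family φ_1, …, φ_N of smooth compactly supported functions on ℝ^d, each with support contained in Ω and orthonormal in L²(ℝ^d), one has Σ_{j=1}^N ( Λ − ∫_{ℝ^d} |∇φ_j(x)|² dx ) ≤ L^sc_{1,d} · |Ω| · Λ^{1+d/2} · (1 − c e^{−c' √Λ |Ω|^{1/d}}). (This is the variational formulation of the bound Tr(−Δ_Ω^D − Λ)_− ≤ L^sc_{1,d}|Ω|Λ^{1+d/2}(1 − c e^{−c'√Λ |Ω|^{1/d}}).) -/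
open MeasureTheory Real
open scoped ENNReal

/-- The semiclassical constant `L^sc_{1,d} = Γ(2)/((4π)^{d/2} Γ(2 + d/2))`. -/
noncomputable def semiclassicalConst (d : ℕ) : ℝ :=
  Real.Gamma 2 / ((4 * π) ^ ((d : ℝ) / 2) * Real.Gamma (2 + (d : ℝ) / 2))

/-- The Dirichlet energy density `|∇φ(x)|² = Σ_k |∂_k φ(x)|²` of a function
`φ : ℝ^d → ℂ`. -/
noncomputable def gradSq (d : ℕ) (φ : EuclideanSpace ℝ (Fin d) → ℂ)
    (x : EuclideanSpace ℝ (Fin d)) : ℝ :=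
  ∑ k : Fin d, ‖fderiv ℝ φ x (EuclideanSpace.single k 1)‖ ^ 2


open scoped FourierTransform SchwartzMap LineDeriv

namespace BLY

lemma schwartz_sq_integrable {V : Type*} [NormedAddCommGroup V] [InnerProductSpace ℝ V]
    [FiniteDimensional ℝ V] [MeasurableSpace V] [BorelSpace V] (f : 𝓢(V, ℂ)) :
    Integrable (fun x => ‖f x‖ ^ 2) := by
  have := (f.memLp 2 volume).integrable_norm_pow (by norm_num)
  simpa using this

lemma norm_sq_eq_sum {d : ℕ} (k : EuclideanSpace ℝ (Fin d)) : ‖k‖ ^ 2 = ∑ m, (k m) ^ 2 := by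
  rw [EuclideanSpace.norm_sq_eq]; simp

lemma norm_fourier_deriv {d : ℕ} (f : 𝓢(EuclideanSpace ℝ (Fin d), ℂ)) (m : Fin d)
    (k : EuclideanSpace ℝ (Fin d)) :
    ‖𝓕 (∂_{(EuclideanSpace.single m (1:ℝ))} f) k‖ ^ 2 = 4 * π ^ 2 * (k m) ^ 2 * ‖𝓕 f k‖ ^ 2 := by
  rw [SchwartzMap.fourier_lineDerivOp_eq]
  have : (fun x : EuclideanSpace ℝ (Fin d) =>
    inner ℝ x (EuclideanSpace.single m (1:ℝ))).HasTemperateGrowth := by fun_prop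
  have e : inner ℝ k (EuclideanSpace.single m (1:ℝ)) = k m := by
    simp [EuclideanSpace.inner_single_right]
  simp [this, abs_of_pos Real.pi_pos, mul_pow, e]
  ring

lemma weight_integrable {d : ℕ} (f : 𝓢(EuclideanSpace ℝ (Fin d), ℂ)) :
    Integrable (fun k => 4 * π ^ 2 * ‖k‖ ^ 2 * ‖𝓕 f k‖ ^ 2) := by
  have : (fun k => 4 * π ^ 2 * ‖k‖ ^ 2 * ‖𝓕 f k‖ ^ 2) =
      fun k => ∑ m : Fin d, ‖𝓕 (∂_{(EuclideanSpace.single m (1:ℝ))} f) k‖ ^ 2 := by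
    ext k
    simp_rw [norm_fourier_deriv, norm_sq_eq_sum, Finset.mul_sum, Finset.sum_mul]
  rw [this]
  exact integrable_finsetSum _ fun m _ => schwartz_sq_integrable _

lemma integral_gradSq {d : ℕ} (f : 𝓢(EuclideanSpace ℝ (Fin d), ℂ)) :
    ∫ x, gradSq d f x = ∫ k, 4 * π ^ 2 * ‖k‖ ^ 2 * ‖𝓕 f k‖ ^ 2 := by
  have : (fun k => 4 * π ^ 2 * ‖k‖ ^ 2 * ‖𝓕 f k‖ ^ 2) =
      fun k => ∑ m : Fin d, ‖𝓕 (∂_{(EuclideanSpace.single m (1:ℝ))} f) k‖ ^ 2 := by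
    ext k
    simp_rw [norm_fourier_deriv, norm_sq_eq_sum, Finset.mul_sum, Finset.sum_mul]
  rw [this, integral_finsetSum _ fun m _ => schwartz_sq_integrable _]
  simp_rw [SchwartzMap.integral_norm_sq_fourier, gradSq]
  rw [← integral_finsetSum _ fun m _ => schwartz_sq_integrable _]
  simp_rw [SchwartzMap.lineDerivOp_apply_eq_fderiv]

/-- Fourier transform of the modulated translate difference. -/
lemma fourier_translate {V : Type*} [NormedAddCommGroup V] [InnerProductSpace ℝ V]
    [FiniteDimensional ℝ V] [MeasurableSpace V] [BorelSpace V] (f : 𝓢(V, ℂ)) (y k : V) :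
    𝓕 (f.compSubConstCLM ℂ (-y)) k = (𝐞 (inner ℝ y k) : ℂ) * 𝓕 f k := by
  have h := congrFun (VectorFourier.fourierIntegral_comp_add_right 𝐞 (volume : Measure V) (innerₗ V) (f : V → ℂ) y) k
  rw [SchwartzMap.fourier_coe, SchwartzMap.fourier_coe]
  have e : ((f.compSubConstCLM ℂ (-y) : 𝓢(V,ℂ)) : V → ℂ) = (f : V → ℂ) ∘ (fun v => v + y) := by
    ext x; simp
  rw [e]
  exact h

lemma norm_char_sub_one (t : ℝ) : ‖(𝐞 t : ℂ) - 1‖ ^ 2 ≤ (2 * π * t) ^ 2 := by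
  rw [Real.fourierChar_apply]
  have := Real.norm_exp_I_mul_ofReal_sub_one_le (x := 2 * π * t)
  rw [mul_comm Complex.I] at this
  have h2 : ‖(2 * π * t)‖ ^ 2 = (2 * π * t)^2 := by rw [Real.norm_eq_abs, sq_abs]
  rw [← h2]
  gcongr

/-- Main translation estimate. -/
lemma translate_est {d : ℕ} (f : 𝓢(EuclideanSpace ℝ (Fin d), ℂ))
    (y ξ : EuclideanSpace ℝ (Fin d)) (Λ : ℝ) (hξ : 4 * π ^ 2 * ‖ξ‖ ^ 2 ≤ Λ) :
    ∫ x, ‖(𝐞 (-(inner ℝ y ξ)) : ℂ) * f (x + y) - f x‖ ^ 2 ≤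
      2 * ‖y‖ ^ 2 * ((∫ k, 4 * π ^ 2 * ‖k‖ ^ 2 * ‖𝓕 f k‖ ^ 2) + Λ * ∫ x, ‖f x‖ ^ 2) := by
  set g : 𝓢(EuclideanSpace ℝ (Fin d), ℂ) :=
    (𝐞 (-(inner ℝ y ξ)) : ℂ) • (f.compSubConstCLM ℂ (-y)) - f with hg
  have h1 : ∀ x, (𝐞 (-(inner ℝ y ξ)) : ℂ) * f (x + y) - f x = g x := by
    intro x; simp [hg]
  have hF : ∀ k, 𝓕 g k = ((𝐞 (inner ℝ y (k - ξ)) : ℂ) - 1) * 𝓕 f k := by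
    intro k
    rw [hg, ← FourierTransform.fourierCLM_apply (R := ℂ), map_sub, map_smul,
      FourierTransform.fourierCLM_apply, FourierTransform.fourierCLM_apply]
    simp only [sub_apply, smul_apply, fourier_translate, smul_eq_mul]
    rw [inner_sub_right, sub_eq_add_neg (inner ℝ y k), AddChar.map_add_eq_mul, Circle.coe_mul]
    ring
  simp_rw [h1]
  rw [← SchwartzMap.integral_norm_sq_fourier, ← SchwartzMap.integral_norm_sq_fourier f,
    ← integral_const_mul, ← integral_add (weight_integrable f)
      ((schwartz_sq_integrable (𝓕 f)).const_mul _), ← integral_const_mul]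
  refine integral_mono (schwartz_sq_integrable _) (((weight_integrable f).add
      ((schwartz_sq_integrable (𝓕 f)).const_mul _)).const_mul _) ?_
  intro k
  simp only [hF, norm_mul, mul_pow]
  have a1 := norm_char_sub_one (inner ℝ y (k - ξ))
  have a2 : (inner ℝ y (k - ξ)) ^ 2 ≤ ‖y‖ ^ 2 * ‖k - ξ‖ ^ 2 := by
    rw [← mul_pow, ← sq_abs]
    gcongr
    exact abs_real_inner_le_norm _ _
  have a3 : ‖k - ξ‖ ^ 2 ≤ 2 * (‖k‖ ^ 2 + ‖ξ‖ ^ 2) := by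
    have := norm_sub_le k ξ
    calc ‖k - ξ‖ ^ 2 ≤ (‖k‖ + ‖ξ‖) ^ 2 := by gcongr
      _ ≤ _ := by nlinarith [sq_nonneg (‖k‖ - ‖ξ‖)]
  have a4 : ‖(𝐞 (inner ℝ y (k - ξ)) : ℂ) - 1‖ ^ 2 ≤
      2 * ‖y‖ ^ 2 * (4 * π ^ 2 * ‖k‖ ^ 2 + Λ) := by
    calc _ ≤ _ := a1
      _ = 4 * π ^ 2 * (inner ℝ y (k - ξ)) ^ 2 := by ring
      _ ≤ 4 * π ^ 2 * (‖y‖ ^ 2 * (2 * (‖k‖ ^ 2 + ‖ξ‖ ^ 2))) := by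
        gcongr
        exact a2.trans (by gcongr)
      _ = 2 * ‖y‖ ^ 2 * (4 * π ^ 2 * ‖k‖ ^ 2 + 4 * π ^ 2 * ‖ξ‖ ^ 2) := by ring
      _ ≤ _ := by gcongr
  calc _ ≤ 2 * ‖y‖ ^ 2 * (4 * π ^ 2 * ‖k‖ ^ 2 + Λ) * ‖𝓕 f k‖ ^ 2 := by gcongr
    _ = _ := by ring

end BLY

namespace BLY

/-- `L¹` distance of the indicator function of `Ω` and its translate. -/
noncomputable def shiftDist {d : ℕ} (Ω : Set (EuclideanSpace ℝ (Fin d)))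
    (y : EuclideanSpace ℝ (Fin d)) : ℝ :=
  ∫ x, |Ω.indicator (fun _ => (1:ℝ)) (x + y) - Ω.indicator (fun _ => (1:ℝ)) x|

section shift
variable {d : ℕ} {Ω : Set (EuclideanSpace ℝ (Fin d))}

lemma ind_integrable (hΩ : MeasurableSet Ω) (hv : volume Ω < ∞) :
    Integrable (Ω.indicator (fun _ => (1:ℝ))) :=
  (integrable_indicator_iff hΩ).2 (integrableOn_const hv.ne)

lemma shift_integrable (hΩ : MeasurableSet Ω) (hv : volume Ω < ∞)
    (y z : EuclideanSpace ℝ (Fin d)) :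
    Integrable (fun x => |Ω.indicator (fun _ => (1:ℝ)) (x + y) -
      Ω.indicator (fun _ => (1:ℝ)) (x + z)|) :=
  (((ind_integrable hΩ hv).comp_add_right y).sub ((ind_integrable hΩ hv).comp_add_right z)).abs

lemma shiftDist_add (hΩ : MeasurableSet Ω) (hv : volume Ω < ∞)
    (y z : EuclideanSpace ℝ (Fin d)) :
    shiftDist Ω (y + z) ≤ shiftDist Ω y + shiftDist Ω z := by
  have h1 : shiftDist Ω z = ∫ x, |Ω.indicator (fun _ => (1:ℝ)) (x + (y + z)) -
      Ω.indicator (fun _ => (1:ℝ)) (x + y)| := by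
    rw [shiftDist, ← integral_add_right_eq_self _ y]
    simp_rw [add_assoc]
  have i0 := shift_integrable hΩ hv y 0
  have i1 := shift_integrable hΩ hv (y + z) 0
  have i2 := shift_integrable hΩ hv (y + z) y
  simp only [add_zero] at i0 i1
  rw [h1, shiftDist, shiftDist, ← integral_add i0 i2]
  refine integral_mono i1 (i0.add i2) fun x => ?_
  have := abs_sub_le (Ω.indicator (fun _ => (1:ℝ)) (x + (y + z)))
    (Ω.indicator (fun _ => (1:ℝ)) (x + y)) (Ω.indicator (fun _ => (1:ℝ)) x)
  simp only
  linarith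

lemma shiftDist_nsmul (hΩ : MeasurableSet Ω) (hv : volume Ω < ∞)
    (y : EuclideanSpace ℝ (Fin d)) (n : ℕ) :
    shiftDist Ω (n • y) ≤ n * shiftDist Ω y := by
  induction n with
  | zero => simp [shiftDist]
  | succ n ih =>
    rw [succ_nsmul]
    refine (shiftDist_add hΩ hv _ _).trans ?_
    push_cast
    linarith

lemma lintegral_inter (hΩ : MeasurableSet Ω) :
    ∫⁻ y, volume (Ω ∩ (fun x => x + y) ⁻¹' Ω) = volume Ω * volume Ω := by
  have h1 : ∀ y : EuclideanSpace ℝ (Fin d), volume (Ω ∩ (fun x => x + y) ⁻¹' Ω) =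
      ∫⁻ x, Ω.indicator (fun _ => (1:ℝ≥0∞)) x * Ω.indicator (fun _ => (1:ℝ≥0∞)) (x + y) := by
    intro y
    rw [← lintegral_indicator_one (hΩ.inter (measurable_add_const y hΩ))]
    congr 1
    ext x
    by_cases h1 : x ∈ Ω <;> by_cases h2 : x + y ∈ Ω <;> simp [Set.indicator, h1, h2]
  simp_rw [h1]
  have hm : Measurable (Ω.indicator (fun _ => (1:ℝ≥0∞))) := measurable_const.indicator hΩ
  rw [lintegral_lintegral_swap]
  · have : ∀ x : EuclideanSpace ℝ (Fin d), ∫⁻ y, Ω.indicator (fun _ => (1:ℝ≥0∞)) x *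
        Ω.indicator (fun _ => (1:ℝ≥0∞)) (x + y) =
        Ω.indicator (fun _ => (1:ℝ≥0∞)) x * volume Ω := by
      intro x
      have hm2 : Measurable (fun y => Ω.indicator (fun _ => (1:ℝ≥0∞)) (x + y)) :=
        hm.comp (measurable_const_add x)
      rw [lintegral_const_mul _ hm2,
        lintegral_add_left_eq_self (μ := volume) (Ω.indicator (fun _ => (1:ℝ≥0∞))) x]
      congr 1
      exact lintegral_indicator_one hΩ
    simp_rw [this]
    rw [lintegral_mul_const _ hm]
    congr 1
    exact lintegral_indicator_one hΩ
  · exact ((hm.comp measurable_snd).mul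
      (hm.comp (measurable_snd.add measurable_fst))).aemeasurable

lemma shiftDist_eq (hΩ : MeasurableSet Ω) (hv : volume Ω < ∞)
    (y : EuclideanSpace ℝ (Fin d)) :
    shiftDist Ω y = 2 * (volume Ω).toReal
      - 2 * (volume (Ω ∩ (fun x => x + y) ⁻¹' Ω)).toReal := by
  have hm := hΩ.inter (measurable_add_const y hΩ)
  have hf : volume (Ω ∩ (fun x => x + y) ⁻¹' Ω) < ∞ :=
    (measure_mono Set.inter_subset_left).trans_lt hv
  have i0 := ind_integrable hΩ hv
  have i1 := i0.comp_add_right y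
  have i2 := (ind_integrable hm hf).const_mul 2
  have e : ∀ {S : Set (EuclideanSpace ℝ (Fin d))}, MeasurableSet S →
      ∫ x, S.indicator (fun _ => (1:ℝ)) x = (volume S).toReal := by
    intro S hS
    exact integral_indicator_one hS
  have h : shiftDist Ω y = ∫ x, (Ω.indicator (fun _ => (1:ℝ)) (x + y) +
      Ω.indicator (fun _ => (1:ℝ)) x -
      2 * (Ω ∩ (fun x => x + y) ⁻¹' Ω).indicator (fun _ => (1:ℝ)) x) := by
    rw [shiftDist]
    congr 1
    ext x
    by_cases h1 : x ∈ Ω <;> by_cases h2 : x + y ∈ Ω <;> simp [Set.indicator, h1, h2] <;> norm_num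
  have i3 : Integrable (fun x => Ω.indicator (fun _ => (1:ℝ)) (x + y) +
      Ω.indicator (fun _ => (1:ℝ)) x) := i1.add i0
  rw [h, integral_sub i3 i2, integral_add i1 i0, integral_const_mul,
    integral_add_right_eq_self (Ω.indicator (fun _ => (1:ℝ))) y, e hΩ, e hm]
  ring

lemma exists_shift (hΩ : MeasurableSet Ω) (hv : volume Ω < ∞) (hpos : 0 < (volume Ω).toReal)
    (r : ℝ) (hr : ENNReal.ofReal (4 * (volume Ω).toReal) ≤
      volume (Metric.ball (0 : EuclideanSpace ℝ (Fin d)) r)) :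
    ∃ y : EuclideanSpace ℝ (Fin d), ‖y‖ ≤ r ∧ (volume Ω).toReal ≤ shiftDist Ω y := by
  by_contra! hcon
  have h1 : ∀ y ∈ Metric.ball (0 : EuclideanSpace ℝ (Fin d)) r,
      ENNReal.ofReal ((volume Ω).toReal / 2) ≤ volume (Ω ∩ (fun x => x + y) ⁻¹' Ω) := by
    intro y hy
    have := hcon y (by simpa using (Metric.mem_ball.1 hy).le)
    rw [shiftDist_eq hΩ hv] at this
    apply ENNReal.ofReal_le_of_le_toReal
    linarith
  have h2 : ENNReal.ofReal ((volume Ω).toReal / 2) *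
      volume (Metric.ball (0 : EuclideanSpace ℝ (Fin d)) r) ≤ volume Ω * volume Ω := by
    rw [← lintegral_inter hΩ, ← setLIntegral_const]
    exact (setLIntegral_mono' measurableSet_ball h1).trans (setLIntegral_le_lintegral _ _)
  have h3 : ENNReal.ofReal ((volume Ω).toReal / 2) * ENNReal.ofReal (4 * (volume Ω).toReal) ≤
      volume Ω * volume Ω := le_trans (by gcongr) h2
  rw [← ENNReal.ofReal_toReal hv.ne, ← ENNReal.ofReal_mul (by positivity),
    ← ENNReal.ofReal_mul (by positivity), ENNReal.toReal_ofReal hpos.le,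
    ENNReal.ofReal_le_ofReal_iff (by positivity)] at h3
  nlinarith

end shift
end BLY

namespace BLY

section ortho
variable {d N : ℕ} {Ω : Set (EuclideanSpace ℝ (Fin d))}
  {f : Fin N → 𝓢(EuclideanSpace ℝ (Fin d), ℂ)}

/-- The density of the family in Fourier space. -/
noncomputable def dens (f : Fin N → 𝓢(EuclideanSpace ℝ (Fin d), ℂ))
    (k : EuclideanSpace ℝ (Fin d)) : ℝ := ∑ j, ‖𝓕 (f j) k‖ ^ 2

lemma dens_nonneg (k : EuclideanSpace ℝ (Fin d)) : 0 ≤ dens f k :=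
  Finset.sum_nonneg fun _ _ => by positivity

lemma dens_integrable : Integrable (dens f) := by
  unfold dens
  exact integrable_finsetSum _ fun j _ => schwartz_sq_integrable _

lemma dens_weight_integrable : Integrable (fun k => 4 * π ^ 2 * ‖k‖ ^ 2 * dens f k) := by
  unfold dens
  simp_rw [Finset.mul_sum]
  exact integrable_finsetSum _ fun j _ => weight_integrable _

/-- The projected plane wave. -/
noncomputable def projWave (f : Fin N → 𝓢(EuclideanSpace ℝ (Fin d), ℂ))
    (ξ : EuclideanSpace ℝ (Fin d)) : 𝓢(EuclideanSpace ℝ (Fin d), ℂ) :=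
  ∑ j, (starRingEnd ℂ (𝓕 (f j) ξ)) • f j

/-- The plane wave cut off to `Ω`. -/
noncomputable def wave (Ω : Set (EuclideanSpace ℝ (Fin d)))
    (ξ : EuclideanSpace ℝ (Fin d)) (x : EuclideanSpace ℝ (Fin d)) : ℂ :=
  Ω.indicator (fun x => (𝐞 (inner ℝ x ξ) : ℂ)) x

lemma conj_mul_integrable (g h : 𝓢(EuclideanSpace ℝ (Fin d), ℂ)) :
    Integrable (fun x => (starRingEnd ℂ) (g x) * h x) := by
  have h1 : MemLp (fun x => (starRingEnd ℂ) (g x)) 2 volume := (g.memLp 2 volume).star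
  exact h1.integrable_mul (h.memLp 2 volume)

lemma sq_norm_eq (z : ℂ) : (((‖z‖ ^ 2 : ℝ)) : ℂ) = (starRingEnd ℂ) z * z := by
  rw [mul_comm, Complex.mul_conj, Complex.normSq_eq_norm_sq]

lemma projWave_apply (ξ x : EuclideanSpace ℝ (Fin d)) :
    projWave f ξ x = ∑ j, (starRingEnd ℂ (𝓕 (f j) ξ)) * f j x := by
  simp [projWave]

lemma integral_projWave
    (horth : ∀ i j, ∫ x, (starRingEnd ℂ) (f i x) * f j x = if i = j then 1 else 0)
    (ξ : EuclideanSpace ℝ (Fin d)) :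
    ∫ x, ‖projWave f ξ x‖ ^ 2 = dens f ξ := by
  apply Complex.ofReal_injective
  rw [← integral_complex_ofReal]
  simp_rw [sq_norm_eq, projWave_apply, map_sum, Finset.sum_mul_sum]
  rw [integral_finsetSum]
  · have : ∀ i, ∫ x, ∑ j, (starRingEnd ℂ) ((starRingEnd ℂ) (𝓕 (f i) ξ) * f i x) *
        ((starRingEnd ℂ) (𝓕 (f j) ξ) * f j x) = (starRingEnd ℂ) (𝓕 (f i) ξ) * 𝓕 (f i) ξ := by
      intro i
      have e : ∀ j x, (starRingEnd ℂ) ((starRingEnd ℂ) (𝓕 (f i) ξ) * f i x) *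
        ((starRingEnd ℂ) (𝓕 (f j) ξ) * f j x) =
          (𝓕 (f i) ξ * (starRingEnd ℂ) (𝓕 (f j) ξ)) * ((starRingEnd ℂ) (f i x) * f j x) := by
        intro j x
        rw [map_mul, Complex.conj_conj]
        ring
      simp_rw [e]
      rw [integral_finsetSum _ fun j _ => (conj_mul_integrable (f i) (f j)).const_mul _]
      simp_rw [integral_const_mul, horth]
      simp [mul_comm]
    simp_rw [this, dens]
    push_cast [← sq_norm_eq]
    rfl
  · intro i _
    refine integrable_finsetSum _ fun j _ => ?_
    have := (conj_mul_integrable (f i) (f j)).const_mul (𝓕 (f i) ξ * (starRingEnd ℂ) (𝓕 (f j) ξ))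
    refine this.congr (Filter.Eventually.of_forall fun x => ?_)
    simp only
    rw [map_mul, Complex.conj_conj]
    ring

lemma char_norm (t : ℝ) : ‖(𝐞 t : ℂ)‖ = 1 := Circle.norm_coe _

lemma wave_norm_sq (ξ x : EuclideanSpace ℝ (Fin d)) :
    ‖wave Ω ξ x‖ ^ 2 = Ω.indicator (fun _ => (1:ℝ)) x := by
  by_cases h : x ∈ Ω <;> simp [wave, h, char_norm]

lemma wave_measurable (hΩ : MeasurableSet Ω) (ξ : EuclideanSpace ℝ (Fin d)) :
    Measurable (wave Ω ξ) := by
  refine Measurable.indicator ?_ hΩ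
  have : Continuous fun x : EuclideanSpace ℝ (Fin d) => (𝐞 (inner ℝ x ξ) : ℂ) := by
    simp only [Real.fourierChar_apply]
    fun_prop
  exact this.measurable

lemma wave_memLp (hΩ : MeasurableSet Ω) (hv : volume Ω < ∞) (ξ : EuclideanSpace ℝ (Fin d)) :
    MemLp (wave Ω ξ) 2 volume := by
  rw [memLp_two_iff_integrable_sq_norm (wave_measurable hΩ ξ).aestronglyMeasurable]
  simp_rw [wave_norm_sq]
  exact ind_integrable hΩ hv

lemma integral_conj_wave (hsupp : ∀ j, ∀ x, x ∉ Ω → f j x = 0) (j : Fin N)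
    (ξ : EuclideanSpace ℝ (Fin d)) :
    ∫ x, wave Ω ξ x * (starRingEnd ℂ) (f j x) = (starRingEnd ℂ) (𝓕 (f j) ξ) := by
  rw [SchwartzMap.fourier_coe, Real.fourier_eq, ← integral_conj]
  congr 1
  ext x
  by_cases h : x ∈ Ω
  · simp only [wave, h, Set.indicator_of_mem, Circle.smul_def, smul_eq_mul, map_mul]
    rw [AddChar.map_neg_eq_inv, Circle.coe_inv_eq_conj, Complex.conj_conj]
  · simp [hsupp j x h]

lemma wave_sub_integrable (hΩ : MeasurableSet Ω) (hv : volume Ω < ∞)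
    (g : 𝓢(EuclideanSpace ℝ (Fin d), ℂ)) (ξ : EuclideanSpace ℝ (Fin d)) :
    Integrable (fun x => ‖wave Ω ξ x - g x‖ ^ 2) := by
  have := ((wave_memLp hΩ hv ξ).sub (g.memLp 2 volume)).integrable_norm_pow (by norm_num)
  simpa using this

lemma integral_wave_sub (hΩ : MeasurableSet Ω) (hv : volume Ω < ∞)
    (horth : ∀ i j, ∫ x, (starRingEnd ℂ) (f i x) * f j x = if i = j then 1 else 0)
    (hsupp : ∀ j, ∀ x, x ∉ Ω → f j x = 0) (ξ : EuclideanSpace ℝ (Fin d)) :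
    ∫ x, ‖wave Ω ξ x - projWave f ξ x‖ ^ 2 = (volume Ω).toReal - dens f ξ := by
  have hc : ∀ j, Integrable (fun x => wave Ω ξ x * (starRingEnd ℂ) (f j x)) := by
    intro j
    have h1 : MemLp (fun x => (starRingEnd ℂ) (f j x)) 2 volume := ((f j).memLp 2 volume).star
    exact (wave_memLp hΩ hv ξ).integrable_mul h1
  have e2 : ∀ x, wave Ω ξ x * (starRingEnd ℂ) (projWave f ξ x) =
      ∑ j, 𝓕 (f j) ξ * (wave Ω ξ x * (starRingEnd ℂ) (f j x)) := by
    intro x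
    rw [projWave_apply, map_sum, Finset.mul_sum]
    refine Finset.sum_congr rfl fun j _ => ?_
    rw [map_mul, Complex.conj_conj]
    ring
  have hci : Integrable (fun x => wave Ω ξ x * (starRingEnd ℂ) (projWave f ξ x)) := by
    simp_rw [e2]
    exact integrable_finsetSum _ fun j _ => (hc j).const_mul _
  have e3 : ∫ x, wave Ω ξ x * (starRingEnd ℂ) (projWave f ξ x) = (dens f ξ : ℂ) := by
    simp_rw [e2]
    rw [integral_finsetSum _ fun j _ => (hc j).const_mul _]
    simp_rw [integral_const_mul, integral_conj_wave hsupp, dens]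
    push_cast [← sq_norm_eq]
    refine Finset.sum_congr rfl fun j _ => ?_
    rw [Complex.mul_conj, Complex.normSq_eq_norm_sq]
    push_cast
    rfl
  have e4 : ∫ x, (wave Ω ξ x * (starRingEnd ℂ) (projWave f ξ x)).re = dens f ξ := by
    have := Complex.reCLM.integral_comp_comm hci
    simp only [Complex.reCLM_apply] at this
    rw [this, e3, Complex.ofReal_re]
  have hre : Integrable (fun x => 2 * (wave Ω ξ x * (starRingEnd ℂ) (projWave f ξ x)).re) :=
    hci.re.const_mul 2
  have e5 : ∀ x, ‖wave Ω ξ x - projWave f ξ x‖ ^ 2 =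
      Ω.indicator (fun _ => (1:ℝ)) x + ‖projWave f ξ x‖ ^ 2 -
        2 * (wave Ω ξ x * (starRingEnd ℂ) (projWave f ξ x)).re := by
    intro x
    rw [← wave_norm_sq ξ x]
    simp only [← Complex.normSq_eq_norm_sq]
    rw [Complex.normSq_sub]
  simp_rw [e5]
  have i1 := ind_integrable hΩ hv
  have i2 := schwartz_sq_integrable (projWave f ξ)
  have i3 : Integrable (fun x => Ω.indicator (fun _ => (1:ℝ)) x + ‖projWave f ξ x‖ ^ 2) :=
    i1.add i2
  have e6 : ∫ x, Ω.indicator (fun _ => (1:ℝ)) x = (volume Ω).toReal := integral_indicator_one hΩ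
  rw [integral_sub i3 hre, integral_add i1 i2, integral_const_mul, e4,
    integral_projWave horth, e6]
  ring

lemma dens_le (hΩ : MeasurableSet Ω) (hv : volume Ω < ∞)
    (horth : ∀ i j, ∫ x, (starRingEnd ℂ) (f i x) * f j x = if i = j then 1 else 0)
    (hsupp : ∀ j, ∀ x, x ∉ Ω → f j x = 0) (ξ : EuclideanSpace ℝ (Fin d)) :
    dens f ξ ≤ (volume Ω).toReal := by
  have h := integral_wave_sub hΩ hv horth hsupp ξ
  have : 0 ≤ ∫ x, ‖wave Ω ξ x - projWave f ξ x‖ ^ 2 := integral_nonneg fun x => by positivity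
  linarith

lemma fourier_projWave_le (ξ k : EuclideanSpace ℝ (Fin d)) :
    ‖𝓕 (projWave f ξ) k‖ ^ 2 ≤ dens f ξ * dens f k := by
  have e : 𝓕 (projWave f ξ) k = ∑ j, (starRingEnd ℂ (𝓕 (f j) ξ)) * 𝓕 (f j) k := by
    rw [projWave, FourierTransform.fourier_sum, sum_apply]
    refine Finset.sum_congr rfl fun j _ => ?_
    rw [FourierTransform.fourier_smul]
    simp
  rw [e]
  calc _ ≤ (∑ j, ‖𝓕 (f j) ξ‖ * ‖𝓕 (f j) k‖) ^ 2 := by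
        gcongr
        refine (norm_sum_le _ _).trans (le_of_eq ?_)
        simp
    _ ≤ _ := Finset.sum_mul_sq_le_sq_mul_sq _ _ _

lemma posPart_integrable (Λ : ℝ) :
    Integrable (fun k => max (4 * π ^ 2 * ‖k‖ ^ 2 - Λ) 0 * dens f k) := by
  have i : Integrable (fun k => (4 * π ^ 2 * ‖k‖ ^ 2 * dens f k - Λ * dens f k)) :=
    dens_weight_integrable.sub (dens_integrable.const_mul Λ)
  convert i.pos_part using 2 with k
  rw [← sub_mul, max_mul_of_nonneg _ _ (dens_nonneg k), zero_mul]

lemma kinetic_projWave (hΩ : MeasurableSet Ω) (hv : volume Ω < ∞)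
    (horth : ∀ i j, ∫ x, (starRingEnd ℂ) (f i x) * f j x = if i = j then 1 else 0)
    (hsupp : ∀ j, ∀ x, x ∉ Ω → f j x = 0) (ξ : EuclideanSpace ℝ (Fin d)) (Λ : ℝ) (hΛ : 0 < Λ)
    (hD : ∫ k, max (4 * π ^ 2 * ‖k‖ ^ 2 - Λ) 0 * dens f k ≤ Λ) :
    ∫ k, 4 * π ^ 2 * ‖k‖ ^ 2 * ‖𝓕 (projWave f ξ) k‖ ^ 2 ≤ 2 * Λ * (volume Ω).toReal := by
  have hdl := dens_le hΩ hv horth hsupp ξ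
  have i1 := (schwartz_sq_integrable (𝓕 (projWave f ξ))).const_mul Λ
  have i2 := (posPart_integrable (f := f) Λ).const_mul (volume Ω).toReal
  calc _ ≤ ∫ k, (Λ * ‖𝓕 (projWave f ξ) k‖ ^ 2 +
        (volume Ω).toReal * (max (4 * π ^ 2 * ‖k‖ ^ 2 - Λ) 0 * dens f k)) := by
        refine integral_mono (weight_integrable _) (i1.add i2) fun k => ?_
        have h1 := fourier_projWave_le (f := f) ξ k
        have h2 : dens f ξ * dens f k ≤ (volume Ω).toReal * dens f k := by
          gcongr
          exact dens_nonneg k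
        have h3 := le_max_left (4 * π ^ 2 * ‖k‖ ^ 2 - Λ) 0
        have h4 := le_max_right (4 * π ^ 2 * ‖k‖ ^ 2 - Λ) 0
        have h5 : (4 * π ^ 2 * ‖k‖ ^ 2 - Λ) * ‖𝓕 (projWave f ξ) k‖ ^ 2 ≤
            max (4 * π ^ 2 * ‖k‖ ^ 2 - Λ) 0 * ((volume Ω).toReal * dens f k) := by
          calc _ ≤ max (4 * π ^ 2 * ‖k‖ ^ 2 - Λ) 0 * ‖𝓕 (projWave f ξ) k‖ ^ 2 := by gcongr
            _ ≤ _ := by gcongr; exact h1.trans h2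
        simp only
        linarith
    _ = Λ * dens f ξ +
        (volume Ω).toReal * ∫ k, max (4 * π ^ 2 * ‖k‖ ^ 2 - Λ) 0 * dens f k := by
        rw [integral_add i1 i2, integral_const_mul, integral_const_mul,
          SchwartzMap.integral_norm_sq_fourier, integral_projWave horth]
    _ ≤ Λ * (volume Ω).toReal + (volume Ω).toReal * Λ := by gcongr
    _ = _ := by ring

lemma norm_add3_sq (a b c : ℂ) : ‖a + b + c‖ ^ 2 ≤ 3 * (‖a‖ ^ 2 + ‖b‖ ^ 2 + ‖c‖ ^ 2) := by
  have := norm_add₃_le (a := a) (b := b) (c := c)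
  calc _ ≤ (‖a‖ + ‖b‖ + ‖c‖) ^ 2 := by gcongr
    _ ≤ _ := by nlinarith [sq_nonneg (‖a‖ - ‖b‖), sq_nonneg (‖b‖ - ‖c‖), sq_nonneg (‖a‖ - ‖c‖)]

lemma wave_shift (ξ x y : EuclideanSpace ℝ (Fin d)) :
    ‖(𝐞 (-(inner ℝ y ξ)) : ℂ) * wave Ω ξ (x + y) - wave Ω ξ x‖ ^ 2 =
      |Ω.indicator (fun _ => (1:ℝ)) (x + y) - Ω.indicator (fun _ => (1:ℝ)) x| := by
  have e : (𝐞 (-(inner ℝ y ξ)) : ℂ) * 𝐞 (inner ℝ (x + y) ξ) = 𝐞 (inner ℝ x ξ) := by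
    rw [← Circle.coe_mul, ← AddChar.map_add_eq_mul, inner_add_left]
    congr 2
    ring
  by_cases h1 : x ∈ Ω <;> by_cases h2 : x + y ∈ Ω <;> 
    simp [wave, h1, h2, e, char_norm]

lemma shiftDist_le (hΩ : MeasurableSet Ω) (hv : volume Ω < ∞)
    (horth : ∀ i j, ∫ x, (starRingEnd ℂ) (f i x) * f j x = if i = j then 1 else 0)
    (hsupp : ∀ j, ∀ x, x ∉ Ω → f j x = 0) (ξ : EuclideanSpace ℝ (Fin d)) (Λ : ℝ) (hΛ : 0 < Λ)
    (hξ : 4 * π ^ 2 * ‖ξ‖ ^ 2 ≤ Λ)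
    (hD : ∫ k, max (4 * π ^ 2 * ‖k‖ ^ 2 - Λ) 0 * dens f k ≤ Λ)
    (y : EuclideanSpace ℝ (Fin d)) :
    shiftDist Ω y ≤ 6 * ((volume Ω).toReal - dens f ξ) +
      18 * ‖y‖ ^ 2 * Λ * (volume Ω).toReal := by
  set h := projWave f ξ with hh
  have i1 := wave_sub_integrable hΩ hv h ξ
  have i2 : Integrable (fun x => ‖(𝐞 (-(inner ℝ y ξ)) : ℂ) * h (x + y) - h x‖ ^ 2) := by
    have := schwartz_sq_integrable ((𝐞 (-(inner ℝ y ξ)) : ℂ) • (h.compSubConstCLM ℂ (-y)) - h)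
    simpa using this
  have i3 := i1.comp_add_right y
  have hT := translate_est h y ξ Λ hξ
  have hK := kinetic_projWave hΩ hv horth hsupp ξ Λ hΛ hD
  have hW := integral_wave_sub hΩ hv horth hsupp ξ
  have hP := integral_projWave horth ξ
  rw [← hh] at hK hW hP
  have hdl := dens_le hΩ hv horth hsupp ξ
  have i12 : Integrable (fun x => ‖wave Ω ξ (x + y) - h (x + y)‖ ^ 2 +
      ‖(𝐞 (-(inner ℝ y ξ)) : ℂ) * h (x + y) - h x‖ ^ 2) := i3.add i2
  have i123 : Integrable (fun x => ‖wave Ω ξ (x + y) - h (x + y)‖ ^ 2 +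
      ‖(𝐞 (-(inner ℝ y ξ)) : ℂ) * h (x + y) - h x‖ ^ 2 + ‖wave Ω ξ x - h x‖ ^ 2) := i12.add i1
  have i0 := shift_integrable hΩ hv y 0
  simp only [add_zero] at i0
  have main : shiftDist Ω y ≤ 3 * (((volume Ω).toReal - dens f ξ) +
      (∫ x, ‖(𝐞 (-(inner ℝ y ξ)) : ℂ) * h (x + y) - h x‖ ^ 2) +
      ((volume Ω).toReal - dens f ξ)) := by
    calc shiftDist Ω y ≤ ∫ x, 3 * (‖wave Ω ξ (x + y) - h (x + y)‖ ^ 2 +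
      ‖(𝐞 (-(inner ℝ y ξ)) : ℂ) * h (x + y) - h x‖ ^ 2 + ‖wave Ω ξ x - h x‖ ^ 2) := by
          refine integral_mono i0 (i123.const_mul 3) fun x => ?_
          simp only
          rw [← wave_shift ξ]
          have := norm_add3_sq ((𝐞 (-(inner ℝ y ξ)) : ℂ) * (wave Ω ξ (x + y) - h (x + y)))
            ((𝐞 (-(inner ℝ y ξ)) : ℂ) * h (x + y) - h x) (-(wave Ω ξ x - h x))
          rw [norm_neg, norm_mul, Circle.norm_coe, one_mul] at this
          refine le_trans (le_of_eq ?_) this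
          congr 2
          ring
      _ = _ := by
          rw [integral_const_mul, integral_add i12 i1, integral_add i3 i2,
            integral_add_right_eq_self (fun x => ‖wave Ω ξ x - h x‖ ^ 2) y, hW]
  have : (∫ x, ‖(𝐞 (-(inner ℝ y ξ)) : ℂ) * h (x + y) - h x‖ ^ 2) ≤
      2 * ‖y‖ ^ 2 * (2 * Λ * (volume Ω).toReal + Λ * (volume Ω).toReal) := by
    refine hT.trans ?_
    rw [hP]
    gcongr
  linarith

/-- Lower bound for the spectral deficit. -/
lemma deficit_lower (hΩ : MeasurableSet Ω) (hv : volume Ω < ∞)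
    (horth : ∀ i j, ∫ x, (starRingEnd ℂ) (f i x) * f j x = if i = j then 1 else 0)
    (hsupp : ∀ j, ∀ x, x ∉ Ω → f j x = 0) (ξ : EuclideanSpace ℝ (Fin d)) (Λ : ℝ) (hΛ : 0 < Λ)
    (hξ : 4 * π ^ 2 * ‖ξ‖ ^ 2 ≤ Λ)
    (hD : ∫ k, max (4 * π ^ 2 * ‖k‖ ^ 2 - Λ) 0 * dens f k ≤ Λ)
    (hpos : 0 < (volume Ω).toReal) (r : ℝ)
    (hr : ENNReal.ofReal (4 * (volume Ω).toReal) ≤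
      volume (Metric.ball (0 : EuclideanSpace ℝ (Fin d)) r)) :
    (volume Ω).toReal / (12 * (36 * r ^ 2 * Λ + 2)) ≤ (volume Ω).toReal - dens f ξ := by
  obtain ⟨Y, hY, hA⟩ := exists_shift hΩ hv hpos r hr
  set n : ℕ := ⌈36 * r ^ 2 * Λ⌉₊ + 1 with hn
  have hn0 : (0:ℝ) < n := by positivity
  have hn1 : 36 * r ^ 2 * Λ ≤ n := by
    rw [hn]; push_cast
    linarith [Nat.le_ceil (36 * r ^ 2 * Λ)]
  have hn2 : (n:ℝ) ≤ 36 * r ^ 2 * Λ + 2 := by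
    rw [hn]; push_cast
    linarith [Nat.ceil_lt_add_one (show 0 ≤ 36 * r ^ 2 * Λ by positivity)]
  set y := (n:ℝ)⁻¹ • Y with hy
  have hyY : n • y = Y := by
    rw [hy, ← Nat.cast_smul_eq_nsmul ℝ, smul_smul, mul_inv_cancel₀ hn0.ne', one_smul]
  have h1 := shiftDist_nsmul hΩ hv y n
  rw [hyY] at h1
  have h2 := shiftDist_le hΩ hv horth hsupp ξ Λ hΛ hξ hD y
  have hny : ‖y‖ ^ 2 = ‖Y‖ ^ 2 / n ^ 2 := by
    rw [hy, norm_smul, mul_pow, norm_inv, Real.norm_natCast]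
    field_simp
  have hY2 : ‖Y‖ ^ 2 ≤ r ^ 2 := by gcongr
  set W := (volume Ω).toReal
  set D := W - dens f ξ
  have hD0 : 0 ≤ D := sub_nonneg.2 (dens_le hΩ hv horth hsupp ξ)
  have h3 : n * (18 * ‖y‖ ^ 2 * Λ * W) ≤ W / 2 := by
    rw [hny]
    have : n * (18 * (‖Y‖ ^ 2 / n ^ 2) * Λ * W) = (36 * ‖Y‖ ^ 2 * Λ) / n * (W / 2) := by
      field_simp
      ring
    rw [this]
    have h4 : (36 * ‖Y‖ ^ 2 * Λ) / n ≤ 1 := by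
      rw [div_le_one hn0]
      refine le_trans ?_ hn1
      gcongr
    calc _ ≤ 1 * (W / 2) := by gcongr
      _ = _ := one_mul _
  have h5 : W ≤ n * (6 * D) + W / 2 := by
    calc W ≤ _ := hA
      _ ≤ _ := h1
      _ ≤ n * (6 * D + 18 * ‖y‖ ^ 2 * Λ * W) := by gcongr
      _ = n * (6 * D) + n * (18 * ‖y‖ ^ 2 * Λ * W) := by ring
      _ ≤ _ := by gcongr
  rw [div_le_iff₀ (by positivity)]
  have : n * D ≤ (36 * r ^ 2 * Λ + 2) * D := by gcongr
  linarith

end ortho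
end BLY

namespace BLY

lemma weight_int {d : ℕ} (Λ : ℝ) (hΛ : 0 < Λ) :
    Integrable (fun k : EuclideanSpace ℝ (Fin d) => max (Λ - 4 * π ^ 2 * ‖k‖ ^ 2) 0) := by
  refine Continuous.integrable_of_hasCompactSupport (by fun_prop) ?_
  refine HasCompactSupport.intro (isCompact_closedBall 0 (√Λ)) fun k hk => ?_
  rw [max_eq_right]
  have h1 : √Λ ≤ ‖k‖ := by
    have : ¬ ‖k‖ ≤ √Λ := by simpa using hk
    linarith
  have h2 : Λ ≤ ‖k‖ ^ 2 := by
    rw [← Real.sq_sqrt hΛ.le]; gcongr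
  have h3 : 1 ≤ 4 * π ^ 2 := by nlinarith [Real.pi_gt_three]
  nlinarith [sq_nonneg ‖k‖]

lemma radial (m : ℕ) (Λ : ℝ) (hΛ : 0 < Λ) :
    ∫ y in Set.Ioi (0:ℝ), y ^ m * max (Λ - 4 * π ^ 2 * y ^ 2) 0 =
      Λ * (√Λ / (2 * π)) ^ (m + 1) * (2 / (((m:ℝ) + 1) * (m + 3))) := by
  have hpi := Real.pi_pos
  set R := √Λ / (2 * π) with hR
  have hR0 : 0 < R := by positivity
  have hR2 : 4 * π ^ 2 * R ^ 2 = Λ := by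
    rw [hR, div_pow, Real.sq_sqrt hΛ.le]; field_simp; norm_num
  rw [setIntegral_eq_of_subset_of_forall_sdiff_eq_zero (s := Set.Ioc 0 R) measurableSet_Ioi
    Set.Ioc_subset_Ioi_self]
  · rw [← intervalIntegral.integral_of_le hR0.le]
    have : ∫ y in (0:ℝ)..R, y ^ m * max (Λ - 4 * π ^ 2 * y ^ 2) 0 =
        ∫ y in (0:ℝ)..R, (Λ * y ^ m - 4 * π ^ 2 * y ^ (m + 2)) := by
      refine intervalIntegral.integral_congr fun y hy => ?_
      rw [Set.uIcc_of_le hR0.le] at hy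
      have : y ^ 2 ≤ R ^ 2 := by
        have := hy.1
        have := hy.2
        gcongr
      have h : 0 ≤ Λ - 4 * π ^ 2 * y ^ 2 := by
        rw [← hR2]
        have : 4 * π ^ 2 * y ^ 2 ≤ 4 * π ^ 2 * R ^ 2 := by gcongr
        linarith
      rw [max_eq_left h]
      ring
    rw [this, intervalIntegral.integral_sub (by apply Continuous.intervalIntegrable; fun_prop)
      (by apply Continuous.intervalIntegrable; fun_prop),
      intervalIntegral.integral_const_mul, intervalIntegral.integral_const_mul,
      integral_pow, integral_pow]
    have e : R ^ (m + 2 + 1) = R ^ (m + 1) * R ^ 2 := by ring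
    rw [e, show 4 * π ^ 2 * ((R ^ (m + 1) * R ^ 2 - 0 ^ (m + 2 + 1)) / ((↑(m + 2) : ℝ) + 1)) =
      (4 * π ^ 2 * R ^ 2) * R ^ (m + 1) / ((↑(m + 2) : ℝ) + 1) by simp; ring, hR2]
    push_cast
    simp only [ne_eq, Nat.add_eq_zero_iff, one_ne_zero, and_false, not_false_eq_true, zero_pow,
      sub_zero]
    have e2 : (m:ℝ) + 2 + 1 = m + 3 := by ring
    rw [e2]
    field_simp
    ring
  · intro y hy
    have h1 : R < y := by
      by_contra h
      exact hy.2 ⟨hy.1, not_lt.1 h⟩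
    have : R ^ 2 ≤ y ^ 2 := by gcongr
    rw [max_eq_right, mul_zero]
    rw [← hR2]
    have : 4 * π ^ 2 * R ^ 2 ≤ 4 * π ^ 2 * y ^ 2 := by gcongr
    linarith

lemma semiclassical (d : ℕ) (hd : 1 ≤ d) (Λ : ℝ) (hΛ : 0 < Λ) :
    ∫ k : EuclideanSpace ℝ (Fin d), max (Λ - 4 * π ^ 2 * ‖k‖ ^ 2) 0 =
      semiclassicalConst d * Λ ^ (1 + (d : ℝ) / 2) := by
  obtain ⟨m, rfl⟩ : ∃ m, d = m + 1 := ⟨d - 1, by omega⟩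
  have hpi := Real.pi_pos
  have h := integral_fun_norm_addHaar (volume : Measure (EuclideanSpace ℝ (Fin (m + 1))))
    (fun y => max (Λ - 4 * π ^ 2 * y ^ 2) 0)
  rw [h, finrank_euclideanSpace_fin]
  simp only [Nat.add_sub_cancel, smul_eq_mul, nsmul_eq_mul]
  rw [radial m Λ hΛ, Measure.real, EuclideanSpace.volume_ball]
  have hG : 0 < Real.Gamma (((m + 1 : ℕ) : ℝ) / 2 + 1) := Real.Gamma_pos_of_pos (by positivity)
  simp only [Fintype.card_fin, ENNReal.ofReal_one, one_pow, one_mul]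
  rw [ENNReal.toReal_ofReal (by positivity)]
  have hG2 : Real.Gamma (2 + ((m + 1 : ℕ) : ℝ) / 2) =
      (((m + 1 : ℕ) : ℝ) / 2 + 1) * Real.Gamma (((m + 1 : ℕ) : ℝ) / 2 + 1) := by
    rw [← Real.Gamma_add_one (by positivity)]
    congr 1
    ring
  have hs : ∀ x : ℝ, 0 ≤ x → x ^ (((m + 1 : ℕ) : ℝ) / 2) = (√x) ^ (m + 1) := by
    intro x hx
    rw [Real.sqrt_eq_rpow, ← Real.rpow_natCast, ← Real.rpow_mul hx]
    congr 1
    ring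
  rw [semiclassicalConst, hG2, Real.Gamma_two, Real.rpow_add hΛ, Real.rpow_one, hs Λ hΛ.le,
    hs (4 * π) (by positivity)]
  have h4 : √(4 * π) = 2 * √π := by
    rw [Real.sqrt_mul (by norm_num), show (4:ℝ) = 2 ^ 2 by norm_num, Real.sqrt_sq (by norm_num)]
  have hpp : (2 * π) = (2 * √π) * √π := by
    rw [mul_assoc, Real.mul_self_sqrt hpi.le]
  have hsp : 0 < √π := Real.sqrt_pos.2 hpi
  rw [h4, hpp, div_pow, mul_pow (2 * √π) (√π)]
  set G := Real.Gamma (((m + 1 : ℕ) : ℝ) / 2 + 1)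
  push_cast
  field_simp
  ring

end BLY

namespace BLY

section final
variable {d N : ℕ} {f : Fin N → 𝓢(EuclideanSpace ℝ (Fin d), ℂ)}

lemma low_eq (Λ : ℝ) (k : EuclideanSpace ℝ (Fin d)) :
    max (Λ - 4 * π ^ 2 * ‖k‖ ^ 2) 0 * dens f k =
      (Λ * dens f k - 4 * π ^ 2 * ‖k‖ ^ 2 * dens f k) +
        max (4 * π ^ 2 * ‖k‖ ^ 2 - Λ) 0 * dens f k := by
  rcases le_total Λ (4 * π ^ 2 * ‖k‖ ^ 2) with h | h
  · rw [max_eq_right (by linarith), max_eq_left (by linarith)]; ring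
  · rw [max_eq_left (by linarith), max_eq_right (by linarith)]; ring

lemma low_integrable (Λ : ℝ) :
    Integrable (fun k => max (Λ - 4 * π ^ 2 * ‖k‖ ^ 2) 0 * dens f k) := by
  simp_rw [low_eq]
  exact ((dens_integrable.const_mul Λ).sub dens_weight_integrable).add (posPart_integrable Λ)

lemma sum_eq (horth : ∀ i j, ∫ x, (starRingEnd ℂ) (f i x) * f j x = if i = j then 1 else 0)
    (Λ : ℝ) :
    ∑ j, (Λ - ∫ x, gradSq d (f j) x) =
      (∫ k, max (Λ - 4 * π ^ 2 * ‖k‖ ^ 2) 0 * dens f k) -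
        ∫ k, max (4 * π ^ 2 * ‖k‖ ^ 2 - Λ) 0 * dens f k := by
  have h1 : ∀ j, ∫ k, ‖𝓕 (f j) k‖ ^ 2 = 1 := by
    intro j
    rw [SchwartzMap.integral_norm_sq_fourier]
    apply Complex.ofReal_injective
    rw [← integral_complex_ofReal]
    simp_rw [sq_norm_eq]
    simp [horth]
  have i0 : Integrable (fun k => Λ * dens f k) := dens_integrable.const_mul Λ
  have i1 : Integrable (fun k => Λ * dens f k - 4 * π ^ 2 * ‖k‖ ^ 2 * dens f k) :=
    i0.sub dens_weight_integrable
  simp_rw [low_eq]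
  rw [integral_add i1 (posPart_integrable Λ), integral_sub i0 dens_weight_integrable,
    integral_const_mul, add_sub_cancel_right, Finset.sum_sub_distrib]
  simp_rw [integral_gradSq, dens, Finset.mul_sum]
  rw [integral_finsetSum _ fun j _ => schwartz_sq_integrable _,
    integral_finsetSum _ fun j _ => weight_integrable _]
  simp [h1, mul_comm]

end final

lemma const_pos (d : ℕ) : 0 < semiclassicalConst d := by
  have := Real.pi_pos
  have h2 : 0 < Real.Gamma (2 + (d:ℝ) / 2) := Real.Gamma_pos_of_pos (by positivity)
  rw [semiclassicalConst, Real.Gamma_two]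
  positivity

end BLY

set_option maxHeartbeats 2000000 in
/-- **Improved Berezin–Li–Yau inequality with measure-dependent remainder (γ = 1,
variational form).** For every `d ≥ 1` there are `c, c' > 0` such that for every open
`Ω ⊆ ℝ^d` of finite measure, every `Λ > 0` and every `L²(ℝ^d)`-orthonormal family
`φ_1, …, φ_N` of smooth compactly supported functions with support in `Ω`,
`Σ_j (Λ − ∫ |∇φ_j|²) ≤ L^sc_{1,d} |Ω| Λ^{1+d/2} (1 − c e^{−c' √Λ |Ω|^{1/d}})`. -/
theorem improved_berezin_li_yau_measure
    (d : ℕ) (hd : 1 ≤ d) :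
    ∃ c c' : ℝ, 0 < c ∧ 0 < c' ∧
      ∀ (Ω : Set (EuclideanSpace ℝ (Fin d))), IsOpen Ω → volume Ω < ∞ →
      ∀ Λ : ℝ, 0 < Λ →
      ∀ (N : ℕ) (φ : Fin N → EuclideanSpace ℝ (Fin d) → ℂ),
        (∀ j, ContDiff ℝ (⊤ : ℕ∞) (φ j)) →
        (∀ j, HasCompactSupport (φ j)) →
        (∀ j, tsupport (φ j) ⊆ Ω) →
        (∀ i j, ∫ x, (starRingEnd ℂ) (φ i x) * φ j x = if i = j then 1 else 0) →
        ∑ j : Fin N, (Λ - ∫ x, gradSq d (φ j) x)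
          ≤ semiclassicalConst d * (volume Ω).toReal * Λ ^ (1 + (d : ℝ) / 2) *
              (1 - c * Real.exp (-c' * Real.sqrt Λ * (volume Ω).toReal ^ (1 / (d : ℝ)))) := by
  have hd0 : (d:ℝ) ≠ 0 := by positivity
  set ω : ℝ := (volume (Metric.ball (0 : EuclideanSpace ℝ (Fin d)) 1)).toReal with hω
  have hωpos : 0 < ω := ENNReal.toReal_pos
    (Metric.measure_ball_pos volume _ one_pos).ne' measure_ball_lt_top.ne
  set κ : ℝ := (4 / ω) ^ (1 / (d:ℝ)) with hκ
  have hκ0 : 0 < κ := by positivity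
  have hL := BLY.const_pos d
  set L := semiclassicalConst d with hLdef
  set c1 : ℝ := 1 / (12 * (72 * κ ^ 2 + 2)) with hc1
  set c2 : ℝ := 1 / (L * (d.factorial : ℝ)) with hc2
  have hc1p : 0 < c1 := by positivity
  have hc2p : 0 < c2 := by positivity
  refine ⟨min c1 c2, 1, lt_min hc1p hc2p, one_pos, ?_⟩
  intro Ω hΩo hv Λ hΛ N φ hsm hcs hsub horth
  have hΩ := hΩo.measurableSet
  set f : Fin N → 𝓢(EuclideanSpace ℝ (Fin d), ℂ) := fun j => (hcs j).toSchwartzMap (hsm j)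
    with hf
  have hfφ : ∀ j, (f j : EuclideanSpace ℝ (Fin d) → ℂ) = φ j := fun j => rfl
  have horth' : ∀ i j, ∫ x, (starRingEnd ℂ) (f i x) * f j x = if i = j then 1 else 0 := horth
  have hsupp : ∀ j, ∀ x, x ∉ Ω → f j x = 0 := by
    intro j x hx
    rw [hfφ]
    exact image_eq_zero_of_notMem_tsupport fun h => hx (hsub j h)
  have hsum := BLY.sum_eq horth' Λ
  simp only [hfφ] at hsum
  rw [hsum]
  set W := (volume Ω).toReal with hW
  have hsc := BLY.semiclassical d hd Λ hΛ
  rw [← hLdef] at hsc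
  set S := Λ ^ (1 + (d:ℝ) / 2) with hS
  have hS0 : 0 < S := by positivity
  have hW0 : 0 ≤ W := ENNReal.toReal_nonneg
  set D2 := ∫ k, max (4 * π ^ 2 * ‖k‖ ^ 2 - Λ) 0 * BLY.dens f k with hD2
  have hD20 : 0 ≤ D2 := integral_nonneg fun k =>
    mul_nonneg (le_max_right _ _) (BLY.dens_nonneg k)
  -- the upper bound from a pointwise bound on the density
  have key : ∀ M : ℝ, (∀ ξ : EuclideanSpace ℝ (Fin d), 4 * π ^ 2 * ‖ξ‖ ^ 2 ≤ Λ →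
      BLY.dens f ξ ≤ M) →
      ∫ k, max (Λ - 4 * π ^ 2 * ‖k‖ ^ 2) 0 * BLY.dens f k ≤ L * S * M := by
    intro M hM
    rw [← hsc, ← integral_mul_const]
    refine integral_mono (BLY.low_integrable Λ) ((BLY.weight_int Λ hΛ).mul_const M) fun k => ?_
    simp only
    rcases le_total (4 * π ^ 2 * ‖k‖ ^ 2) Λ with h | h
    · have := hM k h
      gcongr
    · rw [max_eq_right (by linarith)]; simp
  have key0 := key W fun ξ _ => BLY.dens_le hΩ hv horth' hsupp ξ
  rcases hW0.eq_or_lt with hW00 | hWpos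
  · rw [← hW00] at key0 ⊢
    simp only [mul_zero, zero_mul] at key0 ⊢
    linarith
  set s := √Λ * W ^ (1 / (d:ℝ)) with hs
  have hs0 : 0 < s := by positivity
  have hexp : -1 * √Λ * W ^ (1 / (d:ℝ)) = -s := by rw [hs]; ring
  rw [hexp]
  have hE := Real.exp_pos (-s)
  have hEE : Real.exp (-s) * Real.exp s = 1 := by rw [← Real.exp_add]; simp
  rcases le_or_gt D2 Λ with hcase | hcase
  · set r := κ * W ^ (1 / (d:ℝ)) with hr
    have hr0 : 0 < r := by positivity
    have hrd : r ^ d = 4 / ω * W := by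
      rw [hr, mul_pow, hκ, one_div, Real.rpow_inv_natCast_pow (by positivity) (by omega),
        Real.rpow_inv_natCast_pow (by positivity) (by omega)]
    have hball : ENNReal.ofReal (4 * W) ≤
        volume (Metric.ball (0 : EuclideanSpace ℝ (Fin d)) r) := by
      rw [Measure.addHaar_ball_of_pos _ _ hr0, finrank_euclideanSpace_fin, hrd,
        ← ENNReal.ofReal_toReal (measure_ball_lt_top (μ := volume)
          (x := (0 : EuclideanSpace ℝ (Fin d))) (r := 1)).ne,
        ← hω, ← ENNReal.ofReal_mul (by positivity)]
      apply ENNReal.ofReal_le_ofReal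
      apply le_of_eq
      field_simp
    have hrs : r ^ 2 * Λ = κ ^ 2 * s ^ 2 := by
      rw [hr, hs, mul_pow, mul_pow, Real.sq_sqrt hΛ.le]
      ring
    have hk := key (W - W / (12 * (36 * r ^ 2 * Λ + 2))) fun ξ hξ => by
      have := BLY.deficit_lower hΩ hv horth' hsupp ξ Λ hΛ hξ hcase hWpos r hball
      linarith
    have hc : min c1 c2 * Real.exp (-s) ≤ 1 / (12 * (36 * r ^ 2 * Λ + 2)) := by
      have hq := Real.quadratic_le_exp_of_nonneg hs0.le
      have h1 : 36 * r ^ 2 * Λ + 2 ≤ (72 * κ ^ 2 + 2) * Real.exp s := by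
        have e1 : s ^ 2 ≤ 2 * Real.exp s := by nlinarith
        have e2 : 1 ≤ Real.exp s := by nlinarith [sq_nonneg s]
        have e3 : κ ^ 2 * s ^ 2 ≤ κ ^ 2 * (2 * Real.exp s) := by gcongr
        nlinarith
      have h2 : 0 < 36 * r ^ 2 * Λ + 2 := by positivity
      rw [le_div_iff₀ (by positivity)]
      calc _ ≤ c1 * Real.exp (-s) * (12 * ((72 * κ ^ 2 + 2) * Real.exp s)) := by
            gcongr
            exact min_le_left _ _
        _ = (c1 * (12 * (72 * κ ^ 2 + 2))) * (Real.exp (-s) * Real.exp s) := by ring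
        _ = 1 := by rw [hEE, hc1, mul_one]; field_simp
    calc _ ≤ L * S * (W - W / (12 * (36 * r ^ 2 * Λ + 2))) := by linarith
      _ = L * W * S * (1 - 1 / (12 * (36 * r ^ 2 * Λ + 2))) := by ring
      _ ≤ _ := by gcongr
  · have hsd : W * S = Λ * s ^ d := by
      rw [hs, hS, mul_pow, one_div, Real.rpow_inv_natCast_pow hW0 (by omega), Real.rpow_add hΛ,
        Real.rpow_one, Real.sqrt_eq_rpow, ← Real.rpow_natCast, ← Real.rpow_mul hΛ.le,
        show (1 / 2 * (d:ℝ)) = (d:ℝ) / 2 by ring]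
      ring
    have hfac : s ^ d ≤ d.factorial * Real.exp s := by
      have := Real.pow_div_factorial_le_exp s hs0.le d
      rw [div_le_iff₀ (by positivity)] at this
      linarith
    have hfin : L * W * S * (min c1 c2 * Real.exp (-s)) ≤ Λ := by
      calc _ = L * (W * S) * (min c1 c2 * Real.exp (-s)) := by ring
        _ = L * (Λ * s ^ d) * (min c1 c2 * Real.exp (-s)) := by rw [hsd]
        _ ≤ L * (Λ * (d.factorial * Real.exp s)) * (c2 * Real.exp (-s)) := by
            gcongr
            exact min_le_right _ _
        _ = Λ * (c2 * (L * d.factorial)) * (Real.exp (-s) * Real.exp s) := by ring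
        _ = Λ := by rw [hEE, hc2]; field_simp
    have : L * S * W = L * W * S := by ring
    rw [mul_sub, mul_one]
    linarith
end

section
/- (Improved Kröger inequality with measure-dependent remainder, case γ = 1, variational form.) For every dimension d ≥ 1 there exist constants c, c' > 0 with the following property: for every open set Ω ⊆ ℝ^d of finite Lebesgue measure, every Λ > 0 and every ε > 0, there exist N ∈ ℕ and smooth functions φ_1, …, φ_N : Ω → ℂ, orthonormal in L²(Ω) and with |∇φ_j| ∈ L²(Ω) for each j, such that Σ_{j=1}^N ( Λ − ∫_Ω |∇φ_j(x)|² dx ) > L^sc_{1,d} · |Ω| · Λ^{1+d/2} · (1 + c e^{−c' √Λ |Ω|^{1/d}}) − ε. (This is the variational formulation of the bound Tr(−Δ_Ω^N − Λ)_− ≥ L^sc_{1,d}|Ω|Λ^{1+d/2}(1 + c e^{−c'√Λ |Ω|^{1/d}}).) -/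
open MeasureTheory Real
open scoped ENNReal

namespace IK

/-- logarithmic weight -/
noncomputable def wt (y : ℝ) : ℝ := Real.log 3 + max 0 (-Real.log y)

lemma wt_nonneg (y : ℝ) : 0 ≤ wt y := by
  unfold wt
  have := Real.log_nonneg (show (1:ℝ) ≤ 3 by norm_num)
  have := le_max_left 0 (-Real.log y)
  linarith

lemma measurable_wt : Measurable wt := by
  unfold wt; fun_prop

lemma exists_wt_bound : ∃ C : ℝ, 0 < C ∧ ∀ b : ℝ,
    ∫⁻ x in Set.Icc (0:ℝ) 1, ENNReal.ofReal (wt (x - b)) ≤ ENNReal.ofReal C := by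
  have hfin : ∫⁻ y : ℝ, ENNReal.ofReal (max 0 (-Real.log y)) < ∞ := by
    have hintg : IntegrableOn Real.log (Set.Ioc (-1) 1) volume := by
      have := (intervalIntegral.intervalIntegrable_log' (a := -1) (b := 1))
      rwa [intervalIntegrable_iff_integrableOn_Ioc_of_le (by norm_num)] at this
    have h2 : ∫⁻ y in Set.Ioc (-1:ℝ) 1, ‖Real.log y‖ₑ < ∞ := hintg.2
    refine lt_of_le_of_lt ?_ h2
    rw [← lintegral_indicator measurableSet_Ioc]
    refine lintegral_mono_ae ?_
    have hne : ∀ᵐ y : ℝ, y ≠ -1 := by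
      simp [ae_iff, measure_singleton]
    filter_upwards [hne] with y hy
    by_cases h : y ∈ Set.Ioc (-1:ℝ) 1
    · rw [Set.indicator_of_mem h, ← ofReal_norm]
      apply ENNReal.ofReal_le_ofReal
      rw [Real.norm_eq_abs]
      exact max_le (abs_nonneg _) (neg_le_abs _)
    · rw [Set.indicator_of_notMem h]
      have : 1 ≤ |y| := by
        by_contra hlt
        push Not at hlt
        rw [abs_lt] at hlt
        exact h ⟨hlt.1, hlt.2.le⟩
      have h0 : 0 ≤ Real.log y := by
        rw [← Real.log_abs]; exact Real.log_nonneg this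
      rw [max_eq_left (by linarith)]; simp
  refine ⟨Real.log 3 + (∫⁻ y : ℝ, ENNReal.ofReal (max 0 (-Real.log y))).toReal, ?_, ?_⟩
  · have := Real.log_pos (show (1:ℝ) < 3 by norm_num)
    positivity
  · intro b
    have hl := Real.log_nonneg (show (1:ℝ) ≤ 3 by norm_num)
    rw [ENNReal.ofReal_add hl ENNReal.toReal_nonneg, ENNReal.ofReal_toReal hfin.ne]
    have : ∀ x, ENNReal.ofReal (wt (x - b)) = ENNReal.ofReal (Real.log 3) +
        ENNReal.ofReal (max 0 (-Real.log (x-b))) := by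
      intro x; unfold wt; rw [ENNReal.ofReal_add hl (le_max_left _ _)]
    simp_rw [this]
    rw [lintegral_add_left measurable_const]
    refine add_le_add ?_ ?_
    · simp
    · calc _ ≤ ∫⁻ x : ℝ, ENNReal.ofReal (max 0 (-Real.log (x-b))) := setLIntegral_le_lintegral _ _
        _ = _ := lintegral_sub_right_eq_self (fun y => ENNReal.ofReal (max 0 (-Real.log y))) b

lemma factor_bound (x : ℝ) (hx : x ∈ Set.Icc (0:ℝ) 1) (a : ℂ) (hxa : x ≠ a.re) :
    Real.exp (-wt (x - a.re)) * (1 + ‖a‖) ≤ ‖(x:ℂ) - a‖ := by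
  have hy : 0 < |x - a.re| := abs_pos.mpr (sub_ne_zero.mpr hxa)
  have h1 : |x - a.re| ≤ ‖(x:ℂ) - a‖ := by
    have := Complex.abs_re_le_norm ((x:ℂ) - a)
    simpa using this
  have h3 : Real.exp (-wt (x - a.re)) ≤ 1/3 := by
    rw [show (1/3:ℝ) = Real.exp (-Real.log 3) by rw [Real.exp_neg, Real.exp_log (by norm_num)]; norm_num]
    apply Real.exp_le_exp.mpr
    unfold wt; have := le_max_left 0 (-Real.log (x - a.re)); linarith
  have h4 : Real.exp (-wt (x - a.re)) ≤ |x - a.re| / 3 := by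
    have : |x - a.re| / 3 = Real.exp (Real.log (x - a.re) - Real.log 3) := by
      rw [Real.exp_sub, ← Real.log_abs, Real.exp_log hy, Real.exp_log (by norm_num)]
    rw [this]
    apply Real.exp_le_exp.mpr
    unfold wt; have := le_max_right 0 (-Real.log (x - a.re)); linarith
  have hpos := Real.exp_pos (-wt (x - a.re))
  have hn := norm_nonneg a
  by_cases h : 2 ≤ ‖a‖
  · have : ‖a‖ - 1 ≤ ‖(x:ℂ) - a‖ := by
      have h5 := norm_sub_norm_le a (x:ℂ)
      rw [norm_sub_rev] at h5
      have : ‖(x:ℂ)‖ ≤ 1 := by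
        rw [Complex.norm_real, Real.norm_eq_abs, abs_le]; constructor <;> linarith [hx.1, hx.2]
      linarith
    nlinarith
  · push Not at h
    nlinarith

lemma prod_bound (s : Multiset ℂ) (x : ℝ) (hx : x ∈ Set.Icc (0:ℝ) 1) (hxa : ∀ a ∈ s, x ≠ a.re) :
    Real.exp (-(s.map (fun a => wt (x - a.re))).sum) * (s.map (fun a => 1 + ‖a‖)).prod ≤
      (s.map (fun a => ‖(x:ℂ) - a‖)).prod := by
  induction s using Multiset.induction_on with
  | empty => simp
  | cons a s ih =>
    have h1 := ih (fun b hb => hxa b (Multiset.mem_cons_of_mem hb))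
    have h2 := factor_bound x hx a (hxa a (Multiset.mem_cons_self a s))
    simp only [Multiset.map_cons, Multiset.sum_cons, Multiset.prod_cons]
    rw [neg_add, Real.exp_add]
    calc _ = (Real.exp (-wt (x - a.re)) * (1 + ‖a‖)) * (Real.exp (-(s.map (fun a => wt (x - a.re))).sum) * (s.map (fun a => 1 + ‖a‖)).prod) := by ring
      _ ≤ _ := by
        apply mul_le_mul h2 h1 _ (norm_nonneg _)
        refine mul_nonneg (Real.exp_pos _).le (Multiset.prod_nonneg ?_)
        intro b hb
        obtain ⟨c, _, rfl⟩ := Multiset.mem_map.mp hb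
        positivity

lemma prod_upper (s : Multiset ℂ) (x : ℝ) (hx : x ∈ Set.Icc (0:ℝ) 1)  :
    (s.map (fun a => ‖(x:ℂ) - a‖)).prod ≤ (s.map (fun a => 1 + ‖a‖)).prod := by
  apply Multiset.prod_map_le_prod_map₀
  · intro a _; positivity
  · intro a _
    have : ‖(x:ℂ)‖ ≤ 1 := by
      rw [Complex.norm_real, Real.norm_eq_abs, abs_le]; constructor <;> linarith [hx.1, hx.2]
    have := norm_sub_le (x:ℂ) a
    linarith

lemma sum_wt_nonneg (s : Multiset ℂ) (x : ℝ) : 0 ≤ (s.map (fun a => wt (x - a.re))).sum := by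
  apply Multiset.sum_nonneg
  intro b hb
  obtain ⟨c, _, rfl⟩ := Multiset.mem_map.mp hb
  exact wt_nonneg _

lemma measurable_sum_wt (s : Multiset ℂ) :
    Measurable (fun x : ℝ => (s.map (fun a => wt (x - a.re))).sum) := by
  induction s using Multiset.induction_on with
  | empty => simp
  | cons a s ih =>
    simp only [Multiset.map_cons, Multiset.sum_cons]
    exact (measurable_wt.comp (measurable_id.sub_const _)).add ih

lemma lintegral_sum_wt (C : ℝ) (hC : ∀ b : ℝ,
    ∫⁻ x in Set.Icc (0:ℝ) 1, ENNReal.ofReal (wt (x - b)) ≤ ENNReal.ofReal C) (s : Multiset ℂ) :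
    ∫⁻ x in Set.Icc (0:ℝ) 1, ENNReal.ofReal ((s.map (fun a => wt (x - a.re))).sum) ≤
      s.card * ENNReal.ofReal C := by
  induction s using Multiset.induction_on with
  | empty => simp
  | cons a s ih =>
    simp only [Multiset.map_cons, Multiset.sum_cons, Multiset.card_cons]
    simp_rw [ENNReal.ofReal_add (wt_nonneg _) (sum_wt_nonneg s _)]
    rw [lintegral_add_left]
    · push_cast
      rw [add_mul, one_mul, add_comm]
      exact add_le_add ih (hC _)
    · exact (measurable_wt.comp (measurable_id.sub_const _)).ennreal_ofReal

lemma norm_eval_eq (p : Polynomial ℂ) (z : ℂ) :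
    ‖p.eval z‖ = ‖p.leadingCoeff‖ * (p.roots.map (fun a => ‖z - a‖)).prod := by
  have h := (IsAlgClosed.splits p).eval_eq_prod_roots z
  rw [h, norm_mul]
  congr 1
  generalize p.roots = s
  induction s using Multiset.induction_on with
  | empty => simp
  | cons a s ih => simp [ih]

/-- One-dimensional `L²` Remez inequality. -/
lemma remez1 : ∃ D : ℝ, 1 ≤ D ∧ ∀ (n : ℕ) (p : Polynomial ℂ), p.natDegree ≤ n →
    ∀ S : Set ℝ, MeasurableSet S → volume (Set.Icc (0:ℝ) 1 \ S) < 1/2 →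
    ∫⁻ x in Set.Icc (0:ℝ) 1, ‖p.eval (x:ℂ)‖ₑ ^ 2 ≤
      ENNReal.ofReal (D ^ (n+1)) * ∫⁻ x in Set.Icc (0:ℝ) 1 ∩ S, ‖p.eval (x:ℂ)‖ₑ ^ 2 := by
  obtain ⟨C, hC0, hC⟩ := exists_wt_bound
  refine ⟨4 * Real.exp (8 * C), ?_, ?_⟩
  · have := Real.one_le_exp (show 0 ≤ 8 * C by positivity)
    linarith
  intro n p hp S hS hvol
  set lam : ℝ := 4 * (n+1) * C with hlam
  set G : ℝ → ℝ := fun x => (p.roots.map (fun a => wt (x - a.re))).sum with hG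
  have hGm : Measurable G := measurable_sum_wt _
  set M : ℝ := ‖p.leadingCoeff‖ * (p.roots.map (fun a => 1 + ‖a‖)).prod with hM
  set B : Set ℝ := Set.Icc (0:ℝ) 1 ∩ {x | lam ≤ G x} with hB
  set Z : Set ℝ := {x | ∃ a ∈ p.roots, x = a.re} with hZ
  have hZf : Z.Finite := by
    have : Z = Complex.re '' (↑p.roots.toFinset : Set ℂ) := by
      ext x; simp [hZ, eq_comm]
    rw [this]; exact (Finset.finite_toSet _).image _
  have hlampos : 0 < lam := by positivity
  have hBv : volume B ≤ 1/4 := by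
    have h1 : ENNReal.ofReal lam * volume B ≤ (n:ℝ≥0∞) * ENNReal.ofReal C := by
      have h2 := mul_meas_ge_le_lintegral₀ (μ := volume.restrict (Set.Icc (0:ℝ) 1))
        (hGm.ennreal_ofReal.aemeasurable) (ENNReal.ofReal lam)
      have h3 : volume B ≤ (volume.restrict (Set.Icc (0:ℝ) 1)) {x | ENNReal.ofReal lam ≤ ENNReal.ofReal (G x)} := by
        rw [Measure.restrict_apply (measurableSet_le measurable_const hGm.ennreal_ofReal)]
        apply measure_mono
        rintro x ⟨hx1, hx2⟩
        exact ⟨ENNReal.ofReal_le_ofReal hx2, hx1⟩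
      calc _ ≤ _ := by gcongr
        _ ≤ _ := h2
        _ ≤ _ := lintegral_sum_wt C hC p.roots
        _ ≤ _ := by
          gcongr
          exact (Polynomial.card_roots' p).trans hp
    have hne : volume B ≠ ∞ := by
      refine ne_top_of_le_ne_top ?_ (measure_mono Set.inter_subset_left)
      simp
    rw [← ENNReal.ofReal_toReal hne] at h1 ⊢
    rw [← ENNReal.ofReal_mul hlampos.le, ← ENNReal.ofReal_natCast, ← ENNReal.ofReal_mul (by positivity)] at h1
    rw [ENNReal.ofReal_le_ofReal_iff (by positivity)] at h1
    have h5 : (volume B).toReal ≤ 1/4 := by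
      by_contra hcon
      push Not at hcon
      have : lam * (1/4) < lam * (volume B).toReal := by gcongr
      have h6 : (n:ℝ) * C < (n+1) * C := by nlinarith
      rw [hlam] at this
      nlinarith
    refine (ENNReal.ofReal_le_ofReal h5).trans ?_
    rw [ENNReal.ofReal_div_of_pos (by norm_num)]; simp
  set S' : Set ℝ := (Set.Icc (0:ℝ) 1 ∩ S) \ (B ∪ Z) with hS'
  have hBm : MeasurableSet B := measurableSet_Icc.inter (measurableSet_le measurable_const hGm)
  have hS'm : MeasurableSet S' := (measurableSet_Icc.inter hS).diff (hBm.union hZf.measurableSet)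
  have hS'v : 1/4 ≤ volume S' := by
    have h1 : (1:ℝ≥0∞) ≤ volume (Set.Icc (0:ℝ) 1 \ S) + (volume S' + (volume B + volume Z)) := by
      have : volume (Set.Icc (0:ℝ) 1) = 1 := by simp
      rw [← this]
      calc volume (Set.Icc (0:ℝ) 1) ≤ volume ((Set.Icc (0:ℝ) 1 \ S) ∪ (S' ∪ (B ∪ Z))) := by
            apply measure_mono
            intro x hx
            by_cases h1 : x ∈ S
            · by_cases h2 : x ∈ B ∪ Z
              · exact Or.inr (Or.inr h2)
              · exact Or.inr (Or.inl ⟨⟨hx, h1⟩, h2⟩)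
            · exact Or.inl ⟨hx, h1⟩
        _ ≤ _ := (measure_union_le _ _).trans (by gcongr; exact (measure_union_le _ _).trans (by gcongr; exact measure_union_le _ _))
    rw [hZf.measure_zero, add_zero] at h1
    by_contra hcon
    push Not at hcon
    have hsum : volume (Set.Icc (0:ℝ) 1 \ S) + (volume S' + volume B) < 1/2 + (1/4 + 1/4) := by
      refine ENNReal.add_lt_add hvol ?_
      exact ENNReal.add_lt_add_of_lt_of_le (ne_top_of_le_ne_top (by simp) hBv) hcon hBv
    have : (1/2 + (1/4 + 1/4) : ℝ≥0∞) = 1 := by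
      have e4 : (1/4 : ℝ≥0∞) = ENNReal.ofReal (1/4) := by
        rw [ENNReal.ofReal_div_of_pos (by norm_num)]; simp
      have e2 : (1/2 : ℝ≥0∞) = ENNReal.ofReal (1/2) := by
        rw [ENNReal.ofReal_div_of_pos (by norm_num)]; simp
      rw [e4, e2, ← ENNReal.ofReal_add (by norm_num) (by norm_num), ← ENNReal.ofReal_add (by norm_num) (by norm_num)]
      norm_num
    rw [this] at hsum
    exact absurd h1 (not_le.mpr hsum)
  have hMnn : 0 ≤ M := by
    refine mul_nonneg (norm_nonneg _) (Multiset.prod_nonneg ?_)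
    intro b hb
    obtain ⟨c, _, rfl⟩ := Multiset.mem_map.mp hb
    positivity
  have hup : ∀ x ∈ Set.Icc (0:ℝ) 1, ‖p.eval (x:ℂ)‖ ≤ M := by
    intro x hx
    rw [norm_eval_eq]
    exact mul_le_mul_of_nonneg_left (prod_upper _ x hx) (norm_nonneg _)
  have hlow : ∀ x ∈ S', Real.exp (-lam) * M ≤ ‖p.eval (x:ℂ)‖ := by
    rintro x ⟨⟨hx, hxS⟩, hx2⟩
    rw [norm_eval_eq]
    have hxB : G x < lam := by
      by_contra hcon
      exact hx2 (Or.inl ⟨hx, not_lt.mp hcon⟩)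
    have hxZ : ∀ a ∈ p.roots, x ≠ a.re := by
      intro a ha h; exact hx2 (Or.inr ⟨a, ha, h⟩)
    have h1 := prod_bound p.roots x hx hxZ
    calc Real.exp (-lam) * M ≤ Real.exp (-G x) * M := by gcongr
      _ = ‖p.leadingCoeff‖ * (Real.exp (-G x) * (p.roots.map (fun a => 1 + ‖a‖)).prod) := by rw [hM]; ring
      _ ≤ _ := by gcongr
  calc ∫⁻ x in Set.Icc (0:ℝ) 1, ‖p.eval (x:ℂ)‖ₑ ^ 2 ≤ ∫⁻ x in Set.Icc (0:ℝ) 1, ENNReal.ofReal (M^2) := by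
        refine setLIntegral_mono measurable_const ?_
        intro x hx
        rw [← ofReal_norm, ← ENNReal.ofReal_pow (norm_nonneg _)]
        apply ENNReal.ofReal_le_ofReal
        gcongr; exact hup x hx
    _ = ENNReal.ofReal (M^2) := by simp
    _ ≤ ENNReal.ofReal ((4 * Real.exp (8 * C)) ^ (n+1)) * (ENNReal.ofReal ((Real.exp (-lam) * M)^2) * volume S') := by
        calc ENNReal.ofReal (M^2) ≤ ENNReal.ofReal ((4 * Real.exp (8 * C)) ^ (n+1)) * (ENNReal.ofReal ((Real.exp (-lam) * M)^2) * ENNReal.ofReal (1/4)) := by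
              rw [← ENNReal.ofReal_mul (by positivity), ← ENNReal.ofReal_mul (by positivity)]
              apply ENNReal.ofReal_le_ofReal
              have e1 : (4 * Real.exp (8 * C)) ^ (n+1) = 4^(n+1) * Real.exp (2 * lam) := by
                rw [mul_pow, ← Real.exp_nat_mul, hlam]; congr 2; push_cast; ring
              have e2 : Real.exp (2 * lam) * (Real.exp (-lam))^2 = 1 := by
                rw [← Real.exp_nat_mul, ← Real.exp_add]; simp
              rw [e1, mul_pow (Real.exp (-lam)) M]
              have e3 : (4:ℝ)^(n+1) * (1/4) = 4^n := by rw [pow_succ]; ring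
              have : (4:ℝ)^(n+1) * Real.exp (2*lam) * (Real.exp (-lam)^2 * M^2 * (1/4)) =
                 (4^(n+1) * (1/4)) * (Real.exp (2 * lam) * (Real.exp (-lam))^2) * M^2 := by ring
              rw [this, e2, e3, mul_one]
              have : (1:ℝ) ≤ 4^n := one_le_pow₀ (by norm_num)
              nlinarith [sq_nonneg M]
          _ ≤ _ := by
              gcongr
              refine le_trans (le_of_eq ?_) hS'v
              rw [ENNReal.ofReal_div_of_pos (by norm_num)]; simp
    _ ≤ _ := by
        gcongr
        calc _ = ∫⁻ x in S', ENNReal.ofReal ((Real.exp (-lam) * M)^2) := by simp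
          _ ≤ ∫⁻ x in S', ‖p.eval (x:ℂ)‖ₑ ^ 2 := by
            refine setLIntegral_mono' hS'm ?_
            intro x hx
            rw [← ofReal_norm, ← ENNReal.ofReal_pow (norm_nonneg _)]
            apply ENNReal.ofReal_le_ofReal
            gcongr; exact hlow x hx
          _ ≤ _ := lintegral_mono_set Set.sdiff_subset

end IK

namespace IK

/-- separately polynomial of degree at most `n` in each variable -/
def SepPoly (d n : ℕ) (g : (Fin d → ℝ) → ℂ) : Prop :=
  ∀ (i : Fin d) (x : Fin d → ℝ), ∃ p : Polynomial ℂ, p.natDegree ≤ n ∧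
    ∀ s : ℝ, g (Function.update x i s) = p.eval (s:ℂ)

lemma lintegral_cons {d : ℕ} (F : (Fin (d+1) → ℝ) → ℝ≥0∞) (hF : Measurable F) :
    ∫⁻ x, F x = ∫⁻ s : ℝ, ∫⁻ x' : Fin d → ℝ, F (Fin.cons s x') := by
  have hmp := (volume_preserving_piFinSuccAbove (fun _ : Fin (d+1) => ℝ) 0).symm
  rw [← hmp.lintegral_comp hF, Measure.volume_eq_prod, lintegral_prod]
  · simp [MeasurableEquiv.piFinSuccAbove, Fin.insertNthEquiv]
  · exact (hF.comp (MeasurableEquiv.measurable _)).aemeasurable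

lemma measurable_cons {d : ℕ} : Measurable (fun q : ℝ × (Fin d → ℝ) => (Fin.cons q.1 q.2 : Fin (d+1) → ℝ)) := by
  refine measurable_pi_iff.mpr fun i => ?_
  refine Fin.cases ?_ (fun j => ?_) i
  · simpa using measurable_fst
  · simp only [Fin.cons_succ]; exact (measurable_pi_apply j).comp measurable_snd

lemma continuous_cons {d : ℕ} : Continuous (fun q : ℝ × (Fin d → ℝ) => (Fin.cons q.1 q.2 : Fin (d+1) → ℝ)) := by
  refine continuous_pi fun i => ?_
  refine Fin.cases ?_ (fun j => ?_) i
  · simpa using continuous_fst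
  · simp only [Fin.cons_succ]; exact (continuous_apply j).comp continuous_snd

lemma cons_mem_Icc {d : ℕ} (s : ℝ) (x' : Fin d → ℝ) :
    (Fin.cons s x' : Fin (d+1) → ℝ) ∈ Set.Icc (0 : Fin (d+1) → ℝ) 1 ↔ s ∈ Set.Icc (0:ℝ) 1 ∧ x' ∈ Set.Icc (0 : Fin d → ℝ) 1 := by
  simp only [Set.mem_Icc, Pi.le_def, Fin.forall_fin_succ, Fin.cons_zero, Fin.cons_succ, Pi.zero_apply, Pi.one_apply]
  tauto

lemma setLIntegral_cons {d : ℕ} (F : (Fin (d+1) → ℝ) → ℝ≥0∞) (hF : Measurable F)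
    (T : Set (Fin (d+1) → ℝ)) (hT : MeasurableSet T) :
    ∫⁻ x in Set.Icc (0 : Fin (d+1) → ℝ) 1 ∩ T, F x =
     ∫⁻ s in Set.Icc (0:ℝ) 1, ∫⁻ x' in Set.Icc (0 : Fin d → ℝ) 1 ∩ {x' | Fin.cons s x' ∈ T}, F (Fin.cons s x') := by
  have hm : MeasurableSet (Set.Icc (0 : Fin (d+1) → ℝ) 1 ∩ T) := measurableSet_Icc.inter hT
  rw [← lintegral_indicator hm, lintegral_cons _ (hF.indicator hm),
    ← lintegral_indicator measurableSet_Icc]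
  congr 1
  ext s
  have hsl : MeasurableSet {x' : Fin d → ℝ | (Fin.cons s x' : Fin (d+1) → ℝ) ∈ T} :=
    (measurable_cons.comp (measurable_prodMk_left (x := s))) hT
  by_cases hs : s ∈ Set.Icc (0:ℝ) 1
  · rw [Set.indicator_of_mem hs, ← lintegral_indicator (measurableSet_Icc.inter hsl)]
    congr 1
    ext x'
    by_cases h : x' ∈ Set.Icc (0 : Fin d → ℝ) 1 ∩ {x' | Fin.cons s x' ∈ T}
    · rw [Set.indicator_of_mem h, Set.indicator_of_mem]
      exact ⟨(cons_mem_Icc _ _).mpr ⟨hs, h.1⟩, h.2⟩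
    · rw [Set.indicator_of_notMem h, Set.indicator_of_notMem]
      rintro ⟨h1, h2⟩
      exact h ⟨((cons_mem_Icc _ _).mp h1).2, h2⟩
  · rw [Set.indicator_of_notMem hs]
    rw [← lintegral_zero (μ := (volume : Measure (Fin d → ℝ)))]
    congr 1
    ext x'
    rw [Set.indicator_of_notMem]
    rintro ⟨h1, h2⟩
    exact hs ((cons_mem_Icc _ _).mp h1).1

/-- `d`-dimensional `L²` Remez inequality. -/
lemma remez_pi (D : ℝ) (hD : 1 ≤ D) (hrem : ∀ (n : ℕ) (p : Polynomial ℂ), p.natDegree ≤ n →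
    ∀ S : Set ℝ, MeasurableSet S → volume (Set.Icc (0:ℝ) 1 \ S) < 1/2 →
    ∫⁻ x in Set.Icc (0:ℝ) 1, ‖p.eval (x:ℂ)‖ₑ ^ 2 ≤
      ENNReal.ofReal (D ^ (n+1)) * ∫⁻ x in Set.Icc (0:ℝ) 1 ∩ S, ‖p.eval (x:ℂ)‖ₑ ^ 2) (n : ℕ) (d : ℕ) :
    ∀ (g : (Fin d → ℝ) → ℂ), Continuous g → SepPoly d n g →
    ∀ T : Set (Fin d → ℝ), MeasurableSet T → volume (Set.Icc (0:Fin d → ℝ) 1 \ T) < (1/2)^d →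
    ∫⁻ x in Set.Icc (0:Fin d → ℝ) 1, ‖g x‖ₑ ^ 2 ≤
      ENNReal.ofReal (D ^ (n+1)) ^ d * ∫⁻ x in Set.Icc (0:Fin d → ℝ) 1 ∩ T, ‖g x‖ₑ ^ 2 := by
  induction d with
  | zero =>
    intro g hg _ T hT hv
    simp only [pow_zero, one_mul] at hv ⊢
    apply lintegral_mono_set
    intro x hx
    refine ⟨hx, ?_⟩
    by_contra hxT
    have : Set.Icc (0:Fin 0 → ℝ) 1 \ T = Set.Icc (0:Fin 0 → ℝ) 1 := by
      ext y
      rw [Subsingleton.elim y x]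
      simp [hxT]
    rw [this, Real.volume_Icc_pi] at hv
    simp at hv
  | succ d ih =>
    intro g hg hpoly T hT hv
    set A := ENNReal.ofReal (D ^ (n+1)) with hA
    have hm : Measurable (fun x => ‖g x‖ₑ ^ 2) := by
      have := hg.measurable
      fun_prop
    have hTs : ∀ s : ℝ, MeasurableSet {x' : Fin d → ℝ | (Fin.cons s x' : Fin (d+1) → ℝ) ∈ T} := fun s =>
      (measurable_cons.comp (measurable_prodMk_left (x := s))) hT
    -- volume of bad slices
    set v : ℝ → ℝ≥0∞ := fun s => volume (Set.Icc (0:Fin d → ℝ) 1 \ {x' | (Fin.cons s x' : Fin (d+1) → ℝ) ∈ T}) with hvdef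
    have hvm : Measurable v := by
      have : MeasurableSet {q : ℝ × (Fin d → ℝ) | q.2 ∈ Set.Icc (0:Fin d → ℝ) 1 ∧ (Fin.cons q.1 q.2 : Fin (d+1) → ℝ) ∉ T} :=
        (measurable_snd measurableSet_Icc).inter (measurable_cons hT).compl
      exact measurable_measure_prodMk_left this
    have hvint : ∫⁻ s in Set.Icc (0:ℝ) 1, v s = volume (Set.Icc (0:Fin (d+1) → ℝ) 1 \ T) := by
      have := setLIntegral_cons (d := d) (fun _ => 1) measurable_const Tᶜ hT.compl
      simp only [setLIntegral_one] at this
      rw [Set.sdiff_eq, this]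
      rfl
    set S : Set ℝ := {s | v s < (1/2)^d} with hS
    have hSm : MeasurableSet S := measurableSet_lt hvm measurable_const
    have hSv : volume (Set.Icc (0:ℝ) 1 \ S) < 1/2 := by
      have h2 := mul_meas_ge_le_lintegral₀ (μ := volume.restrict (Set.Icc (0:ℝ) 1))
        hvm.aemeasurable ((1/2)^d)
      rw [hvint, Measure.restrict_apply (measurableSet_le measurable_const hvm)] at h2
      have h3 : {x | (1/2)^d ≤ v x} ∩ Set.Icc (0:ℝ) 1 = Set.Icc (0:ℝ) 1 \ S := by
        ext x; simp [hS]; tauto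
      rw [h3] at h2
      have h4 := h2.trans_lt hv
      rw [pow_succ] at h4
      by_contra hcon
      push Not at hcon
      exact absurd h4 (not_lt.mpr (by gcongr))
    have hgc : ∀ s : ℝ, Continuous (fun x' : Fin d → ℝ => g (Fin.cons s x')) := fun s =>
      hg.comp (continuous_cons.comp (by fun_prop : Continuous fun x' : Fin d → ℝ => (s, x')))
    have hcm : Measurable (fun q : ℝ × (Fin d → ℝ) => ‖g (Fin.cons q.1 q.2)‖ₑ ^ 2) :=
      hm.comp measurable_cons
    have hstep : ∀ s ∈ S, ∫⁻ x' in Set.Icc (0:Fin d → ℝ) 1, ‖g (Fin.cons s x')‖ₑ ^ 2 ≤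
        A ^ d * ∫⁻ x' in Set.Icc (0:Fin d → ℝ) 1 ∩ {x' | (Fin.cons s x' : Fin (d+1) → ℝ) ∈ T}, ‖g (Fin.cons s x')‖ₑ ^ 2 := by
      intro s hs
      refine ih (fun x' => g (Fin.cons s x')) (hgc s) ?_ _ (hTs s) hs
      intro i x
      obtain ⟨p, hp1, hp2⟩ := hpoly i.succ (Fin.cons s x)
      refine ⟨p, hp1, fun r => ?_⟩
      rw [← hp2 r, ← Fin.cons_update]
    have hline : ∀ x' : Fin d → ℝ, ∫⁻ s in Set.Icc (0:ℝ) 1, ‖g (Fin.cons s x')‖ₑ ^ 2 ≤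
        A * ∫⁻ s in Set.Icc (0:ℝ) 1 ∩ S, ‖g (Fin.cons s x')‖ₑ ^ 2 := by
      intro x'
      obtain ⟨p, hp1, hp2⟩ := hpoly 0 (Fin.cons 0 x')
      have : ∀ s : ℝ, g (Fin.cons s x') = p.eval (s:ℂ) := by
        intro s; rw [← hp2 s, Fin.update_cons_zero]
      simp_rw [this]
      exact hrem n p hp1 S hSm hSv
    have e1 := setLIntegral_cons (d := d) (fun x => ‖g x‖ₑ ^ 2) hm Set.univ MeasurableSet.univ
    simp only [Set.inter_univ, Set.mem_univ, Set.ofPred_true] at e1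
    rw [e1, setLIntegral_cons (d := d) (fun x => ‖g x‖ₑ ^ 2) hm T hT]
    calc ∫⁻ s in Set.Icc (0:ℝ) 1, ∫⁻ x' in Set.Icc (0 : Fin d → ℝ) 1, ‖g (Fin.cons s x')‖ₑ ^ 2
        = ∫⁻ x' in Set.Icc (0 : Fin d → ℝ) 1, ∫⁻ s in Set.Icc (0:ℝ) 1, ‖g (Fin.cons s x')‖ₑ ^ 2 :=
          lintegral_lintegral_swap hcm.aemeasurable
      _ ≤ ∫⁻ x' in Set.Icc (0 : Fin d → ℝ) 1, A * ∫⁻ s in Set.Icc (0:ℝ) 1 ∩ S, ‖g (Fin.cons s x')‖ₑ ^ 2 :=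
          lintegral_mono hline
      _ = A * ∫⁻ x' in Set.Icc (0 : Fin d → ℝ) 1, ∫⁻ s in Set.Icc (0:ℝ) 1 ∩ S, ‖g (Fin.cons s x')‖ₑ ^ 2 :=
          lintegral_const_mul' _ _ ENNReal.ofReal_ne_top
      _ = A * ∫⁻ s in Set.Icc (0:ℝ) 1 ∩ S, ∫⁻ x' in Set.Icc (0 : Fin d → ℝ) 1, ‖g (Fin.cons s x')‖ₑ ^ 2 := by
          congr 1
          exact (lintegral_lintegral_swap hcm.aemeasurable).symm
      _ ≤ A * ∫⁻ s in Set.Icc (0:ℝ) 1 ∩ S, A ^ d * ∫⁻ x' in Set.Icc (0:Fin d → ℝ) 1 ∩ {x' | (Fin.cons s x' : Fin (d+1) → ℝ) ∈ T}, ‖g (Fin.cons s x')‖ₑ ^ 2 := by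
          gcongr A * ?_
          exact setLIntegral_mono' (measurableSet_Icc.inter hSm) (fun s hs => hstep s hs.2)
      _ = A ^ (d+1) * ∫⁻ s in Set.Icc (0:ℝ) 1 ∩ S, ∫⁻ x' in Set.Icc (0:Fin d → ℝ) 1 ∩ {x' | (Fin.cons s x' : Fin (d+1) → ℝ) ∈ T}, ‖g (Fin.cons s x')‖ₑ ^ 2 := by
          rw [lintegral_const_mul' _ _ (ENNReal.pow_ne_top ENNReal.ofReal_ne_top), ← mul_assoc, pow_succ A d, mul_comm A]
      _ ≤ _ := by
          gcongr
          exact Set.inter_subset_left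

end IK

namespace IK

/-- plane wave -/
noncomputable def ew {d : ℕ} (ξ y : Fin d → ℝ) : ℂ :=
  Complex.exp (((2 * π * ∑ i, ξ i * y i : ℝ) : ℂ) * Complex.I)

lemma ew_add {d : ℕ} (ξ y z : Fin d → ℝ) : ew ξ (y + z) = ew ξ y * ew ξ z := by
  unfold ew
  rw [← Complex.exp_add, ← add_mul, ← Complex.ofReal_add]
  congr 3
  simp only [Pi.add_apply, mul_add, Finset.sum_add_distrib]

lemma ew_sub_left {d : ℕ} (ξ η y : Fin d → ℝ) :
    ew (ξ - η) y = ew ξ y * (starRingEnd ℂ) (ew η y) := by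
  unfold ew
  rw [← Complex.exp_conj, ← Complex.exp_add]
  congr 1
  simp only [Pi.sub_apply, sub_mul, Finset.sum_sub_distrib, mul_sub, map_mul, Complex.conj_ofReal, Complex.conj_I]
  push_cast
  ring

lemma norm_ew {d : ℕ} (ξ y : Fin d → ℝ) : ‖ew ξ y‖ = 1 := by
  unfold ew; exact Complex.norm_exp_ofReal_mul_I _

lemma continuous_ew {d : ℕ} (ξ : Fin d → ℝ) : Continuous (ew ξ) := by
  unfold ew; fun_prop

/-- the box of side `n` -/
def box (d n : ℕ) : Set (Fin d → ℝ) := Set.univ.pi fun _ => Set.Ioc (-(n:ℝ)/2) ((n:ℝ)/2)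

lemma measurableSet_box (d n : ℕ) : MeasurableSet (box d n) :=
  MeasurableSet.univ_pi fun _ => measurableSet_Ioc

lemma volume_box (d n : ℕ) : volume (box d n) = ENNReal.ofReal ((n:ℝ)^d) := by
  unfold box
  rw [volume_pi_pi]
  simp only [Real.volume_Ioc]
  rw [Finset.prod_const, Finset.card_univ, Fintype.card_fin, ENNReal.ofReal_pow (by positivity)]
  congr 2; ring

lemma integral_ew_one (n : ℕ) (hn : 0 < n) (a : ℝ) (k : ℤ) (hk : n * a = k) (ha : a ≠ 0) :
    ∫ y in Set.Ioc (-(n:ℝ)/2) ((n:ℝ)/2), Complex.exp (((2 * π * a : ℝ) * Complex.I) * (y:ℂ)) = 0 := by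
  have hn' : (0:ℝ) < n := by exact_mod_cast hn
  rw [← intervalIntegral.integral_of_le (by linarith)]
  have hne : ((2 * π * a : ℝ) : ℂ) * Complex.I ≠ 0 := by
    refine mul_ne_zero ?_ Complex.I_ne_zero
    exact_mod_cast mul_ne_zero (mul_ne_zero two_ne_zero Real.pi_ne_zero) ha
  rw [integral_exp_mul_complex hne]
  have : Complex.exp (((2 * π * a : ℝ) * Complex.I) * (((n:ℝ)/2 : ℝ):ℂ)) =
      Complex.exp (((2 * π * a : ℝ) * Complex.I) * ((-(n:ℝ)/2 : ℝ):ℂ)) := by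
    rw [Complex.exp_eq_exp_iff_exists_int]
    refine ⟨k, ?_⟩
    have hk' : ((n:ℝ):ℂ) * (a:ℂ) = (k:ℂ) := by exact_mod_cast congrArg (fun r : ℝ => (r:ℂ)) hk
    rw [← hk']
    push_cast
    ring
  rw [this, sub_self, zero_div]

lemma integral_ew {d : ℕ} (n : ℕ) (hn : 0 < n) (ζ : Fin d → ℝ) (hζ : ∀ i, ∃ k : ℤ, n * ζ i = k) :
    ∫ y in box d n, ew ζ y = if ζ = 0 then ((n:ℝ)^d : ℝ) else 0 := by
  have hn' : (0:ℝ) < n := by exact_mod_cast hn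
  split_ifs with h
  · subst h
    have : ∀ y : Fin d → ℝ, ew 0 y = 1 := by intro y; simp [ew]
    simp_rw [this]
    rw [setIntegral_const, Measure.real, volume_box, ENNReal.toReal_ofReal (by positivity)]
    simp
  · have hex : ∃ i, ζ i ≠ 0 := by
      by_contra hcon; push Not at hcon; exact h (funext hcon)
    obtain ⟨i, hi⟩ := hex
    have e1 : ∀ y : Fin d → ℝ, ew ζ y = ∏ j, Complex.exp (((2 * π * ζ j : ℝ) * Complex.I) * (y j:ℂ)) := by
      intro y
      rw [← Complex.exp_sum]
      unfold ew
      congr 1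
      push_cast
      rw [Finset.mul_sum, Finset.sum_mul]
      refine Finset.sum_congr rfl fun j _ => ?_
      ring
    simp_rw [e1]
    unfold box
    rw [volume_pi, Measure.restrict_pi_pi]
    rw [integral_fintype_prod_eq_prod (𝕜 := ℂ) (fun j (y:ℝ) => Complex.exp (((2 * π * ζ j : ℝ) * Complex.I) * (y:ℂ)))]
    obtain ⟨k, hk⟩ := hζ i
    exact Finset.prod_eq_zero (Finset.mem_univ i) (integral_ew_one n hn (ζ i) k hk hi)

lemma integrableOn_box {d n : ℕ} (f : (Fin d → ℝ) → ℂ) (hf : Continuous f) : IntegrableOn f (box d n) := by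
  have : IntegrableOn f (Set.univ.pi fun _ => Set.Icc (-(n:ℝ)/2) ((n:ℝ)/2)) :=
    hf.continuousOn.integrableOn_compact (isCompact_univ_pi fun _ => isCompact_Icc)
  exact this.mono_set (Set.pi_mono fun _ _ => Set.Ioc_subset_Icc_self)

lemma parseval {d : ℕ} (n : ℕ) (hn : 0 < n) (Z : Finset (Fin d → ℝ))
    (hZ : ∀ ξ ∈ Z, ∀ i, ∃ k : ℤ, n * ξ i = k) (c : (Fin d → ℝ) → ℂ) :
    ∫⁻ y in box d n, ‖∑ ξ ∈ Z, c ξ * ew ξ y‖ₑ ^ 2 = ENNReal.ofReal ((n:ℝ)^d * ∑ ξ ∈ Z, ‖c ξ‖^2) := by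
  classical
  set f : (Fin d → ℝ) → ℂ := fun y => ∑ ξ ∈ Z, c ξ * ew ξ y with hf
  have hfc : Continuous f := by
    refine continuous_finsetSum _ fun ξ _ => ?_
    exact continuous_const.mul (continuous_ew ξ)
  have key : ∫ y in box d n, f y * (starRingEnd ℂ) (f y) = (((n:ℝ)^d * ∑ ξ ∈ Z, ‖c ξ‖^2 : ℝ) : ℂ) := by
    have e1 : ∀ y, f y * (starRingEnd ℂ) (f y) =
        ∑ ξ ∈ Z, ∑ η ∈ Z, (c ξ * (starRingEnd ℂ) (c η)) * ew (ξ - η) y := by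
      intro y
      simp only [hf, map_sum, Finset.sum_mul_sum, map_mul]
      refine Finset.sum_congr rfl fun ξ _ => Finset.sum_congr rfl fun η _ => ?_
      rw [ew_sub_left]; ring
    simp_rw [e1]
    have hi : ∀ ξ η : Fin d → ℝ, IntegrableOn (fun y => (c ξ * (starRingEnd ℂ) (c η)) * ew (ξ - η) y) (box d n) :=
      fun ξ η => integrableOn_box _ (continuous_const.mul (continuous_ew _))
    rw [integral_finsetSum _ (fun ξ _ => integrable_finsetSum _ fun η _ => hi ξ η)]
    push_cast
    rw [Finset.mul_sum]
    refine Finset.sum_congr rfl fun ξ hξ => ?_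
    rw [integral_finsetSum _ (fun η _ => hi ξ η)]
    rw [Finset.sum_eq_single ξ]
    · rw [integral_const_mul, integral_ew n hn _ (fun i => ⟨0, by simp⟩)]
      · simp only [sub_self, if_true]
        rw [Complex.mul_conj, Complex.normSq_eq_norm_sq]
        push_cast; ring
    · intro η hη hne
      rw [integral_const_mul, integral_ew n hn]
      · rw [if_neg (sub_ne_zero.mpr hne.symm), Complex.ofReal_zero, mul_zero]
      · intro i
        obtain ⟨k, hk⟩ := hZ ξ hξ i
        obtain ⟨l, hl⟩ := hZ η hη i
        refine ⟨k - l, ?_⟩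
        push_cast
        rw [← hk, ← hl, Pi.sub_apply]; ring
    · intro h; exact absurd hξ h
  have key2 : ∫ y in box d n, ‖f y‖^2 = (n:ℝ)^d * ∑ ξ ∈ Z, ‖c ξ‖^2 := by
    have : ∀ y, f y * (starRingEnd ℂ) (f y) = ((‖f y‖^2 : ℝ) : ℂ) := by
      intro y; rw [Complex.mul_conj, Complex.normSq_eq_norm_sq]
    simp_rw [this] at key
    rw [integral_complex_ofReal] at key
    exact_mod_cast key
  have hintg : IntegrableOn (fun y => ‖f y‖^2) (box d n) := by
    have := integrableOn_box (n := n) (fun y => f y * (starRingEnd ℂ) (f y)) (hfc.mul (Complex.continuous_conj.comp hfc))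
    have := this.norm
    refine this.congr ?_
    filter_upwards with y
    rw [norm_mul, RCLike.norm_conj, sq]
  rw [← key2, ofReal_integral_eq_lintegral_ofReal hintg (by filter_upwards with y; positivity)]
  refine lintegral_congr fun y => ?_
  rw [ENNReal.ofReal_pow (norm_nonneg _), ofReal_norm]

end IK

namespace IK

lemma enorm_sq_le (a b : ℂ) : ‖a‖ₑ ^ 2 ≤ 2 * ‖b‖ₑ ^ 2 + 2 * ‖a - b‖ₑ ^ 2 := by
  have h : ‖a‖^2 ≤ 2 * ‖b‖^2 + 2 * ‖a-b‖^2 := by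
    have h1 : ‖a‖ ≤ ‖b‖ + ‖a - b‖ := by
      calc ‖a‖ = ‖b + (a - b)‖ := by congr 1; ring
        _ ≤ _ := norm_add_le _ _
    have h2 : ‖a‖^2 ≤ (‖b‖ + ‖a - b‖)^2 := by gcongr
    nlinarith [sq_nonneg (‖b‖ - ‖a-b‖)]
  have h2 := ENNReal.ofReal_le_ofReal h
  rw [ENNReal.ofReal_add (by positivity) (by positivity), ENNReal.ofReal_mul (by norm_num),
    ENNReal.ofReal_mul (by norm_num), ENNReal.ofReal_pow (norm_nonneg _),
    ENNReal.ofReal_pow (norm_nonneg _), ENNReal.ofReal_pow (norm_nonneg _)] at h2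
  simpa using h2

/-- truncated exponential -/
noncomputable def texp (k : ℕ) (w : ℂ) : ℂ := ∑ m ∈ Finset.range k, w ^ m / (m.factorial : ℂ)

lemma sepPoly_texp {d : ℕ} (k : ℕ) (ξ : Fin d → ℝ) (l : ℝ) :
    SepPoly d k (fun t => texp k (((2 * π * ∑ i, ξ i * (l * t i) : ℝ) : ℂ) * Complex.I)) := by
  intro i x
  set a : ℂ := ((2 * π * ∑ j ∈ Finset.univ.erase i, ξ j * (l * x j) : ℝ) : ℂ) * Complex.I with ha
  set b : ℂ := ((2 * π * (ξ i * l) : ℝ) : ℂ) * Complex.I with hb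
  refine ⟨∑ m ∈ Finset.range k, Polynomial.C (1 / (m.factorial : ℂ)) *
    (Polynomial.C a + Polynomial.C b * Polynomial.X) ^ m, ?_, ?_⟩
  · refine Polynomial.natDegree_sum_le_of_forall_le _ _ fun m hm => ?_
    refine (Polynomial.natDegree_C_mul_le _ _).trans ?_
    refine (Polynomial.natDegree_pow_le).trans ?_
    have h1 : (Polynomial.C a + Polynomial.C b * Polynomial.X).natDegree ≤ 1 := by
      rw [add_comm]
      exact Polynomial.natDegree_linear_le
    calc m * _ ≤ m * 1 := by gcongr
      _ ≤ k := by rw [mul_one]; exact (Finset.mem_range.mp hm).le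
  · intro s
    simp only [texp, Polynomial.eval_finsetSum, Polynomial.eval_mul, Polynomial.eval_C, Polynomial.eval_pow, Polynomial.eval_add, Polynomial.eval_X]
    refine Finset.sum_congr rfl fun m _ => ?_
    have : (((2 * π * ∑ j, ξ j * (l * Function.update x i s j) : ℝ) : ℂ) * Complex.I) = a + b * s := by
      rw [← Finset.add_sum_erase _ _ (Finset.mem_univ i)]
      have : ∑ j ∈ Finset.univ.erase i, ξ j * (l * Function.update x i s j) =
          ∑ j ∈ Finset.univ.erase i, ξ j * (l * x j) := by
        refine Finset.sum_congr rfl fun j hj => ?_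
        rw [Function.update_of_ne (Finset.ne_of_mem_erase hj)]
      rw [this, Function.update_self, ha, hb]
      push_cast
      ring
    rw [this]; ring

lemma sepPoly_sum {d k : ℕ} {ι : Type*} (Z : Finset ι) (c : ι → ℂ) (g : ι → (Fin d → ℝ) → ℂ)
    (hg : ∀ j ∈ Z, SepPoly d k (g j)) : SepPoly d k (fun t => ∑ j ∈ Z, c j * g j t) := by
  classical
  intro i x
  have : ∀ j, ∃ p : Polynomial ℂ, j ∈ Z → (p.natDegree ≤ k ∧
    ∀ s : ℝ, g j (Function.update x i s) = p.eval (s:ℂ)) := by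
    intro j
    by_cases hj : j ∈ Z
    · obtain ⟨p, hp⟩ := hg j hj i x
      exact ⟨p, fun _ => hp⟩
    · exact ⟨0, fun h => absurd h hj⟩
  choose p hp using this
  refine ⟨∑ j ∈ Z, Polynomial.C (c j) * p j, ?_, ?_⟩
  · refine Polynomial.natDegree_sum_le_of_forall_le _ _ fun m hm => ?_
    exact (Polynomial.natDegree_C_mul_le _ _).trans (hp m hm).1
  · intro s
    simp only [Polynomial.eval_finsetSum, Polynomial.eval_mul, Polynomial.eval_C]
    refine Finset.sum_congr rfl fun j hj => ?_
    rw [(hp j hj).2]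

lemma texp_err (k : ℕ) (X B θ : ℝ) (hB : 1 ≤ B) (hθ : |θ| ≤ X) (hk : Real.exp 1 * B * X ≤ k) :
    ‖Complex.exp ((θ:ℂ) * Complex.I) - texp k ((θ:ℂ) * Complex.I)‖ ≤ 2 * (1 / B)^k := by
  have hX : 0 ≤ X := (abs_nonneg _).trans hθ
  have hn : ‖(θ:ℂ) * Complex.I‖ = |θ| := by simp
  have he : 2 ≤ Real.exp 1 := by
    have := Real.add_one_le_exp (1:ℝ); linarith
  have h2 : 2 * X ≤ k := by
    refine le_trans ?_ hk
    have : 2 ≤ Real.exp 1 * B := by nlinarith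
    nlinarith
  have h1 := Complex.exp_bound' (x := (θ:ℂ) * Complex.I) (n := k) (by
    rw [hn, div_le_iff₀ (by positivity)]
    push_cast
    linarith)
  refine h1.trans ?_
  rw [hn]
  have h3 : |θ|^k / k.factorial ≤ (1/B)^k := by
    have h4 := Real.pow_div_factorial_le_exp (Real.exp 1 * B * X) (by positivity) k
    have h5 : Real.exp (Real.exp 1 * B * X) ≤ (Real.exp 1)^k := by
      rw [← Real.exp_nat_mul, mul_one]
      exact Real.exp_le_exp.mpr hk
    have h6 := h4.trans h5
    have h7 : |θ|^k / k.factorial ≤ X^k / k.factorial := by gcongr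
    refine h7.trans ?_
    rw [mul_pow, mul_pow] at h6
    have hep : 0 < (Real.exp 1)^k := by positivity
    have h8 : B^k * (X^k / k.factorial) ≤ 1 := by
      have : Real.exp 1 ^ k * (B^k * (X^k / k.factorial)) ≤ Real.exp 1 ^ k * 1 := by
        calc _ = Real.exp 1 ^ k * B ^ k * X ^ k / k.factorial := by ring
          _ ≤ _ := by rw [mul_one]; exact h6
      exact le_of_mul_le_mul_left this hep
    rw [div_pow, one_pow, le_div_iff₀ (by positivity)]
    linarith
  linarith

lemma continuous_texp (k : ℕ) : Continuous (texp k) := by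
  unfold texp; fun_prop

set_option maxHeartbeats 1000000 in
lemma ls_core (d : ℕ) (D : ℝ) (hD : 1 ≤ D) (hrem : ∀ (n : ℕ) (p : Polynomial ℂ), p.natDegree ≤ n →
    ∀ S : Set ℝ, MeasurableSet S → volume (Set.Icc (0:ℝ) 1 \ S) < 1/2 →
    ∫⁻ x in Set.Icc (0:ℝ) 1, ‖p.eval (x:ℂ)‖ₑ ^ 2 ≤
      ENNReal.ofReal (D ^ (n+1)) * ∫⁻ x in Set.Icc (0:ℝ) 1 ∩ S, ‖p.eval (x:ℂ)‖ₑ ^ 2)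
    (k : ℕ) (X B : ℝ) (hB : 1 ≤ B) (hk : Real.exp 1 * B * X ≤ k)
    (n : ℕ) (hn : 0 < n) (Z : Finset (Fin d → ℝ))
    (hZ : ∀ ξ ∈ Z, ∀ i, ∃ k : ℤ, n * ξ i = k) (c : (Fin d → ℝ) → ℂ)
    (l : ℝ) (hl : 0 < l) (W : Set (Fin d → ℝ)) (hW : MeasurableSet W)
    (hWv : volume W < ENNReal.ofReal ((l/2)^d))
    (hWbox : ∀ x ∈ W, ∀ t ∈ Set.Icc (0 : Fin d → ℝ) 1, x - l • t ∈ box d n)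
    (hX : ∀ ξ ∈ Z, ∀ t ∈ Set.Icc (0 : Fin d → ℝ) 1, |2 * π * ∑ i, ξ i * (l * t i)| ≤ X) :
    ∃ I : ℝ≥0∞, I + ∫⁻ x in W, ‖∑ ξ ∈ Z, c ξ * ew ξ x‖ₑ ^ 2 =
        ENNReal.ofReal ((n:ℝ)^d * ∑ ξ ∈ Z, ‖c ξ‖^2) ∧
      ENNReal.ofReal ((n:ℝ)^d * ∑ ξ ∈ Z, ‖c ξ‖^2) ≤ 
        2 * (ENNReal.ofReal (D ^ (k+1)) ^ d * (2 * I + 2 * (ENNReal.ofReal ((2 * (1 / B)^k)^2) * ENNReal.ofReal ((n:ℝ)^d * ∑ ξ ∈ Z, ‖c ξ‖^2)))) +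
        2 * (ENNReal.ofReal ((2 * (1 / B)^k)^2) * ENNReal.ofReal ((n:ℝ)^d * ∑ ξ ∈ Z, ‖c ξ‖^2)) := by
  set N0 := ENNReal.ofReal ((n:ℝ)^d * ∑ ξ ∈ Z, ‖c ξ‖^2) with hN0
  set η2 := ENNReal.ofReal ((2 * (1 / B)^k)^2) with hη2
  set K := ENNReal.ofReal (D ^ (k+1)) ^ d with hK
  set f : (Fin d → ℝ) → ℂ := fun x => ∑ ξ ∈ Z, c ξ * ew ξ x with hf
  set F : (Fin d → ℝ) → (Fin d → ℝ) → ℂ := fun z t => f (z + l • t) with hF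
  set g : (Fin d → ℝ) → (Fin d → ℝ) → ℂ := fun ξ t => texp k (((2 * π * ∑ i, ξ i * (l * t i) : ℝ) : ℂ) * Complex.I) with hg
  set P : (Fin d → ℝ) → (Fin d → ℝ) → ℂ := fun z t => ∑ ξ ∈ Z, (c ξ * ew ξ z) * g ξ t with hP
  set Q : Set (Fin d → ℝ) := Set.Icc 0 1 with hQ
  have hQm : MeasurableSet Q := measurableSet_Icc
  have hQv : volume Q = 1 := by rw [hQ, Real.volume_Icc_pi]; simp
  have hfc : Continuous f := continuous_finsetSum _ fun ξ _ => continuous_const.mul (continuous_ew ξ)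
  have hFc : Continuous (fun q : (Fin d → ℝ) × (Fin d → ℝ) => F q.1 q.2) := by
    simp only [hF]
    exact hfc.comp (by fun_prop)
  have hgc : ∀ ξ, Continuous (g ξ) := fun ξ => (continuous_texp k).comp (by fun_prop)
  have hPc : Continuous (fun q : (Fin d → ℝ) × (Fin d → ℝ) => P q.1 q.2) := by
    simp only [hP]
    refine continuous_finsetSum _ fun ξ _ => ?_
    exact (continuous_const.mul ((continuous_ew ξ).comp continuous_fst)).mul ((hgc ξ).comp continuous_snd)
  have hFm : Measurable (fun q : (Fin d → ℝ) × (Fin d → ℝ) => ‖F q.1 q.2‖ₑ ^ 2) := by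
    have := hFc.measurable; fun_prop
  have hPm : Measurable (fun q : (Fin d → ℝ) × (Fin d → ℝ) => ‖P q.1 q.2‖ₑ ^ 2) := by
    have := hPc.measurable; fun_prop
  have hRm : Measurable (fun q : (Fin d → ℝ) × (Fin d → ℝ) => ‖F q.1 q.2 - P q.1 q.2‖ₑ ^ 2) := by
    have := (hFc.sub hPc).measurable; fun_prop
  have hRm' : Measurable (fun q : (Fin d → ℝ) × (Fin d → ℝ) => ‖P q.1 q.2 - F q.1 q.2‖ₑ ^ 2) := by
    have := (hPc.sub hFc).measurable; fun_prop
  have hFew : ∀ z t, F z t = ∑ ξ ∈ Z, (c ξ * ew ξ (l • t)) * ew ξ z := by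
    intro z t
    simp only [hF, hf]
    refine Finset.sum_congr rfl fun ξ _ => ?_
    rw [ew_add]; ring
  have hFt : ∀ t, ∫⁻ z in box d n, ‖F z t‖ₑ ^ 2 = N0 := by
    intro t
    simp_rw [hFew]
    rw [parseval n hn Z hZ (fun ξ => c ξ * ew ξ (l • t))]
    simp only [norm_mul, norm_ew, mul_one]
    rfl
  have hRt : ∀ t ∈ Q, ∫⁻ z in box d n, ‖F z t - P z t‖ₑ ^ 2 ≤ η2 * N0 := by
    intro t ht
    have : ∀ z, F z t - P z t = ∑ ξ ∈ Z, (c ξ * (ew ξ (l • t) - g ξ t)) * ew ξ z := by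
      intro z
      rw [hFew, hP, ← Finset.sum_sub_distrib]
      refine Finset.sum_congr rfl fun ξ _ => ?_
      ring
    simp_rw [this]
    rw [parseval n hn Z hZ (fun ξ => c ξ * (ew ξ (l • t) - g ξ t)), hη2, hN0, ← ENNReal.ofReal_mul (by positivity)]
    apply ENNReal.ofReal_le_ofReal
    rw [← mul_assoc, mul_comm (_ ^ 2) ((n:ℝ)^d), mul_assoc]
    gcongr
    rw [Finset.mul_sum]
    refine Finset.sum_le_sum fun ξ hξ => ?_
    rw [norm_mul, mul_pow, mul_comm]
    gcongr
    have := texp_err k X B (2 * π * ∑ i, ξ i * (l * t i)) hB (hX ξ hξ t ht) hk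
    simpa [ew, g] using this
  -- the slices
  set T : (Fin d → ℝ) → Set (Fin d → ℝ) := fun z => {t | z + l • t ∉ W} with hT
  have hVm : MeasurableSet {q : (Fin d → ℝ) × (Fin d → ℝ) | q.1 + l • q.2 ∈ W} := by
    have : Measurable (fun q : (Fin d → ℝ) × (Fin d → ℝ) => q.1 + l • q.2) := by fun_prop
    exact this hW
  have hTm : ∀ z, MeasurableSet (T z) := by
    intro z
    have : Measurable (fun t : Fin d → ℝ => z + l • t) := by fun_prop
    exact (this hW).compl
  have hTv : ∀ z, volume (Q \ T z) < (1/2)^d := by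
    intro z
    have h1 : Q \ T z ⊆ (fun t : Fin d → ℝ => l • t) ⁻¹' ((fun t => z + t) ⁻¹' W) := by
      rintro t ⟨_, h⟩
      simpa [hT] using h
    refine (measure_mono h1).trans_lt ?_
    rw [Measure.addHaar_preimage_smul _ hl.ne', measure_preimage_add, Module.finrank_fintype_fun_eq_card, Fintype.card_fin]
    have h2 : ((1/2)^d : ℝ≥0∞) = ENNReal.ofReal (|(l^d)⁻¹|) * ENNReal.ofReal ((l/2)^d) := by
      rw [← ENNReal.ofReal_mul (abs_nonneg _), abs_of_pos (by positivity)]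
      have : (l^d)⁻¹ * (l/2)^d = (1/2)^d := by
        rw [← inv_pow, ← mul_pow]; congr 1; field_simp
      rw [this, ENNReal.ofReal_pow (by norm_num), ENNReal.ofReal_div_of_pos (by norm_num)]
      simp
    rw [h2]
    refine (ENNReal.mul_lt_mul_iff_right ?_ ENNReal.ofReal_ne_top).mpr hWv
    simp only [ne_eq, ENNReal.ofReal_eq_zero, not_le]
    positivity
  set I : ℝ≥0∞ := ∫⁻ z in box d n, ∫⁻ t in Q ∩ T z, ‖F z t‖ₑ ^ 2 with hI
  refine ⟨I, ?_, ?_⟩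
  · -- decomposition
    have h1 : ∀ t ∈ Q, ∫⁻ z in box d n, Set.indicator W (fun x => ‖f x‖ₑ ^ 2) (z + l • t) =
        ∫⁻ x in W, ‖f x‖ₑ ^ 2 := by
      intro t ht
      rw [← lintegral_indicator (measurableSet_box d n), ← lintegral_indicator hW,
        ← lintegral_add_right_eq_self (Set.indicator W (fun x => ‖f x‖ₑ ^ 2)) (l • t)]
      refine lintegral_congr fun z => ?_
      by_cases hz : z ∈ box d n
      · rw [Set.indicator_of_mem hz]
      · rw [Set.indicator_of_notMem hz, Set.indicator_of_notMem]
        intro h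
        apply hz
        have := hWbox _ h t ht
        simpa using this
    have hindm : Measurable (Set.indicator W (fun x => ‖f x‖ₑ ^ 2)) := by
      refine Measurable.indicator ?_ hW
      have := hfc.measurable; fun_prop
    have hindm2 : Measurable (fun q : (Fin d → ℝ) × (Fin d → ℝ) => Set.indicator W (fun x => ‖f x‖ₑ ^ 2) (q.1 + l • q.2)) :=
      hindm.comp (by fun_prop)
    have h2 : ∫⁻ x in W, ‖f x‖ₑ ^ 2 = ∫⁻ z in box d n, ∫⁻ t in Q, Set.indicator W (fun x => ‖f x‖ₑ ^ 2) (z + l • t) := by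
      rw [lintegral_lintegral_swap hindm2.aemeasurable, setLIntegral_congr_fun hQm h1]
      simp [hQv]
    have h3 : ∀ z, (∫⁻ t in Q ∩ T z, ‖F z t‖ₑ ^ 2) + ∫⁻ t in Q, Set.indicator W (fun x => ‖f x‖ₑ ^ 2) (z + l • t) = ∫⁻ t in Q, ‖F z t‖ₑ ^ 2 := by
      intro z
      have this : ∀ t, Set.indicator W (fun x => ‖f x‖ₑ ^ 2) (z + l • t) = Set.indicator (T z)ᶜ (fun t => ‖F z t‖ₑ ^ 2) t := by
        intro t
        by_cases h : z + l • t ∈ W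
        · have h' : t ∈ (T z)ᶜ := fun h'' => h'' h
          rw [Set.indicator_of_mem h, Set.indicator_of_mem h']
        · have h' : t ∉ (T z)ᶜ := fun h'' => h'' h
          rw [Set.indicator_of_notMem h, Set.indicator_of_notMem h']
      have hB : ∫⁻ t in Q, Set.indicator W (fun x => ‖f x‖ₑ ^ 2) (z + l • t) = ∫⁻ t in Q \ T z, ‖F z t‖ₑ ^ 2 := by
        rw [lintegral_congr this, lintegral_indicator (hTm z).compl, Measure.restrict_restrict (hTm z).compl,
          Set.inter_comm (T z)ᶜ Q, Set.sdiff_eq]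
      rw [hB]
      exact lintegral_inter_add_sdiff (fun t => ‖F z t‖ₑ ^ 2) Q (hTm z)
    have hsum : I + ∫⁻ z in box d n, ∫⁻ t in Q, Set.indicator W (fun x => ‖f x‖ₑ ^ 2) (z + l • t) = ∫⁻ z in box d n, ∫⁻ t in Q, ‖F z t‖ₑ ^ 2 := by
      rw [hI, ← lintegral_add_right]
      · exact lintegral_congr h3
      · exact hindm2.lintegral_prod_right'
    rw [h2, hsum, lintegral_lintegral_swap hFm.aemeasurable, lintegral_congr hFt]
    simp [hQv]
  · have hswR : ∫⁻ z in box d n, ∫⁻ t in Q, ‖F z t - P z t‖ₑ ^ 2 ≤ η2 * N0 := by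
      have hsw := lintegral_lintegral_swap (μ := volume.restrict (box d n)) (ν := volume.restrict Q) (f := fun z t => ‖F z t - P z t‖ₑ ^ 2) hRm.aemeasurable
      rw [hsw]
      calc _ ≤ ∫⁻ t in Q, η2 * N0 := setLIntegral_mono measurable_const hRt
        _ = _ := by simp [hQv]
    have hswF : ∫⁻ z in box d n, ∫⁻ t in Q, ‖F z t‖ₑ ^ 2 = N0 := by
      rw [lintegral_lintegral_swap hFm.aemeasurable]
      simp_rw [hFt]
      simp [hQv]
    have hPz : ∀ z, Continuous (P z) := fun z => continuous_finsetSum _ fun ξ _ => continuous_const.mul (hgc ξ)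
    have hsep : ∀ z, SepPoly d k (P z) := fun z =>
      sepPoly_sum Z (fun ξ => c ξ * ew ξ z) g (fun ξ _ => sepPoly_texp k ξ l)
    clear_value K η2 N0
    have hKK : ENNReal.ofReal (D ^ (k+1)) ^ d = K := hK.symm
    have hrz : ∀ z, ∫⁻ t in Q, ‖P z t‖ₑ ^ 2 ≤ K * ∫⁻ t in Q ∩ T z, ‖P z t‖ₑ ^ 2 := by
      intro z
      have := remez_pi D hD hrem k d (P z) (hPz z) (hsep z) (T z) (hTm z) (hTv z)
      rw [hKK] at this
      exact this
    have hFz : ∀ z, Continuous (F z) := fun z => hfc.comp (by fun_prop : Continuous fun t : Fin d → ℝ => z + l • t)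
    have hslF : ∀ z, Measurable (fun t => ‖F z t‖ₑ ^ 2) := fun z => (hFz z).measurable.enorm.pow_const 2
    have hslP : ∀ z, Measurable (fun t => ‖P z t‖ₑ ^ 2) := fun z => (hPz z).measurable.enorm.pow_const 2
    have hslR : ∀ z, Measurable (fun t => ‖F z t - P z t‖ₑ ^ 2) := fun z => ((hFz z).measurable.sub (hPz z).measurable).enorm.pow_const 2
    clear_value F P
    have hz : ∀ z, ∫⁻ t in Q, ‖F z t‖ₑ ^ 2 ≤ 2 * (K * (2 * (∫⁻ t in Q ∩ T z, ‖F z t‖ₑ ^ 2) + 2 * ∫⁻ t in Q, ‖F z t - P z t‖ₑ ^ 2)) + 2 * ∫⁻ t in Q, ‖F z t - P z t‖ₑ ^ 2 := by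
      intro z
      calc ∫⁻ t in Q, ‖F z t‖ₑ ^ 2 ≤ ∫⁻ t in Q, (2 * ‖P z t‖ₑ ^ 2 + 2 * ‖F z t - P z t‖ₑ ^ 2) :=
            lintegral_mono fun t => enorm_sq_le _ _
        _ = 2 * (∫⁻ t in Q, ‖P z t‖ₑ ^ 2) + 2 * ∫⁻ t in Q, ‖F z t - P z t‖ₑ ^ 2 := by
            rw [lintegral_add_left ((hslP z).const_mul _), lintegral_const_mul _ (hslP z), lintegral_const_mul _ (hslR z)]
        _ ≤ 2 * (K * ∫⁻ t in Q ∩ T z, ‖P z t‖ₑ ^ 2) + 2 * ∫⁻ t in Q, ‖F z t - P z t‖ₑ ^ 2 := by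
            gcongr; exact hrz z
        _ ≤ _ := by
            gcongr
            calc ∫⁻ t in Q ∩ T z, ‖P z t‖ₑ ^ 2 ≤ ∫⁻ t in Q ∩ T z, (2 * ‖F z t‖ₑ ^ 2 + 2 * ‖F z t - P z t‖ₑ ^ 2) := by
                  refine lintegral_mono fun t => ?_
                  have := enorm_sq_le (P z t) (F z t)
                  rwa [show ‖P z t - F z t‖ₑ = ‖F z t - P z t‖ₑ from enorm_sub_rev _ _] at this
              _ = 2 * (∫⁻ t in Q ∩ T z, ‖F z t‖ₑ ^ 2) + 2 * ∫⁻ t in Q ∩ T z, ‖F z t - P z t‖ₑ ^ 2 := by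
                  rw [lintegral_add_left ((hslF z).const_mul _), lintegral_const_mul _ (hslF z), lintegral_const_mul _ (hslR z)]
              _ ≤ _ := by
                  gcongr
                  exact Set.inter_subset_left
    have hIRm : Measurable (fun z => ∫⁻ t in Q, ‖F z t - P z t‖ₑ ^ 2) := hRm.lintegral_prod_right'
    have hKtop : K ≠ ∞ := by rw [← hKK]; exact ENNReal.pow_ne_top ENNReal.ofReal_ne_top
    calc N0 = ∫⁻ z in box d n, ∫⁻ t in Q, ‖F z t‖ₑ ^ 2 := hswF.symm
      _ ≤ ∫⁻ z in box d n, (2 * (K * (2 * (∫⁻ t in Q ∩ T z, ‖F z t‖ₑ ^ 2) + 2 * ∫⁻ t in Q, ‖F z t - P z t‖ₑ ^ 2)) + 2 * ∫⁻ t in Q, ‖F z t - P z t‖ₑ ^ 2) := lintegral_mono hz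
      _ = 2 * (K * (2 * I + 2 * ∫⁻ z in box d n, ∫⁻ t in Q, ‖F z t - P z t‖ₑ ^ 2)) + 2 * ∫⁻ z in box d n, ∫⁻ t in Q, ‖F z t - P z t‖ₑ ^ 2 := by
          rw [lintegral_add_right _ (hIRm.const_mul _), lintegral_const_mul' _ _ (by simp), lintegral_const_mul' _ _ hKtop,
            lintegral_add_right _ (hIRm.const_mul _), lintegral_const_mul' _ _ (by simp), lintegral_const_mul' _ _ (by simp)]
      _ ≤ _ := by gcongr

end IK

namespace IK

lemma ls_final (d : ℕ) : ∃ c c' : ℝ, 0 < c ∧ c ≤ 1/8 ∧ 0 < c' ∧ ∀ (X : ℝ), 0 ≤ X → 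
    ∀ (n : ℕ), 0 < n → ∀ (Z : Finset (Fin d → ℝ)),
    (∀ ξ ∈ Z, ∀ i, ∃ k : ℤ, n * ξ i = k) → ∀ (u : (Fin d → ℝ) → ℂ)
    (l : ℝ), 0 < l → ∀ (W : Set (Fin d → ℝ)), MeasurableSet W →
    volume W < ENNReal.ofReal ((l/2)^d) →
    (∀ x ∈ W, ∀ t ∈ Set.Icc (0 : Fin d → ℝ) 1, x - l • t ∈ box d n) →
    (∀ ξ ∈ Z, ∀ t ∈ Set.Icc (0 : Fin d → ℝ) 1, |2 * π * ∑ i, ξ i * (l * t i)| ≤ X) →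
    ∫⁻ x in W, ‖∑ ξ ∈ Z, u ξ * ew ξ x‖ₑ ^ 2 ≤
      ENNReal.ofReal ((1 - c * Real.exp (- c' * X)) * ((n:ℝ)^d * ∑ ξ ∈ Z, ‖u ξ‖^2)) := by
  obtain ⟨D, hD, hrem⟩ := remez1
  set D1 := D ^ d with hD1
  have hD1' : 1 ≤ D1 := one_le_pow₀ hD
  have hD1p : 0 < D1 := by linarith
  have hlog : 0 ≤ Real.log D1 := Real.log_nonneg hD1'
  set B := 48 * D1 with hB
  have hBp : 0 < B := by positivity
  have hB1 : 1 ≤ B := by linarith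
  refine ⟨Real.exp (-(3 * Real.log D1)) / 8, Real.exp 1 * B * Real.log D1 + 1, by positivity, ?_, by positivity, ?_⟩
  · have : Real.exp (-(3 * Real.log D1)) ≤ 1 := by
      rw [Real.exp_le_one_iff]; linarith
    linarith
  intro X hX n hn Z hZ u l hl W hW hWv hWbox hXb
  set k := ⌈Real.exp 1 * B * X⌉₊ + 1 with hk
  have hk1 : Real.exp 1 * B * X ≤ k := by
    rw [hk]; push_cast
    have := Nat.le_ceil (Real.exp 1 * B * X); linarith
  have hk2 : (k:ℝ) + 1 ≤ Real.exp 1 * B * X + 3 := by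
    rw [hk]; push_cast
    have := Nat.ceil_lt_add_one (a := Real.exp 1 * B * X) (by positivity); linarith
  obtain ⟨I, hI1, hI2⟩ := ls_core d D hD hrem k X B hB1 hk1 n hn Z hZ u l hl W hW hWv hWbox hXb
  set A := (n:ℝ)^d * ∑ ξ ∈ Z, ‖u ξ‖^2 with hA
  have hA0 : 0 ≤ A := by positivity
  set M := ∫⁻ x in W, ‖∑ ξ ∈ Z, u ξ * ew ξ x‖ₑ ^ 2 with hM
  have hItop : I ≠ ∞ := by
    intro h; rw [h, top_add] at hI1; exact ENNReal.ofReal_ne_top hI1.symm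
  have hMtop : M ≠ ∞ := by
    intro h; rw [h, add_top] at hI1; exact ENNReal.ofReal_ne_top hI1.symm
  lift I to NNReal using hItop
  have hr1 : (I:ℝ) + M.toReal = A := by
    have := congrArg ENNReal.toReal hI1
    rwa [ENNReal.toReal_add ENNReal.coe_ne_top hMtop, ENNReal.toReal_ofReal hA0, ENNReal.coe_toReal] at this
  have hr2 : A ≤ 2 * (D1^(k+1) * (2 * I + 2 * ((2 * (1 / B)^k)^2 * A))) + 2 * ((2 * (1 / B)^k)^2 * A) := by
    have e1 : (I : ℝ≥0∞) = ENNReal.ofReal (I:ℝ) := by simp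
    have e2 : (2:ℝ≥0∞) = ENNReal.ofReal 2 := by simp
    rw [e1, e2, ← ENNReal.ofReal_pow (by positivity), ← ENNReal.ofReal_mul (by positivity), ← ENNReal.ofReal_mul (by positivity), 
      ← ENNReal.ofReal_mul (by positivity), ← ENNReal.ofReal_add (by positivity) (by positivity), 
      ← ENNReal.ofReal_mul (by positivity), ← ENNReal.ofReal_mul (by positivity), ← ENNReal.ofReal_add (by positivity) (by positivity)] at hI2
    rw [ENNReal.ofReal_le_ofReal_iff (by positivity)] at hI2
    rw [← pow_mul, mul_comm (k+1) d, pow_mul] at hI2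
    exact hI2
  have hη : D1^(k+1) * (2 * (1 / B)^k)^2 ≤ 1/12 := by
    have h1 : (1/B)^k ≤ 1 / 48 * (1 / D1)^k := by
      rw [hB, one_div, mul_inv, mul_pow, one_div, one_div]
      gcongr
      calc ((48:ℝ)⁻¹)^k ≤ (48:ℝ)⁻¹^1 := pow_le_pow_of_le_one (by norm_num) (by norm_num) (by omega)
        _ = _ := by norm_num
    have h1' : (1/B)^k ≤ 1 / 48 * (1 / D1) := by
      refine h1.trans ?_
      gcongr
      calc (1/D1)^k ≤ (1/D1)^1 := pow_le_pow_of_le_one (by positivity) (by rw [div_le_one hD1p]; exact hD1') (by omega)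
        _ = _ := by rw [pow_one]
    have h3 : (1 / D1)^k * D1^k = 1 := by rw [← mul_pow]; simp [hD1p.ne']
    calc D1^(k+1) * (2 * (1 / B)^k)^2 = 4 * (D1^(k+1) * ((1/B)^k * (1/B)^k)) := by ring
      _ ≤ 4 * (D1^(k+1) * ((1 / 48 * (1 / D1)^k) * (1 / 48 * (1/D1)))) := by gcongr
      _ = 4 / 48 / 48 * (((1 / D1)^k * D1^k) * (D1 * (1/D1))) := by ring
      _ ≤ 1/12 := by rw [h3]; field_simp; norm_num
  have hDk : 1 ≤ D1^(k+1) := one_le_pow₀ hD1'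
  have hη2 : (2 * (1 / B)^k)^2 ≤ 1/12 := by
    refine le_trans ?_ hη
    nlinarith [sq_nonneg (2 * (1 / B)^k)]
  have hr3 : A ≤ 8 * (D1^(k+1) * I) := by
    have a1 : D1^(k+1) * (2 * (1 / B)^k)^2 * A ≤ 1/12 * A := by gcongr
    have a2 : (2 * (1 / B)^k)^2 * A ≤ 1/12 * A := by gcongr
    nlinarith
  have hr4 : D1^(k+1) ≤ Real.exp ((Real.exp 1 * B * X + 3) * Real.log D1) := by
    calc D1^(k+1) = Real.exp (((k:ℝ)+1) * Real.log D1) := by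
          rw [mul_comm, ← Real.rpow_def_of_pos hD1p, ← Nat.cast_add_one, Real.rpow_natCast]
      _ ≤ _ := by gcongr
  set E := Real.exp (-(3 * Real.log D1)) / 8 * Real.exp (-(Real.exp 1 * B * Real.log D1 + 1) * X) with hE
  have hEI : E * A ≤ I := by
    have : E * D1^(k+1) ≤ 1/8 := by
      calc E * D1^(k+1) ≤ E * Real.exp ((Real.exp 1 * B * X + 3) * Real.log D1) := by gcongr
        _ = 1/8 * Real.exp (-X) := by
          rw [hE, div_mul_eq_mul_div, div_mul_eq_mul_div, ← Real.exp_add, ← Real.exp_add, div_eq_mul_inv, mul_comm]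
          norm_num
          ring
        _ ≤ 1/8 := by
          have : Real.exp (-X) ≤ 1 := by rw [Real.exp_le_one_iff]; linarith
          linarith
    have hEp : 0 < E := by positivity
    calc E * A ≤ E * (8 * (D1^(k+1) * I)) := by gcongr
      _ = 8 * (E * D1^(k+1)) * I := by ring
      _ ≤ 8 * (1/8) * I := by gcongr
      _ = I := by ring
  rw [← ENNReal.ofReal_toReal hMtop]
  apply ENNReal.ofReal_le_ofReal
  linarith

end IK

namespace IK

/-- bounded continuous functions -/
def BC {E : Type*} [TopologicalSpace E] (h : E → ℂ) : Prop := Continuous h ∧ ∃ C : ℝ, ∀ x, ‖h x‖ ≤ C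

lemma BC.mul {E : Type*} [TopologicalSpace E] {h g : E → ℂ} (hh : BC h) (hg : BC g) :
    BC (fun x => h x * g x) := by
  obtain ⟨h1, C, hC⟩ := hh
  obtain ⟨g1, C', hC'⟩ := hg
  refine ⟨h1.mul g1, C * C', fun x => ?_⟩
  rw [norm_mul]
  exact mul_le_mul (hC x) (hC' x) (norm_nonneg _) ((norm_nonneg _).trans (hC x))

lemma BC.const {E : Type*} [TopologicalSpace E] (c : ℂ) : BC (fun _ : E => c) :=
  ⟨continuous_const, ‖c‖, fun _ => le_rfl⟩

lemma BC.conj {E : Type*} [TopologicalSpace E] {h : E → ℂ} (hh : BC h) :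
    BC (fun x => (starRingEnd ℂ) (h x)) := by
  obtain ⟨h1, C, hC⟩ := hh
  refine ⟨Complex.continuous_conj.comp h1, C, fun x => ?_⟩
  rw [RCLike.norm_conj]; exact hC x

lemma BC.sum {E ι : Type*} [TopologicalSpace E] (s : Finset ι) {h : ι → E → ℂ} (hh : ∀ i, BC (h i)) :
    BC (fun x => ∑ i ∈ s, h i x) := by
  choose h1 C hC using hh
  refine ⟨continuous_finsetSum _ fun i _ => h1 i, ∑ i ∈ s, C i, fun x => ?_⟩
  exact (norm_sum_le _ _).trans (Finset.sum_le_sum fun i _ => hC i x)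

lemma BC.integrableOn {E : Type*} [TopologicalSpace E] [MeasurableSpace E] [BorelSpace E] 
    [SecondCountableTopologyEither E ℂ]
    {μ : Measure E} {Ω : Set E} (hΩ : μ Ω < ∞) {h : E → ℂ} (hh : BC h) : IntegrableOn h Ω μ := by
  obtain ⟨h1, C, hC⟩ := hh
  have : IsFiniteMeasure (μ.restrict Ω) := ⟨by simpa using hΩ⟩
  exact Integrable.of_bound h1.aestronglyMeasurable C (Filter.Eventually.of_forall hC)

lemma BC.integrableOn_sq {E : Type*} [TopologicalSpace E] [MeasurableSpace E] [BorelSpace E] 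
    [SecondCountableTopologyEither E ℂ] 
    {μ : Measure E} {Ω : Set E} (hΩ : μ Ω < ∞) {h : E → ℂ} (hh : BC h) : IntegrableOn (fun x => ‖h x‖^2) Ω μ := by
  have := ((hh.conj.mul hh).integrableOn hΩ (μ := μ)).norm
  refine this.congr (Filter.Eventually.of_forall fun x => ?_)
  simp [sq]

lemma trace_inv {ι : Type*} [Fintype ι] (b : OrthonormalBasis ι ℂ (EuclideanSpace ℂ ι)) (v : ι → ℂ) :
    ∑ j, ‖∑ m, (b j) m * v m‖^2 = ∑ m, ‖v m‖^2 := by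
  set w : EuclideanSpace ℂ ι := WithLp.toLp 2 (fun m => (starRingEnd ℂ) (v m)) with hw
  have h := b.sum_sq_norm_inner_right w
  have h2 : ‖w‖^2 = ∑ m, ‖v m‖^2 := by
    rw [EuclideanSpace.norm_sq_eq]
    simp [hw]
  rw [← h2, ← h]
  refine Finset.sum_congr rfl fun j _ => ?_
  rw [norm_inner_symm, PiLp.inner_apply]
  congr 2
  refine Finset.sum_congr rfl fun m _ => ?_
  simp [hw]

lemma fderiv_lincomb {d : ℕ} {ι : Type*} [Fintype ι] (ψ : ι → EuclideanSpace ℝ (Fin d) → ℂ)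
    (hψ : ∀ m, ContDiff ℝ (⊤ : ℕ∞) (ψ m)) (u : ι → ℂ) (x v : EuclideanSpace ℝ (Fin d)) :
    fderiv ℝ (fun x => ∑ m, u m * ψ m x) x v = ∑ m, u m * fderiv ℝ (ψ m) x v := by
  have hdiff : ∀ m, DifferentiableAt ℝ (ψ m) x := fun m => (hψ m).differentiable (by simp) x
  rw [fderiv_fun_sum (fun m _ => (hdiff m).const_mul (u m))]
  rw [sum_apply]
  refine Finset.sum_congr rfl fun m _ => ?_
  rw [fderiv_const_mul (hdiff m)]
  simp

lemma gradSq_const_mul {d : ℕ} (a : ℂ) (f : EuclideanSpace ℝ (Fin d) → ℂ) 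
    (hf : ContDiff ℝ (⊤ : ℕ∞) f) (x : EuclideanSpace ℝ (Fin d)) :
    gradSq d (fun x => a * f x) x = ‖a‖^2 * gradSq d f x := by
  unfold gradSq
  rw [Finset.mul_sum]
  refine Finset.sum_congr rfl fun k _ => ?_
  rw [fderiv_const_mul (hf.differentiable (by simp) x)]
  simp [mul_pow]

lemma linalg {d : ℕ} {ι : Type*} [Fintype ι] [DecidableEq ι] (Ω : Set (EuclideanSpace ℝ (Fin d)))
    (hΩ : volume Ω < ∞) (Λ : ℝ) (hΛ : 0 < Λ) (ψ : ι → EuclideanSpace ℝ (Fin d) → ℂ)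
    (hψ : ∀ m, ContDiff ℝ (⊤ : ℕ∞) (ψ m)) (hb : ∀ m, BC (ψ m))
    (hgb : ∀ m k, BC (fun x => fderiv ℝ (ψ m) x (EuclideanSpace.single k 1)))
    (g : ℝ) (hg : 0 < g) (hq : ∀ u : ι → ℂ, ∫ x in Ω, ‖∑ m, u m * ψ m x‖^2 ≤ g * ∑ m, ‖u m‖^2) :
    ∃ (N : ℕ) (φ : Fin N → EuclideanSpace ℝ (Fin d) → ℂ),
        (∀ j, ContDiffOn ℝ (⊤ : ℕ∞) (φ j) Ω) ∧
        (∀ i j, ∫ x in Ω, (starRingEnd ℂ) (φ i x) * φ j x = if i = j then 1 else 0) ∧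
        (∀ j, IntegrableOn (fun x => gradSq d (φ j) x) Ω volume) ∧
        ∑ m, (Λ * (∫ x in Ω, ‖ψ m x‖^2) - ∫ x in Ω, gradSq d (ψ m) x) ≤ 
          g * ∑ j : Fin N, (Λ - ∫ x in Ω, gradSq d (φ j) x) := by
  set G : Matrix ι ι ℂ := Matrix.of fun m l => ∫ x in Ω, (starRingEnd ℂ) (ψ m x) * ψ l x with hG
  have hGh : G.IsHermitian := by
    ext m l
    simp only [Matrix.conjTranspose_apply, hG, Matrix.of_apply, RCLike.star_def, ← integral_conj]
    congr 1
    ext x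
    simp [mul_comm]
  set b := hGh.eigenvectorBasis with hbdef
  set lam := hGh.eigenvalues with hlam
  set f : ι → EuclideanSpace ℝ (Fin d) → ℂ := fun j x => ∑ m, (b j) m * ψ m x with hf
  have hfs : ∀ j, ContDiff ℝ (⊤ : ℕ∞) (f j) := fun j =>
    ContDiff.sum fun m _ => contDiff_const.mul (hψ m)
  have hfb : ∀ j, BC (f j) := fun j => BC.sum _ fun m => (BC.const _).mul (hb m)
  have hfd : ∀ j x v, fderiv ℝ (f j) x v = ∑ m, (b j) m * fderiv ℝ (ψ m) x v := fun j x v =>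
    fderiv_lincomb ψ hψ _ x v
  have hfgb : ∀ j k, BC (fun x => fderiv ℝ (f j) x (EuclideanSpace.single k 1)) := by
    intro j k
    simp_rw [hfd]
    exact BC.sum _ fun m => (BC.const _).mul (hgb m k)
  have hgi : ∀ (h : EuclideanSpace ℝ (Fin d) → ℂ), (∀ k, BC (fun x => fderiv ℝ h x (EuclideanSpace.single k 1))) →
      IntegrableOn (fun x => gradSq d h x) Ω volume := by
    intro h hh
    unfold gradSq
    exact integrable_finsetSum _ fun k _ => (hh k).integrableOn_sq hΩ
  -- orthogonality
  have horth : ∀ i j, ∫ x in Ω, (starRingEnd ℂ) (f i x) * f j x = if i = j then (lam j : ℂ) else 0 := by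
    intro i j
    have h1 : ∀ x, (starRingEnd ℂ) (f i x) * f j x = 
        ∑ m, ∑ l, ((starRingEnd ℂ) (b i m) * b j l) * ((starRingEnd ℂ) (ψ m x) * ψ l x) := by
      intro x
      simp only [hf, map_sum, Finset.sum_mul_sum, map_mul]
      refine Finset.sum_congr rfl fun m _ => Finset.sum_congr rfl fun l _ => ?_
      ring
    simp_rw [h1]
    have hintg : ∀ m l, Integrable (fun x => ((starRingEnd ℂ) (b i m) * b j l) * ((starRingEnd ℂ) (ψ m x) * ψ l x)) (volume.restrict Ω) :=
      fun m l => ((((hb m).conj.mul (hb l)).integrableOn hΩ).const_mul _)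
    rw [integral_finsetSum _ (fun m _ => integrable_finsetSum _ fun l _ => hintg m l)]
    have h2 : ∀ m, ∫ x in Ω, ∑ l, ((starRingEnd ℂ) (b i m) * b j l) * ((starRingEnd ℂ) (ψ m x) * ψ l x) =
        (starRingEnd ℂ) (b i m) * (lam j * b j m) := by
      intro m
      rw [integral_finsetSum _ (fun l _ => hintg m l)]
      have h3 := congrFun (hGh.mulVec_eigenvectorBasis j) m
      have h4 : ∑ l, G m l * b j l = lam j * b j m := by
        simpa [Matrix.mulVec, dotProduct] using h3
      rw [← h4, Finset.mul_sum]
      refine Finset.sum_congr rfl fun l _ => ?_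
      rw [integral_const_mul, hG, Matrix.of_apply]
      ring
    simp_rw [h2]
    have h5 := b.inner_eq_ite i j
    rw [PiLp.inner_apply] at h5
    have h6 : ∑ m, (starRingEnd ℂ) (b i m) * (lam j * b j m) = lam j * ∑ m, inner ℂ (b i m) (b j m) := by
      rw [Finset.mul_sum]
      refine Finset.sum_congr rfl fun m _ => ?_
      rw [RCLike.inner_apply]; ring
    rw [h6, h5]
    split_ifs <;> simp
  have hlamI : ∀ j, ∫ x in Ω, ‖f j x‖^2 = lam j := by
    intro j
    have h1 := horth j j
    rw [if_pos rfl] at h1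
    have h2 : ∀ x, (starRingEnd ℂ) (f j x) * f j x = ((‖f j x‖^2 : ℝ) : ℂ) := by
      intro x
      rw [mul_comm, Complex.mul_conj, Complex.normSq_eq_norm_sq]
    simp_rw [h2] at h1
    rw [integral_complex_ofReal] at h1
    exact_mod_cast h1
  have hlamg : ∀ j, lam j ≤ g := by
    intro j
    rw [← hlamI j]
    refine (hq (fun m => b j m)).trans ?_
    have h1 : ‖b j‖ = 1 := b.norm_eq_one j
    have h2 : ∑ m, ‖b j m‖^2 = 1 := by
      rw [← EuclideanSpace.norm_sq_eq, h1, one_pow]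
    rw [h2, mul_one]
  set q : ι → ℝ := fun j => Λ * lam j - ∫ x in Ω, gradSq d (f j) x with hqd
  have hgnn : ∀ (h : EuclideanSpace ℝ (Fin d) → ℂ) x, 0 ≤ gradSq d h x := by
    intro h x; unfold gradSq; positivity
  have hlampos : ∀ j, 0 < q j → 0 < lam j := by
    intro j hj
    have h1 : 0 ≤ ∫ x in Ω, gradSq d (f j) x := integral_nonneg fun x => hgnn _ x
    simp only [hqd] at hj
    by_contra h
    push Not at h
    nlinarith
  have hsum : ∑ m, (Λ * (∫ x in Ω, ‖ψ m x‖^2) - ∫ x in Ω, gradSq d (ψ m) x) = ∑ j, q j := by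
    simp only [hqd, ← hlamI]
    rw [Finset.sum_sub_distrib, Finset.sum_sub_distrib, ← Finset.mul_sum, ← Finset.mul_sum,
      ← integral_finsetSum _ (fun m _ => (hb m).integrableOn_sq hΩ),
      ← integral_finsetSum _ (fun m _ => (hfb m).integrableOn_sq hΩ),
      ← integral_finsetSum _ (fun m _ => hgi _ (hgb m)),
      ← integral_finsetSum _ (fun m _ => hgi _ (hfgb m))]
    congr 2
    · congr 1
      ext x
      exact (trace_inv b _).symm
    · ext x
      simp only [gradSq, hfd]
      rw [Finset.sum_comm, Finset.sum_comm (s := Finset.univ (α := ι))]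
      refine Finset.sum_congr rfl fun k _ => ?_
      exact (trace_inv b _).symm
  classical
  let e := (Fintype.equivFin {j // 0 < q j}).symm
  refine ⟨_, fun j x => ((1 / Real.sqrt (lam (e j)) : ℝ) : ℂ) * f (e j) x, ?_, ?_, ?_, ?_⟩
  · intro j
    exact (contDiff_const.mul (hfs _)).contDiffOn
  · intro i j
    have h1 : ∀ x, (starRingEnd ℂ) (((1 / Real.sqrt (lam (e i)) : ℝ) : ℂ) * f (e i) x) * (((1 / Real.sqrt (lam (e j)) : ℝ) : ℂ) * f (e j) x) = 
      (((1 / Real.sqrt (lam (e i)) : ℝ) : ℂ) * ((1 / Real.sqrt (lam (e j)) : ℝ) : ℂ)) * ((starRingEnd ℂ) (f (e i) x) * f (e j) x) := by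
      intro x
      rw [map_mul, Complex.conj_ofReal]; ring
    simp_rw [h1]
    rw [integral_const_mul, horth]
    by_cases hij : i = j
    · subst hij
      rw [if_pos rfl, if_pos rfl]
      have hp := hlampos _ (e i).2
      have : (1 / Real.sqrt (lam (e i))) * (1 / Real.sqrt (lam (e i))) * lam (e i) = 1 := by
        rw [div_mul_div_comm, Real.mul_self_sqrt hp.le]; field_simp
      exact_mod_cast this
    · rw [if_neg hij, if_neg, mul_zero]
      intro h
      exact hij (e.injective (Subtype.ext h))
  · intro j
    simp_rw [gradSq_const_mul _ _ (hfs _)]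
    exact (hgi _ (hfgb _)).const_mul _
  · rw [hsum]
    simp_rw [gradSq_const_mul _ _ (hfs _)]
    simp_rw [integral_const_mul]
    rw [Equiv.sum_comp e (fun j : {j // 0 < q j} => Λ - ‖((1 / Real.sqrt (lam j) : ℝ) : ℂ)‖^2 * ∫ x in Ω, gradSq d (f j) x), Finset.mul_sum]
    calc ∑ j, q j ≤ ∑ j ∈ Finset.univ.filter (fun j => 0 < q j), q j := by
          rw [Finset.sum_filter]
          refine Finset.sum_le_sum fun j _ => ?_
          split_ifs with h
          · exact le_rfl
          · exact not_lt.mp h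
      _ = ∑ j : {j // 0 < q j}, q j := by
          rw [← Finset.sum_subtype_eq_sum_filter]
          simp
      _ ≤ _ := by
          refine Finset.sum_le_sum fun j _ => ?_
          have hp := hlampos _ j.2
          have hn : ‖((1 / Real.sqrt (lam j) : ℝ) : ℂ)‖^2 = 1 / lam j := by
            rw [Complex.norm_real, Real.norm_eq_abs, sq_abs, div_pow, Real.sq_sqrt hp.le, one_pow]
          rw [hn]
          have hqj : Λ - 1 / lam j * ∫ x in Ω, gradSq d (f j) x = q j / lam j := by
            simp only [hqd]; field_simp
          rw [hqj, mul_div_assoc', le_div_iff₀ hp, mul_comm g]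
          exact mul_le_mul_of_nonneg_left (hlamg j) j.2.le

end IK

namespace IK

/-- the Euclidean ball in `Fin d → ℝ` -/
def eball (d : ℕ) (R : ℝ) : Set (Fin d → ℝ) := {x | ‖(WithLp.toLp 2 x : EuclideanSpace ℝ (Fin d))‖ < R}

lemma norm_toLp_sq {d : ℕ} (x : Fin d → ℝ) : ‖(WithLp.toLp 2 x : EuclideanSpace ℝ (Fin d))‖^2 = ∑ i, x i ^ 2 := by
  rw [EuclideanSpace.norm_sq_eq]; simp

lemma isOpen_eball (d : ℕ) (R : ℝ) : IsOpen (eball d R) := by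
  have : Continuous (fun x : Fin d → ℝ => (WithLp.toLp 2 x : EuclideanSpace ℝ (Fin d))) := PiLp.continuous_toLp 2 _
  exact isOpen_lt this.norm continuous_const

lemma convex_eball (d : ℕ) (R : ℝ) : Convex ℝ (eball d R) := by
  have h := (convex_ball (0 : EuclideanSpace ℝ (Fin d)) R).linear_preimage
    ((WithLp.linearEquiv 2 ℝ (Fin d → ℝ)).symm.toLinearMap)
  convert! h using 1
  ext x
  simp [eball]

lemma isBounded_eball (d : ℕ) (R : ℝ) : Bornology.IsBounded (eball d R) := by
  rw [isBounded_iff_forall_norm_le]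
  refine ⟨max R 0, fun x hx => ?_⟩
  rw [pi_norm_le_iff_of_nonneg (le_max_right _ _)]
  intro i
  refine le_trans ?_ (le_max_left _ _)
  exact (PiLp.norm_apply_le (WithLp.toLp 2 x : EuclideanSpace ℝ (Fin d)) i).trans (le_of_lt hx)

lemma freq (d : ℕ) (R : ℝ) : ∃ Z : ℕ → Finset (Fin d → ℝ), 
    (∀ n, 0 < n → ∀ ξ ∈ Z n, ξ ∈ eball d R ∧ ∀ i, ∃ k : ℤ, n * ξ i = k) ∧ 
    ∀ F : (Fin d → ℝ) → ℝ, Continuous F → Filter.Tendsto (fun n : ℕ => (∑ ξ ∈ Z n, F ξ) / (n:ℝ)^d) Filter.atTop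
      (nhds (∫ x in eball d R, F x)) := by
  classical
  open scoped Pointwise in
  let A : ℕ → Set (Fin d → ℝ) := fun n => eball d R ∩ (n:ℝ)⁻¹ • (Submodule.span ℤ (Set.range (Pi.basisFun ℝ (Fin d))) : Set (Fin d → ℝ))
  have hfin : ∀ n, 0 < n → (A n).Finite := by
    intro n hn
    have hn' : (n:ℝ) ≠ 0 := by exact_mod_cast hn.ne'
    simp only [A]
    rw [← Submodule.coe_pointwise_smul, ZSpan.smul _ (inv_ne_zero hn')]
    exact ZSpan.setFinite_inter _ (isBounded_eball d R)
  refine ⟨fun n => if h : (A n).Finite then h.toFinset else ∅, ?_, ?_⟩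
  · intro n hn ξ hξ
    beta_reduce at hξ
    rw [dif_pos (hfin n hn), Set.Finite.mem_toFinset] at hξ
    refine ⟨hξ.1, ?_⟩
    have : NeZero n := ⟨hn.ne'⟩
    have h2 := (BoxIntegral.unitPartition.mem_smul_span_iff (n := n)).mp hξ.2
    intro i
    obtain ⟨k, hk⟩ := h2 i
    exact ⟨k, by simpa using hk.symm⟩
  · intro F hF
    have h := tendsto_tsum_div_pow_atTop_integral (eball d R) F hF (isBounded_eball d R)
      (isOpen_eball d R).measurableSet ((convex_eball d R).addHaar_frontier volume)
    rw [Fintype.card_fin] at h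
    refine h.congr' ?_
    filter_upwards [Filter.eventually_gt_atTop 0] with n hn
    rw [dif_pos (hfin n hn)]
    congr 1
    have := (hfin n hn).fintype
    change ∑' x : ↑(A n), F x = _
    rw [tsum_fintype, Finset.sum_set_coe (A n), Set.Finite.toFinset_eq_toFinset]

lemma integral_eball (d : ℕ) (hd : 1 ≤ d) (Λ : ℝ) (hΛ : 0 < Λ) :
    ∫ x in eball d (Real.sqrt Λ / (2 * π)), (Λ - 4 * π^2 * ∑ i, x i ^ 2) = semiclassicalConst d * Λ ^ (1 + (d:ℝ)/2) := by
  set R := Real.sqrt Λ / (2 * π) with hR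
  have hRp : 0 < R := by positivity
  have : Nonempty (Fin d) := ⟨⟨0, hd⟩⟩
  have : Nontrivial (EuclideanSpace ℝ (Fin d)) := by
    apply Module.nontrivial_of_finrank_pos (R := ℝ)
    rw [finrank_euclideanSpace_fin]; exact hd
  set h : ℝ → ℝ := fun r => Set.indicator (Set.Iio R) (fun r => Λ - 4 * π^2 * r^2) r with hh
  have e1 : ∫ x in eball d R, (Λ - 4 * π^2 * ∑ i, x i ^ 2) = ∫ x : EuclideanSpace ℝ (Fin d), h ‖x‖ := by
    rw [← integral_indicator (isOpen_eball d R).measurableSet]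
    rw [← (PiLp.volume_preserving_toLp (Fin d)).integral_comp (MeasurableEquiv.toLp 2 (Fin d → ℝ)).measurableEmbedding]
    refine integral_congr_ae (Filter.Eventually.of_forall fun x => ?_)
    simp only [hh]
    by_cases hx : x ∈ eball d R
    · have hx' : ‖(WithLp.toLp 2 x : EuclideanSpace ℝ (Fin d))‖ ∈ Set.Iio R := hx
      rw [Set.indicator_of_mem hx, Set.indicator_of_mem hx', norm_toLp_sq]
    · have hx' : ‖(WithLp.toLp 2 x : EuclideanSpace ℝ (Fin d))‖ ∉ Set.Iio R := hx
      rw [Set.indicator_of_notMem hx, Set.indicator_of_notMem hx']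
  rw [e1, integral_fun_norm_addHaar, finrank_euclideanSpace_fin]
  have e2 : ∫ y in Set.Ioi (0:ℝ), y^(d-1) • h y = ∫ y in (0:ℝ)..R, (Λ * y^(d-1) - 4 * π^2 * y^(d+1)) := by
    rw [intervalIntegral.integral_of_le hRp.le, integral_Ioc_eq_integral_Ioo, ← integral_indicator measurableSet_Ioi,
      ← integral_indicator measurableSet_Ioo]
    congr 1
    ext y
    simp only [hh, Set.indicator, Set.mem_Ioi, Set.mem_Iio, Set.mem_Ioo, smul_eq_mul]
    by_cases h1 : 0 < y
    · by_cases h2 : y < R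
      · simp only [h1, h2, if_true, and_self]
        obtain ⟨m, rfl⟩ : ∃ m, d = m + 1 := ⟨d - 1, by omega⟩
        simp only [Nat.add_sub_cancel]; ring
      · simp [h1, h2]
    · simp [h1]
  have e3 : ∫ y in (0:ℝ)..R, (Λ * y^(d-1) - 4 * π^2 * y^(d+1)) = Λ * (R^d / d) - 4 * π^2 * (R^(d+2)/(d+2)) := by
    rw [intervalIntegral.integral_sub (by apply Continuous.intervalIntegrable; fun_prop) (by apply Continuous.intervalIntegrable; fun_prop),
      intervalIntegral.integral_const_mul, intervalIntegral.integral_const_mul, integral_pow, integral_pow]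
    obtain ⟨m, rfl⟩ : ∃ m, d = m + 1 := ⟨d - 1, by omega⟩
    simp only [Nat.add_sub_cancel]
    push_cast
    norm_num
    ring
  have hR2 : 4 * π^2 * R^2 = Λ := by
    rw [hR, div_pow, Real.sq_sqrt hΛ.le]; field_simp; norm_num
  have hdp : (0:ℝ) < d := by exact_mod_cast hd
  have e4 : Λ * (R^d / d) - 4 * π^2 * (R^(d+2)/(d+2)) = Λ * R^d * (2 / (d * (d+2))) := by
    have : 4 * π^2 * (R^(d+2)/(d+2)) = Λ * (R^d/(d+2)) := by
      rw [← hR2]; ring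
    rw [this]; field_simp; ring
  have e5 : volume.real (Metric.ball (0 : EuclideanSpace ℝ (Fin d)) 1) = Real.sqrt π ^ d / Real.Gamma (d/2+1) := by
    rw [Measure.real, EuclideanSpace.volume_ball, Fintype.card_fin]
    simp only [ENNReal.ofReal_one, one_pow, one_mul]
    rw [ENNReal.toReal_ofReal]
    have : 0 < Real.Gamma ((d:ℝ)/2+1) := Real.Gamma_pos_of_pos (by positivity)
    positivity
  rw [e2, e3, e4, e5]
  have hG : Real.Gamma (2 + (d:ℝ)/2) = ((d:ℝ)/2 + 1) * Real.Gamma ((d:ℝ)/2+1) := by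
    rw [← Real.Gamma_add_one (by positivity)]; congr 1; ring
  have hGp : 0 < Real.Gamma ((d:ℝ)/2+1) := Real.Gamma_pos_of_pos (by positivity)
  unfold semiclassicalConst
  rw [hG, Real.Gamma_two]
  have hL : Λ ^ (1 + (d:ℝ)/2) = Λ * Real.sqrt Λ ^ d := by
    rw [Real.rpow_add hΛ, Real.rpow_one, Real.sqrt_eq_rpow, ← Real.rpow_natCast, ← Real.rpow_mul hΛ.le]
    congr 2; ring
  have h4 : (4 * π) ^ ((d:ℝ)/2) = 2^d * Real.sqrt π ^ d := by
    have : 2^d * Real.sqrt π ^ d = (Real.sqrt (4 * π)) ^ d := by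
      rw [← mul_pow, Real.sqrt_mul (by norm_num), show (4:ℝ) = 2^2 by norm_num, Real.sqrt_sq (by norm_num)]
    rw [this, Real.sqrt_eq_rpow, ← Real.rpow_natCast, ← Real.rpow_mul (by positivity)]
    congr 1; ring
  rw [hL, h4, hR, div_pow, mul_pow]
  have hpi : π ^ d = Real.sqrt π ^ d * Real.sqrt π ^ d := by
    rw [← mul_pow, Real.mul_self_sqrt Real.pi_pos.le]
  rw [hpi]
  have hsp : 0 < Real.sqrt π := Real.sqrt_pos.mpr Real.pi_pos
  simp only [nsmul_eq_mul, smul_eq_mul]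
  field_simp

end IK

namespace IK

/-- plane wave on Euclidean space -/
noncomputable def pw {d : ℕ} (ξ : Fin d → ℝ) (x : EuclideanSpace ℝ (Fin d)) : ℂ := ew ξ x.ofLp

lemma pw_hasFDerivAt {d : ℕ} (ξ : Fin d → ℝ) (x : EuclideanSpace ℝ (Fin d)) :
    ∃ L : EuclideanSpace ℝ (Fin d) →L[ℝ] ℂ, HasFDerivAt (pw ξ) L x ∧
      ∀ k, L (EuclideanSpace.single k 1) = pw ξ x * (((2 * π * ξ k : ℝ) : ℂ) * Complex.I) := by
  set L0 : EuclideanSpace ℝ (Fin d) →L[ℝ] ℝ := ∑ i, (2 * π * ξ i) • EuclideanSpace.proj i with hL0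
  have hL0a : ∀ y, L0 y = 2 * π * ∑ i, ξ i * y i := by
    intro y
    rw [hL0, sum_apply, Finset.mul_sum]
    refine Finset.sum_congr rfl fun i _ => ?_
    simp; ring
  have hpw : pw ξ = fun y => Complex.exp ((Complex.ofRealCLM.comp L0) y * Complex.I) := by
    ext y
    simp only [pw, ew, ContinuousLinearMap.comp_apply, Complex.ofRealCLM_apply, hL0a]
  have h1 := (((Complex.ofRealCLM.comp L0).hasFDerivAt (x := x)).mul_const Complex.I).cexp
  rw [← hpw] at h1
  refine ⟨_, h1, fun k => ?_⟩
  have h2 : L0 (EuclideanSpace.single k 1) = 2 * π * ξ k := by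
    rw [hL0a]
    simp
  have h3 : Complex.exp ((Complex.ofRealCLM.comp L0) x * Complex.I) = pw ξ x := by rw [hpw]
  rw [h3]
  simp only [smul_apply, ContinuousLinearMap.comp_apply, Complex.ofRealCLM_apply, h2, smul_eq_mul]
  ring

lemma pw_fderiv {d : ℕ} (ξ : Fin d → ℝ) (x : EuclideanSpace ℝ (Fin d)) (k : Fin d) :
    fderiv ℝ (pw ξ) x (EuclideanSpace.single k 1) = pw ξ x * (((2 * π * ξ k : ℝ) : ℂ) * Complex.I) := by
  obtain ⟨L, h1, h2⟩ := pw_hasFDerivAt ξ x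
  rw [h1.fderiv, h2]

lemma norm_pw {d : ℕ} (ξ : Fin d → ℝ) (x : EuclideanSpace ℝ (Fin d)) : ‖pw ξ x‖ = 1 := norm_ew _ _

lemma pw_gradSq {d : ℕ} (ξ : Fin d → ℝ) (x : EuclideanSpace ℝ (Fin d)) :
    gradSq d (pw ξ) x = 4 * π^2 * ∑ k, ξ k ^ 2 := by
  unfold gradSq
  rw [Finset.mul_sum]
  refine Finset.sum_congr rfl fun k _ => ?_
  rw [pw_fderiv, norm_mul, norm_pw, norm_mul, Complex.norm_real, Complex.norm_I, one_mul, mul_one, Real.norm_eq_abs, sq_abs]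
  ring

lemma pw_contDiff {d : ℕ} (ξ : Fin d → ℝ) : ContDiff ℝ (⊤ : ℕ∞) (pw ξ) := by
  unfold pw ew
  apply ContDiff.cexp
  apply ContDiff.mul _ contDiff_const
  apply Complex.ofRealCLM.contDiff.comp
  apply contDiff_const.mul
  apply ContDiff.sum
  intro i _
  apply contDiff_const.mul
  exact (EuclideanSpace.proj i : EuclideanSpace ℝ (Fin d) →L[ℝ] ℝ).contDiff

lemma pw_BC {d : ℕ} (ξ : Fin d → ℝ) : BC (pw ξ) := ⟨(pw_contDiff ξ).continuous, 1, fun x => (norm_pw ξ x).le⟩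

lemma pw_BC' {d : ℕ} (ξ : Fin d → ℝ) (k : Fin d) : BC (fun x => fderiv ℝ (pw ξ) x (EuclideanSpace.single k 1)) := by
  simp_rw [pw_fderiv]
  exact (pw_BC ξ).mul (BC.const _)

/-- inner box -/
def ibox (d n : ℕ) (l : ℝ) : Set (Fin d → ℝ) := Set.univ.pi fun _ => Set.Ioc (-(n:ℝ)/2 + l) ((n:ℝ)/2)

lemma measurableSet_ibox (d n : ℕ) (l : ℝ) : MeasurableSet (ibox d n l) :=
  MeasurableSet.univ_pi fun _ => measurableSet_Ioc

lemma ibox_sub {d n : ℕ} {l : ℝ} (hl : 0 < l) : ∀ x ∈ ibox d n l, ∀ t ∈ Set.Icc (0 : Fin d → ℝ) 1, x - l • t ∈ box d n := by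
  intro x hx t ht i hi
  have h1 := hx i hi
  have h2 := ht.1 i
  have h3 := ht.2 i
  simp only [Pi.zero_apply, Pi.one_apply] at h2 h3
  simp only [Set.mem_Ioc, Pi.sub_apply, Pi.smul_apply, smul_eq_mul] at h1 ⊢
  constructor <;> nlinarith

lemma tendsto_outside {d : ℕ} (O : Set (Fin d → ℝ)) (hO : MeasurableSet O) (hv : volume O < ∞) (l : ℝ) :
    Filter.Tendsto (fun n : ℕ => (volume (O \ ibox d n l)).toReal) Filter.atTop (nhds 0) := by
  have hanti : Antitone (fun n : ℕ => O \ ibox d n l) := by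
    intro m n hmn
    have hmn' : (m:ℝ) ≤ n := by exact_mod_cast hmn
    refine Set.sdiff_subset_sdiff_right ?_
    refine Set.pi_mono fun i _ => Set.Ioc_subset_Ioc (by linarith) (by linarith)
  have h := tendsto_measure_iInter_atTop (μ := volume) (s := fun n : ℕ => O \ ibox d n l)
    (fun n => (hO.diff (measurableSet_ibox d n l)).nullMeasurableSet) hanti
    ⟨0, ((measure_mono Set.sdiff_subset).trans_lt hv).ne⟩
  have hempty : ⋂ n : ℕ, O \ ibox d n l = ∅ := by
    rw [Set.eq_empty_iff_forall_notMem]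
    intro x hx
    rw [Set.mem_iInter] at hx
    obtain ⟨n, hn⟩ := exists_nat_gt (2 * (‖x‖ + |l|))
    refine (hx n).2 fun i _ => ?_
    have h1 := norm_le_pi_norm x i
    rw [Real.norm_eq_abs] at h1
    have h2 := abs_le.mp h1
    have h3 := le_abs_self l
    have h4 := abs_nonneg l
    constructor <;> linarith
  rw [hempty, measure_empty] at h
  have := (ENNReal.tendsto_toReal ENNReal.zero_ne_top).comp h
  rw [ENNReal.toReal_zero] at this
  exact this

lemma main_bound {d : ℕ} (Ω : Set (EuclideanSpace ℝ (Fin d))) (hΩ : IsOpen Ω) (hv : volume Ω < ∞)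
    (O : Set (Fin d → ℝ)) (hO : O = (WithLp.toLp 2) ⁻¹' Ω) (W : Set (Fin d → ℝ)) (hW : MeasurableSet W) (A : ℝ) (n : ℕ)
    (Z : Finset (Fin d → ℝ))
    (hA : 0 ≤ A) (hls : ∀ (u : (Fin d → ℝ) → ℂ), ∫⁻ x in O ∩ W, ‖∑ ξ ∈ Z, u ξ * ew ξ x‖ₑ ^ 2 ≤
      ENNReal.ofReal (A * ((n:ℝ)^d * ∑ ξ ∈ Z, ‖u ξ‖^2))) (u : Z → ℂ) :
    ∫ x in Ω, ‖∑ m : Z, u m * pw (m : Fin d → ℝ) x‖^2 ≤ 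
      (A * (n:ℝ)^d + Z.card * (volume (O \ W)).toReal) * ∑ m, ‖u m‖^2 := by
  classical
  set u' : (Fin d → ℝ) → ℂ := fun ξ => if h : ξ ∈ Z then u ⟨ξ, h⟩ else 0 with hu'
  have hu : ∀ m : Z, u m = u' m := by
    intro m; simp [hu']
  have hs1 : ∑ m, ‖u m‖^2 = ∑ ξ ∈ Z, ‖u' ξ‖^2 := by
    simp_rw [hu]
    exact Finset.sum_coe_sort Z (fun ξ => ‖u' ξ‖^2)
  have hs2 : ∀ x, ∑ m : Z, u m * pw (m : Fin d → ℝ) x = ∑ ξ ∈ Z, u' ξ * ew ξ x.ofLp := by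
    intro x
    simp_rw [hu]
    exact Finset.sum_coe_sort Z (fun ξ => u' ξ * pw ξ x)
  rw [hs1]
  simp_rw [hs2]
  have hOm : MeasurableSet O := by
    rw [hO]; exact (PiLp.volume_preserving_toLp (Fin d)).measurable hΩ.measurableSet
  have hOv : volume O < ∞ := by
    rw [hO, (PiLp.volume_preserving_toLp (Fin d)).measure_preimage hΩ.measurableSet.nullMeasurableSet]; exact hv
  have e1 : ∫ x in Ω, ‖∑ ξ ∈ Z, u' ξ * ew ξ x.ofLp‖^2 = ∫ y in O, ‖∑ ξ ∈ Z, u' ξ * ew ξ y‖^2 := by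
    rw [hO, ← (PiLp.volume_preserving_toLp (Fin d)).setIntegral_preimage_emb (MeasurableEquiv.toLp 2 (Fin d → ℝ)).measurableEmbedding]
  rw [e1]
  set f : (Fin d → ℝ) → ℂ := fun y => ∑ ξ ∈ Z, u' ξ * ew ξ y with hf
  have hfBC : BC f := BC.sum _ fun ξ => (BC.const _).mul ⟨continuous_ew ξ, 1, fun x => (norm_ew ξ x).le⟩
  have hfi := hfBC.integrableOn_sq (μ := volume) hOv
  rw [← integral_inter_add_sdiff hW hfi, add_mul]
  have hb1 : ∫ y in O ∩ W, ‖f y‖^2 ≤ A * (n:ℝ)^d * ∑ ξ ∈ Z, ‖u' ξ‖^2 := by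
    rw [integral_eq_lintegral_of_nonneg_ae (Filter.Eventually.of_forall fun y => by positivity) 
      (by have := hfBC.1; exact (by fun_prop : Continuous fun y => ‖f y‖^2).aestronglyMeasurable)]
    refine ENNReal.toReal_le_of_le_ofReal (by positivity) ?_
    rw [mul_assoc]
    refine le_trans (le_of_eq ?_) (hls u')
    refine lintegral_congr fun y => ?_
    rw [ENNReal.ofReal_pow (norm_nonneg _), ofReal_norm]
  have hb2 : ∀ y, ‖f y‖^2 ≤ Z.card * ∑ ξ ∈ Z, ‖u' ξ‖^2 := by
    intro y
    have h1 : ‖f y‖ ≤ ∑ ξ ∈ Z, ‖u' ξ‖ := by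
      refine (norm_sum_le _ _).trans (le_of_eq ?_)
      refine Finset.sum_congr rfl fun ξ _ => ?_
      rw [norm_mul, norm_ew, mul_one]
    calc ‖f y‖^2 ≤ (∑ ξ ∈ Z, ‖u' ξ‖)^2 := by gcongr
      _ ≤ _ := sq_sum_le_card_mul_sum_sq
  have hb3 : ∫ y in O \ W, ‖f y‖^2 ≤ Z.card * (volume (O \ W)).toReal * ∑ ξ ∈ Z, ‖u' ξ‖^2 := by
    have hfin : volume (O \ W) < ∞ := (measure_mono Set.sdiff_subset).trans_lt hOv
    calc ∫ y in O \ W, ‖f y‖^2 ≤ ∫ y in O \ W, (Z.card * ∑ ξ ∈ Z, ‖u' ξ‖^2 : ℝ) := by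
          refine setIntegral_mono (hfBC.integrableOn_sq hfin) ?_ hb2
          exact integrableOn_const hfin.ne
      _ = _ := by
          rw [setIntegral_const, smul_eq_mul, Measure.real]; ring
  linarith

lemma freq_bound {d : ℕ} {R l : ℝ} (hl : 0 < l) (hR : 0 < R) {ξ : Fin d → ℝ} (hξ : ξ ∈ eball d R) :
    ∀ t ∈ Set.Icc (0 : Fin d → ℝ) 1, |2 * π * ∑ i, ξ i * (l * t i)| ≤ 2 * π * (d * (R * l)) := by
  intro t ht
  rw [abs_mul, abs_of_pos (by positivity : 0 < 2 * π)]
  gcongr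
  refine (Finset.abs_sum_le_sum_abs _ _).trans ?_
  calc ∑ i, |ξ i * (l * t i)| ≤ ∑ i : Fin d, R * l := by
        refine Finset.sum_le_sum fun i _ => ?_
        have h1 : |ξ i| ≤ R :=
          (PiLp.norm_apply_le (WithLp.toLp 2 ξ : EuclideanSpace ℝ (Fin d)) i).trans (le_of_lt hξ)
        have h2 := ht.1 i
        have h3 := ht.2 i
        simp only [Pi.zero_apply, Pi.one_apply] at h2 h3
        rw [abs_mul, abs_of_nonneg (by positivity : 0 ≤ l * t i)]
        gcongr
        nlinarith
    _ = _ := by simp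

end IK

/-- **Improved Kröger inequality with measure-dependent remainder (γ = 1, variational
form).** For every `d ≥ 1` there are `c, c' > 0` such that for every open `Ω ⊆ ℝ^d` of
finite measure, every `Λ > 0` and every `ε > 0`, there exist `N ∈ ℕ` and smooth functions
`φ_1, …, φ_N` on `Ω`, orthonormal in `L²(Ω)` and with `|∇φ_j| ∈ L²(Ω)`, such that
`Σ_j (Λ − ∫_Ω |∇φ_j|²) > L^sc_{1,d} |Ω| Λ^{1+d/2} (1 + c e^{−c' √Λ |Ω|^{1/d}}) − ε`. -/
theorem improved_kroger_measure
    (d : ℕ) (hd : 1 ≤ d) :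
    ∃ c c' : ℝ, 0 < c ∧ 0 < c' ∧
      ∀ (Ω : Set (EuclideanSpace ℝ (Fin d))), IsOpen Ω → volume Ω < ∞ →
      ∀ Λ : ℝ, 0 < Λ → ∀ ε : ℝ, 0 < ε →
      ∃ (N : ℕ) (φ : Fin N → EuclideanSpace ℝ (Fin d) → ℂ),
        (∀ j, ContDiffOn ℝ (⊤ : ℕ∞) (φ j) Ω) ∧
        (∀ i j, ∫ x in Ω, (starRingEnd ℂ) (φ i x) * φ j x = if i = j then 1 else 0) ∧
        (∀ j, IntegrableOn (fun x => gradSq d (φ j) x) Ω volume) ∧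
        semiclassicalConst d * (volume Ω).toReal * Λ ^ (1 + (d : ℝ) / 2) *
            (1 + c * Real.exp (-c' * Real.sqrt Λ * (volume Ω).toReal ^ (1 / (d : ℝ)))) - ε
          < ∑ j : Fin N, (Λ - ∫ x in Ω, gradSq d (φ j) x) := by
  classical
  obtain ⟨c, c', hc, hc8, hc', hls⟩ := IK.ls_final d
  have hdp : (0:ℝ) < d := by exact_mod_cast hd
  refine ⟨c, c' * (4 * d), hc, by positivity, ?_⟩
  intro Ω hΩ hv Λ hΛ ε hε
  set V := (volume Ω).toReal with hV
  have hV0 : 0 ≤ V := ENNReal.toReal_nonneg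
  rcases hV0.eq_or_lt with hV00 | hVp
  · refine ⟨0, fun j => j.elim0, fun j => j.elim0, fun j => j.elim0, fun j => j.elim0, ?_⟩
    rw [← hV00]
    simp [hε]
  set R := Real.sqrt Λ / (2 * π) with hR
  have hRp : 0 < R := by positivity
  obtain ⟨Z, hZ, hlim⟩ := IK.freq d R
  set l := 4 * V ^ (1 / (d:ℝ)) with hl
  have hlp : 0 < l := by positivity
  set X := 2 * π * (d * (R * l)) with hX
  have hXp : 0 ≤ X := by positivity
  have hXe : -c' * X = -(c' * (4 * d)) * Real.sqrt Λ * V ^ (1 / (d:ℝ)) := by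
    rw [hX, hR, hl]; field_simp
  set δ := c * Real.exp (-(c' * (4 * d)) * Real.sqrt Λ * V ^ (1 / (d:ℝ))) with hδ
  have hδX : c * Real.exp (-c' * X) = δ := by rw [hXe]
  have hδ0 : 0 < δ := by positivity
  have hδ1 : δ ≤ 1/8 := by
    rw [← hδX]
    have : Real.exp (-c' * X) ≤ 1 := by
      rw [Real.exp_le_one_iff]; nlinarith
    nlinarith [Real.exp_pos (-c' * X)]
  set O : Set (Fin d → ℝ) := (WithLp.toLp 2) ⁻¹' Ω with hO
  have hOm : MeasurableSet O := (PiLp.volume_preserving_toLp (Fin d)).measurable hΩ.measurableSet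
  have hOV : volume O = volume Ω :=
    (PiLp.volume_preserving_toLp (Fin d)).measure_preimage hΩ.measurableSet.nullMeasurableSet
  have hOl : volume O < ENNReal.ofReal ((l/2)^d) := by
    rw [hOV, ← ENNReal.ofReal_toReal hv.ne, ← hV]
    refine (ENNReal.ofReal_lt_ofReal_iff (by positivity)).mpr ?_
    have h1 : (l/2)^d = 2^d * V := by
      have : l / 2 = 2 * V ^ (1 / (d:ℝ)) := by rw [hl]; ring
      rw [this, mul_pow, ← Real.rpow_natCast (V ^ (1 / (d:ℝ))), ← Real.rpow_mul hV0, one_div, inv_mul_cancel₀ hdp.ne', Real.rpow_one]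
    rw [h1]
    have h2 : (1:ℝ) < 2^d := one_lt_pow₀ (by norm_num) (by omega)
    nlinarith
  set F : (Fin d → ℝ) → ℝ := fun x => Λ - 4 * π^2 * ∑ i, x i ^ 2 with hF
  have hFc : Continuous F := by rw [hF]; fun_prop
  set S := semiclassicalConst d * Λ ^ (1 + (d:ℝ)/2) with hS
  have hlimF : Filter.Tendsto (fun n : ℕ => (∑ ξ ∈ Z n, F ξ) / (n:ℝ)^d) Filter.atTop (nhds S) := by
    rw [hS, ← IK.integral_eball d hd Λ hΛ]
    exact hlim F hFc
  have hlim1 : Filter.Tendsto (fun n : ℕ => ((Z n).card : ℝ) / (n:ℝ)^d) Filter.atTop (nhds (∫ x in IK.eball d R, (1:ℝ))) := by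
    have := hlim (fun _ => 1) continuous_const
    simpa using this
  have hout := IK.tendsto_outside O hOm (hOV ▸ hv) l
  set G : ℕ → ℝ := fun n => (1 - δ) + ((Z n).card : ℝ) / (n:ℝ)^d * (volume (O \ IK.ibox d n l)).toReal with hG
  have hGlim : Filter.Tendsto G Filter.atTop (nhds (1 - δ)) := by
    have := (hlim1.mul hout).const_add (1 - δ)
    simpa using this
  have hGpos : ∀ n, 0 < G n := by
    intro n
    have : 0 ≤ ((Z n).card : ℝ) / (n:ℝ)^d * (volume (O \ IK.ibox d n l)).toReal := by positivity
    simp only [hG]; linarith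
  have hS0 : 0 ≤ S := by
    rw [hS]; unfold semiclassicalConst
    have h1 : 0 < Real.Gamma (2 + (d:ℝ)/2) := Real.Gamma_pos_of_pos (by positivity)
    rw [Real.Gamma_two]
    positivity
  have hlimQ : Filter.Tendsto (fun n : ℕ => V * ((∑ ξ ∈ Z n, F ξ) / (n:ℝ)^d) / G n) Filter.atTop (nhds (V * S / (1 - δ))) :=
    (hlimF.const_mul V).div hGlim (by linarith)
  have htarget : V * S * (1 + δ) - ε < V * S / (1 - δ) := by
    have h1 : V * S * (1 + δ) ≤ V * S / (1 - δ) := by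
      rw [le_div_iff₀ (by linarith)]
      have : 0 ≤ V * S := by positivity
      nlinarith [sq_nonneg δ]
    linarith
  obtain ⟨n, hn1, hn0⟩ := ((hlimQ.eventually_const_lt htarget).and (Filter.eventually_gt_atTop 0)).exists
  have hnp : (0:ℝ) < (n:ℝ)^d := by
    have : (0:ℝ) < n := by exact_mod_cast hn0
    positivity
  have hbound := IK.main_bound Ω hΩ hv O hO (IK.ibox d n l) (IK.measurableSet_ibox d n l) (1 - δ) n (Z n) (by linarith) (by
    intro u
    rw [← hδX]
    exact hls X hXp n hn0 (Z n) (fun ξ hξ => (hZ n hn0 ξ hξ).2) u l hlp (O ∩ IK.ibox d n l)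
      (hOm.inter (IK.measurableSet_ibox d n l)) ((measure_mono Set.inter_subset_left).trans_lt hOl)
      (fun x hx => IK.ibox_sub hlp x hx.2) (fun ξ hξ => IK.freq_bound hlp hRp (hZ n hn0 ξ hξ).1))
  have hge : (1 - δ) * (n:ℝ)^d + (Z n).card * (volume (O \ IK.ibox d n l)).toReal = (n:ℝ)^d * G n := by
    simp only [hG]; field_simp
  rw [hge] at hbound
  obtain ⟨N, φ, h1, h2, h3, h4⟩ := IK.linalg Ω hv Λ hΛ (fun m : Z n => IK.pw (m : Fin d → ℝ))
    (fun m => IK.pw_contDiff _) (fun m => IK.pw_BC _) (fun m k => IK.pw_BC' _ k) ((n:ℝ)^d * G n)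
    (mul_pos hnp (hGpos n)) hbound
  refine ⟨N, φ, h1, h2, h3, ?_⟩
  set T := ∑ j : Fin N, (Λ - ∫ x in Ω, gradSq d (φ j) x) with hT
  have h5 : ∑ m : Z n, (Λ * (∫ x in Ω, ‖IK.pw (m : Fin d → ℝ) x‖^2) - ∫ x in Ω, gradSq d (IK.pw (m : Fin d → ℝ)) x) =
      V * ∑ ξ ∈ Z n, F ξ := by
    rw [Finset.mul_sum, ← Finset.sum_coe_sort (Z n)]
    refine Finset.sum_congr rfl fun m _ => ?_
    simp only [IK.norm_pw, IK.pw_gradSq, setIntegral_const, smul_eq_mul, Measure.real, hF]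
    rw [← hV]
    ring
  rw [h5] at h4
  have h6 : V * ((∑ ξ ∈ Z n, F ξ) / (n:ℝ)^d) / G n ≤ T := by
    rw [div_le_iff₀ (hGpos n), mul_div_assoc', div_le_iff₀ hnp]
    linarith
  have h7 : semiclassicalConst d * V * Λ ^ (1 + (d : ℝ) / 2) * (1 + δ) = V * S * (1 + δ) := by
    rw [hS]; ring
  rw [h7]
  exact hn1.trans_le h6
end

section
/- (Projection lemma, first inequality.) Let ℋ be a complex Hilbert space and let P, Q be bounded self-adjoint idempotent operators (orthogonal projections) on ℋ. Then for every g ∈ ℋ one has ‖PQg‖² · ‖(I − P)Qg‖² ≥ ‖Qg‖² · ‖(I − Q)(I − P)Qg‖², where I denotes the identity operator. -/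
open scoped InnerProductSpace

theorem proj_orth_aux {H : Type*} [NormedAddCommGroup H] [InnerProductSpace ℂ H] [CompleteSpace H]
    (T : H →L[ℂ] H) (hT : IsSelfAdjoint T) (hT2 : T ∘L T = T) (x : H) :
    inner ℂ (T x) (x - T x) = 0 ∧ ‖x‖ ^ 2 = ‖T x‖ ^ 2 + ‖x - T x‖ ^ 2 := by
  have hs := hT.isSymmetric
  have h2 : T (T x) = T x := congrArg (fun S : H →L[ℂ] H => S x) hT2
  have h0 : inner ℂ (T x) (x - T x) = 0 := by
    have h := hs x (x - T x)
    simp only [ContinuousLinearMap.coe_coe, map_sub, h2, sub_self, inner_zero_right] at h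
    exact h
  refine ⟨h0, ?_⟩
  have h := norm_add_sq_eq_norm_sq_add_norm_sq_of_inner_eq_zero (𝕜 := ℂ) (T x) (x - T x) h0
  rw [add_sub_cancel] at h
  nlinarith [h]

/-- **Projection lemma, first inequality.**
If `P, Q` are orthogonal projections (bounded self-adjoint idempotents) on a complex
Hilbert space `ℋ`, then for every `g` one has
`‖PQg‖² ‖(I − P)Qg‖² ≥ ‖Qg‖² ‖(I − Q)(I − P)Qg‖²`. -/
theorem projection_lemma_first
    {H : Type*} [NormedAddCommGroup H] [InnerProductSpace ℂ H] [CompleteSpace H]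
    (P Q : H →L[ℂ] H)
    (hP : IsSelfAdjoint P) (hP2 : P ∘L P = P)
    (hQ : IsSelfAdjoint Q) (hQ2 : Q ∘L Q = Q)
    (g : H) :
    ‖Q g‖ ^ 2 * ‖(ContinuousLinearMap.id ℂ H - Q) ((ContinuousLinearMap.id ℂ H - P) (Q g))‖ ^ 2
      ≤ ‖P (Q g)‖ ^ 2 * ‖(ContinuousLinearMap.id ℂ H - P) (Q g)‖ ^ 2 := by
  simp only [ContinuousLinearMap.sub_apply, ContinuousLinearMap.id_apply]
  have hu : Q (Q g) = Q g := congrArg (fun S : H →L[ℂ] H => S g) hQ2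
  obtain ⟨h1, h2⟩ := proj_orth_aux P hP hP2 (Q g)
  generalize Q g = u at *
  obtain ⟨-, h3⟩ := proj_orth_aux Q hQ hQ2 (u - P u)
  have h4 : inner ℂ u (Q (u - P u)) = ((‖u - P u‖ ^ 2 : ℝ) : ℂ) := by
    have h := hQ.isSymmetric u (u - P u)
    simp only [ContinuousLinearMap.coe_coe] at h
    rw [← h, hu]
    calc inner ℂ u (u - P u) = inner ℂ (P u + (u - P u)) (u - P u) := by rw [add_sub_cancel]
      _ = _ := by
        rw [inner_add_left, h1, zero_add, inner_self_eq_norm_sq_to_K]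
        push_cast
        rfl
  have h5 := norm_inner_le_norm (𝕜 := ℂ) u (Q (u - P u))
  rw [h4, Complex.norm_real, Real.norm_of_nonneg (by positivity)] at h5
  have h6 := pow_le_pow_left₀ (by positivity) h5 2
  rw [mul_pow] at h6
  have h7 : ‖u - P u - Q (u - P u)‖ ^ 2 = ‖u - P u‖ ^ 2 - ‖Q (u - P u)‖ ^ 2 := by linarith
  have h8 : ‖P u‖ ^ 2 = ‖u‖ ^ 2 - ‖u - P u‖ ^ 2 := by linarith
  rw [h7, h8]
  linarith
end

section
/- (Aizenman–Lieb identity for eigenvalue sequences.) Let γ > 1, let Λ ≥ 0 and let (λ_n)_{n ∈ ℕ} be a sequence of nonnegative real numbers. Then, as an identity in [0, ∞], Σ_{n} (λ_n − Λ)_−^γ = γ(γ−1) ∫_0^Λ (Λ − λ)^{γ−2} ( Σ_{n} (λ_n − λ)_− ) dλ, where x_− := max(−x, 0), so that (λ_n − Λ)_− = max(Λ − λ_n, 0). -/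
open MeasureTheory
open scoped ENNReal

/-- The single-eigenvalue real integral. -/
lemma al_real (γ : ℝ) (hγ : 1 < γ) (c : ℝ) (hc : 0 < c) :
    IntervalIntegrable (fun u : ℝ => u ^ (γ - 2) * (c - u)) volume 0 c ∧
    γ * (γ - 1) * ∫ u in (0 : ℝ)..c, u ^ (γ - 2) * (c - u) = c ^ γ := by
  have h1 : IntervalIntegrable (fun u : ℝ => u ^ (γ - 2)) volume 0 c :=
    intervalIntegral.intervalIntegrable_rpow' (by linarith)
  refine ⟨h1.mul_continuousOn (by fun_prop), ?_⟩
  have h2 : IntervalIntegrable (fun u : ℝ => u ^ (γ - 1)) volume 0 c :=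
    intervalIntegral.intervalIntegrable_rpow' (by linarith)
  have e : ∫ u in (0 : ℝ)..c, u ^ (γ - 2) * (c - u)
      = ∫ u in (0 : ℝ)..c, (c * u ^ (γ - 2) - u ^ (γ - 1)) := by
    apply intervalIntegral.integral_congr_ae
    refine Filter.Eventually.of_forall fun u hu => ?_
    rw [Set.uIoc_of_le hc.le] at hu
    have : u ^ (γ - 1) = u ^ (γ - 2) * u := by
      rw [← Real.rpow_add_one hu.1.ne']; congr 1; ring
    rw [this]; ring
  have g1 : γ - 1 ≠ 0 := by linarith
  have g0 : γ ≠ 0 := by linarith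
  rw [e, intervalIntegral.integral_sub (h1.const_mul c) h2, intervalIntegral.integral_const_mul,
    integral_rpow (Or.inl (by linarith)), integral_rpow (Or.inl (by linarith))]
  have i1 : γ - 2 + 1 = γ - 1 := by ring
  have i2 : γ - 1 + 1 = γ := by ring
  rw [i1, i2, Real.zero_rpow g1, Real.zero_rpow g0]
  have : c ^ γ = c ^ (γ - 1) * c := by
    rw [← Real.rpow_add_one hc.ne']; congr 1; ring
  rw [this]
  field_simp
  ring

/-- The single-eigenvalue identity. -/
lemma al_single (γ : ℝ) (hγ : 1 < γ) (Λ : ℝ) (a : ℝ) (ha : 0 ≤ a) :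
    ENNReal.ofReal (max (Λ - a) 0 ^ γ) = ENNReal.ofReal (γ * (γ - 1)) *
      ∫⁻ l in Set.Ioo (0 : ℝ) Λ,
        ENNReal.ofReal ((Λ - l) ^ (γ - 2)) * ENNReal.ofReal (max (l - a) 0) := by
  rcases le_or_gt Λ a with h | h
  · rw [max_eq_right (by linarith), Real.zero_rpow (by linarith)]
    rw [setLIntegral_congr_fun (g := fun _ => 0) measurableSet_Ioo]
    · simp
    · intro l hl
      have : max (l - a) 0 = 0 := max_eq_right (by linarith [hl.2])
      simp [this]
  · obtain ⟨hi, he⟩ := al_real γ hγ (Λ - a) (by linarith)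
    have hi' : IntervalIntegrable (fun l : ℝ => (Λ - l) ^ (γ - 2) * (l - a)) volume a Λ := by
      have := (hi.comp_sub_left Λ).symm
      simp only [sub_zero, sub_sub_cancel] at this
      refine this.congr (fun l _ => ?_)
      ring_nf
    have he' : ∫ l in a..Λ, (Λ - l) ^ (γ - 2) * (l - a)
        = ∫ u in (0 : ℝ)..(Λ - a), u ^ (γ - 2) * (Λ - a - u) := by
      have := intervalIntegral.integral_comp_sub_left (a := a) (b := Λ)
        (fun u : ℝ => u ^ (γ - 2) * (Λ - a - u)) Λ
      rw [sub_self] at this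
      rw [← this]
      refine intervalIntegral.integral_congr fun l _ => ?_
      ring_nf
    have hl : ∫⁻ l in Set.Ioo (0 : ℝ) Λ,
        ENNReal.ofReal ((Λ - l) ^ (γ - 2)) * ENNReal.ofReal (max (l - a) 0)
        = ∫⁻ l in Set.Ioo a Λ, ENNReal.ofReal ((Λ - l) ^ (γ - 2) * (l - a)) := by
      rw [← lintegral_indicator measurableSet_Ioo, ← lintegral_indicator measurableSet_Ioo]
      congr 1
      ext l
      by_cases h1 : l ∈ Set.Ioo a Λ
      · have h2 : l ∈ Set.Ioo 0 Λ := ⟨ha.trans_lt h1.1, h1.2⟩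
        rw [Set.indicator_of_mem h1, Set.indicator_of_mem h2,
          max_eq_left (by linarith [h1.1]), ENNReal.ofReal_mul]
        exact Real.rpow_nonneg (by linarith [h1.2]) _
      · rw [Set.indicator_of_notMem h1]
        by_cases h2 : l ∈ Set.Ioo 0 Λ
        · have : l ≤ a := by
            by_contra h3
            exact h1 ⟨not_le.1 h3, h2.2⟩
          rw [Set.indicator_of_mem h2, max_eq_right (by linarith)]
          simp
        · rw [Set.indicator_of_notMem h2]
    rw [hl, max_eq_left (by linarith), ← he, ← he', intervalIntegral.integral_of_le h.le,
      integral_Ioc_eq_integral_Ioo, ENNReal.ofReal_mul (by nlinarith),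
      ofReal_integral_eq_lintegral_ofReal]
    · exact (intervalIntegrable_iff_integrableOn_Ioo_of_le h.le).1 hi'
    · refine (ae_restrict_iff' measurableSet_Ioo).2 (Filter.Eventually.of_forall fun l hl => ?_)
      exact mul_nonneg (Real.rpow_nonneg (by linarith [hl.2]) _) (by linarith [hl.1])

/-- **Aizenman–Lieb identity for eigenvalue sequences.**
For `γ > 1`, `Λ ≥ 0` and a sequence `(λ_n)` of nonnegative reals, one has, as an identity
in `[0,∞]`,
`Σ_n (λ_n − Λ)_−^γ = γ(γ−1) ∫_0^Λ (Λ − λ)^{γ−2} (Σ_n (λ_n − λ)_−) dλ`,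
where `x_− = max (−x) 0`, so `(λ_n − Λ)_− = max (Λ − λ_n) 0`. -/
theorem aizenman_lieb_identity
    (γ : ℝ) (hγ : 1 < γ) (Λ : ℝ) (hΛ : 0 ≤ Λ)
    (lam : ℕ → ℝ) (hlam : ∀ n, 0 ≤ lam n) :
    ∑' n : ℕ, ENNReal.ofReal (max (Λ - lam n) 0 ^ γ)
      = ENNReal.ofReal (γ * (γ - 1)) *
        ∫⁻ l in Set.Ioo (0 : ℝ) Λ,
          ENNReal.ofReal ((Λ - l) ^ (γ - 2)) *
            ∑' n : ℕ, ENNReal.ofReal (max (l - lam n) 0) := by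
  simp_rw [← ENNReal.tsum_mul_left]
  rw [lintegral_tsum (fun n => by fun_prop), ← ENNReal.tsum_mul_left]
  exact tsum_congr fun n => al_single γ hγ Λ (lam n) (hlam n)
end
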